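/- Achievability part of Theorem 1: every rate tuple (R_I, R_C, L, R_S) in the single-letter region S_1 belongs to the operational identification-compression-leakage-keyrate region R_1; that is, if there exist finite random variables U, V with joint law of the form P_{X,Y,Z} P_{V|X} P_{U|V} (so U − V − X − (Y,Z) is a Markov chain) such that R_I ≤ I(Y;U), R_C ≥ R_I + I(X;V|Y), L ≥ I(X;V,Y) − I(X;Y|U) + I(X;Z|U) and R_S ≤ I(V;Y|U) − I(V;Z|U), then (R_I, R_C, L, R_S) is achievable. -/

import Mathlib

open Finset Real

/- Probability mass of the event `X = x` under the pmf `μ` on a finite sample space. -/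
open Classical in
noncomputable def pmass {Ω α : Type*} [Fintype Ω] (μ : Ω → ℝ) (X : Ω → α) (x : α) : ℝ :=
  ∑ ω, if X ω = x then μ ω else 0

/-- Shannon entropy (in bits) of the random variable `X` under the pmf `μ`. -/
noncomputable def ent {Ω α : Type*} [Fintype Ω] [Fintype α] (μ : Ω → ℝ) (X : Ω → α) : ℝ :=
  ∑ x, -(pmass μ X x * Real.logb 2 (pmass μ X x))

/-- Conditional Shannon entropy `H(X | Y)` (in bits). -/
noncomputable def condEnt {Ω α β : Type*} [Fintype Ω] [Fintype α] [Fintype β]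
    (μ : Ω → ℝ) (X : Ω → α) (Y : Ω → β) : ℝ :=
  ent μ (fun ω => (X ω, Y ω)) - ent μ Y

/-- Mutual information `I(X;Y)` (in bits). -/
noncomputable def mutInf {Ω α β : Type*} [Fintype Ω] [Fintype α] [Fintype β]
    (μ : Ω → ℝ) (X : Ω → α) (Y : Ω → β) : ℝ :=
  ent μ X + ent μ Y - ent μ (fun ω => (X ω, Y ω))

/-- Conditional mutual information `I(X;Y|Z)` (in bits). -/
noncomputable def condMutInf {Ω α β γ : Type*} [Fintype Ω] [Fintype α] [Fintype β] [Fintype γ]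
    (μ : Ω → ℝ) (X : Ω → α) (Y : Ω → β) (Z : Ω → γ) : ℝ :=
  ent μ (fun ω => (X ω, Z ω)) + ent μ (fun ω => (Y ω, Z ω))
    - ent μ (fun ω => (X ω, Y ω, Z ω)) - ent μ Z

/- Probability of the event `A` under the pmf `μ`. -/
open Classical in
noncomputable def prob {Ω : Type*} [Fintype Ω] (μ : Ω → ℝ) (A : Ω → Prop) : ℝ :=
  ∑ ω, if A ω then μ ω else 0

/-- `μ` is a probability mass function on the finite set `Ω`. -/
def IsPMF {Ω : Type*} [Fintype Ω] (μ : Ω → ℝ) : Prop :=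
  (∀ ω, 0 ≤ μ ω) ∧ ∑ ω, μ ω = 1

/-- Binary entropy function (bits). -/
noncomputable def binH (t : ℝ) : ℝ :=
  -(t * Real.logb 2 t) - (1 - t) * Real.logb 2 (1 - t)
/-- An `(|ℳ|,|𝒲|,|𝒮|,n)`-code: per-user stochastic encoders producing a stored
description and a secret key, together with identification and authentication decoders. -/
structure IACode (𝒳 𝒴 : Type) (n Mc Wc Sc : ℕ) where
  enc : Fin Wc → (Fin n → 𝒳) → Fin Mc × Fin Sc → ℝ
  enc_pmf : ∀ w xs, IsPMF (enc w xs)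
  gId : (Fin Wc → Fin Mc) → (Fin n → 𝒴) → Fin Wc
  gAu : (Fin Wc → Fin Mc) → (Fin n → 𝒴) → Fin Sc

/-- Sample space: all users' source sequences, all users' (description, key) pairs,
and the measurement/side-information sequence `(Y^n, Z^n)`. -/
abbrev CodeSpace (𝒳 𝒴 𝒵 : Type) (n Mc Wc Sc : ℕ) : Type :=
  (Fin Wc → Fin n → 𝒳) × (Fin Wc → Fin Mc × Fin Sc) × (Fin n → 𝒴 × 𝒵)

/-- Joint pmf of all the random variables of the system, conditioned on user `w`
being presented: the source sequences are i.i.d. `PX` and independent across users,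
the encoders act on them, and `(Y^n,Z^n)` is the output of `n` independent uses of
the channel `Q` with input `X^n(w)`. -/
noncomputable def codeDist {𝒳 𝒴 𝒵 : Type} [Fintype 𝒳] (PX : 𝒳 → ℝ) (Q : 𝒳 → 𝒴 × 𝒵 → ℝ)
    {n Mc Wc Sc : ℕ} (C : IACode 𝒳 𝒴 n Mc Wc Sc) (w : Fin Wc) :
    CodeSpace 𝒳 𝒴 𝒵 n Mc Wc Sc → ℝ :=
  fun ω => (∏ w', ∏ i, PX (ω.1 w' i)) * (∏ w', C.enc w' (ω.1 w') (ω.2.1 w')) *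
    (∏ i, Q (ω.1 w i) (ω.2.2 i))

/-- The stored database `M̄ = (M(1),…,M(K))`. -/
def Mbar {𝒳 𝒴 𝒵 : Type} {n Mc Wc Sc : ℕ} (ω : CodeSpace 𝒳 𝒴 𝒵 n Mc Wc Sc) :
    Fin Wc → Fin Mc := fun w => (ω.2.1 w).1

/-- The measurement sequence `Y^n`. -/
def Yseq {𝒳 𝒴 𝒵 : Type} {n Mc Wc Sc : ℕ} (ω : CodeSpace 𝒳 𝒴 𝒵 n Mc Wc Sc) :
    Fin n → 𝒴 := fun i => (ω.2.2 i).1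

/-- The adversary's side-information sequence `Z^n`. -/
def Zseq {𝒳 𝒴 𝒵 : Type} {n Mc Wc Sc : ℕ} (ω : CodeSpace 𝒳 𝒴 𝒵 n Mc Wc Sc) :
    Fin n → 𝒵 := fun i => (ω.2.2 i).2

/-- Single-letter joint distribution of `(U,V,X,Y,Z)` of the form
`P_{X,Y,Z} P_{V|X} P_{U|V}`, i.e. `U - V - X - (Y,Z)` is a Markov chain. -/
noncomputable def slDist {𝒰 𝒱 𝒳 𝒴 𝒵 : Type}
    (PX : 𝒳 → ℝ) (Q : 𝒳 → 𝒴 × 𝒵 → ℝ) (PVX : 𝒳 → 𝒱 → ℝ) (PUV : 𝒱 → 𝒰 → ℝ) :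
    𝒰 × 𝒱 × 𝒳 × 𝒴 × 𝒵 → ℝ :=
  fun ω => PX ω.2.2.1 * PVX ω.2.2.1 ω.2.1 * PUV ω.2.1 ω.1 * Q ω.2.2.1 (ω.2.2.2.1, ω.2.2.2.2)
/-- Achievability of a tuple `(R_I, R_C, L, R_S)` for secret key-based
identification/authentication with a privacy constraint (Definition 2). -/
def Achievable1 {𝒳 𝒴 𝒵 : Type} [Fintype 𝒳] [Fintype 𝒴] [Fintype 𝒵]
    (PX : 𝒳 → ℝ) (Q : 𝒳 → 𝒴 × 𝒵 → ℝ) (RI RC L RS : ℝ) : Prop :=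
  ∀ δ : ℝ, 0 < δ →
    ∃ (Mc Wc Sc : ℕ → ℕ) (Cn : ∀ n : ℕ, IACode 𝒳 𝒴 n (Mc n) (Wc n) (Sc n)) (N : ℕ),
      ∀ n : ℕ, N ≤ n →
        -- maximal identification/authentication error probability
        (∀ w : Fin (Wc n),
          prob (codeDist PX Q (Cn n) w (𝒵 := 𝒵))
            (fun ω => ¬ ((Cn n).gId (Mbar ω) (Yseq ω) = w ∧
              (Cn n).gAu (Mbar ω) (Yseq ω) = (ω.2.1 w).2)) ≤ δ) ∧
        -- identification rate
        RI - δ ≤ (1 / (n : ℝ)) * Real.logb 2 (Wc n) ∧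
        -- compression rate
        (1 / (n : ℝ)) * Real.logb 2 (Mc n) ≤ RC + δ ∧
        -- information leakage rate (maximum over users)
        (∀ w : Fin (Wc n),
          (1 / (n : ℝ)) * mutInf (codeDist PX Q (Cn n) w (𝒵 := 𝒵))
            (fun ω => ω.1 w) (fun ω => (Mbar ω, Zseq ω)) ≤ L + δ) ∧
        -- key leakage rate (maximum over users)
        (∀ w : Fin (Wc n),
          (1 / (n : ℝ)) * mutInf (codeDist PX Q (Cn n) w (𝒵 := 𝒵))
            (fun ω => (ω.2.1 w).2) (fun ω => (Mbar ω, Zseq ω)) ≤ δ) ∧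
        -- secret key rate (minimum over users)
        (∀ w : Fin (Wc n),
          RS - δ ≤ (1 / (n : ℝ)) * ent (codeDist PX Q (Cn n) w (𝒵 := 𝒵))
            (fun ω => (ω.2.1 w).2))

/-! ### Indicators and finite probability mass functions -/

open Classical in
/-- The real-valued indicator of a proposition. -/
noncomputable def ind (P : Prop) : ℝ := if P then 1 else 0

lemma ind_of_true {P : Prop} (h : P) : ind P = 1 := if_pos h

lemma ind_of_false {P : Prop} (h : ¬ P) : ind P = 0 := if_neg h

lemma ind_nonneg (P : Prop) : 0 ≤ ind P := by
  unfold ind; split_ifs <;> norm_num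

lemma ind_le_one (P : Prop) : ind P ≤ 1 := by
  unfold ind; split_ifs <;> norm_num

lemma ind_mono {P R : Prop} (h : P → R) : ind P ≤ ind R := by
  by_cases hP : P
  · rw [ind_of_true hP, ind_of_true (h hP)]
  · rw [ind_of_false hP]; exact ind_nonneg R

lemma ind_and (P R : Prop) : ind (P ∧ R) = ind P * ind R := by
  by_cases hP : P <;> by_cases hR : R <;> simp [ind, hP, hR]

lemma ind_not (P : Prop) : ind (¬ P) = 1 - ind P := by
  by_cases hP : P <;> simp [ind, hP]

lemma ind_or_le (P R : Prop) : ind (P ∨ R) ≤ ind P + ind R := by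
  by_cases hP : P <;> by_cases hR : R <;> simp [ind, hP, hR]

lemma ind_exists_le {ι : Type*} [Fintype ι] (P : ι → Prop) : ind (∃ i, P i) ≤ ∑ i, ind (P i) := by
  by_cases h : ∃ i, P i
  · obtain ⟨i, hi⟩ := h
    calc ind (∃ i, P i) ≤ ind (P i) := by rw [ind_of_true hi]; exact ind_le_one _
      _ ≤ ∑ i, ind (P i) := single_le_sum (fun i _ => ind_nonneg (P i)) (mem_univ i)
  · rw [ind_of_false h]; exact sum_nonneg fun i _ => ind_nonneg _

lemma sum_ind_eq {α : Type*} [Fintype α] (a : α) (g : α → ℝ) :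
    ∑ b, ind (a = b) * g b = g a := by
  rw [Fintype.sum_eq_single a]
  · simp [ind]
  · intro b hb; rw [ind_of_false (Ne.symm hb), zero_mul]

section Pmass

variable {Ω α β γ : Type*} [Fintype Ω]

lemma pmass_eq (μ : Ω → ℝ) (X : Ω → α) (x : α) : pmass μ X x = ∑ ω, μ ω * ind (X ω = x) := by
  unfold pmass ind
  exact sum_congr rfl fun ω _ => by split_ifs <;> simp

lemma prob_eq (μ : Ω → ℝ) (A : Ω → Prop) : prob μ A = ∑ ω, μ ω * ind (A ω) := by
  unfold prob ind
  exact sum_congr rfl fun ω _ => by split_ifs <;> simp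

lemma pmass_nonneg {μ : Ω → ℝ} (hμ : ∀ ω, 0 ≤ μ ω) (X : Ω → α) (x : α) : 0 ≤ pmass μ X x := by
  rw [pmass_eq]; exact sum_nonneg fun ω _ => mul_nonneg (hμ ω) (ind_nonneg _)

lemma le_pmass {μ : Ω → ℝ} (hμ : ∀ ω, 0 ≤ μ ω) (X : Ω → α) (ω : Ω) : μ ω ≤ pmass μ X (X ω) := by
  rw [pmass_eq]
  calc μ ω = μ ω * ind (X ω = X ω) := by rw [ind_of_true rfl, mul_one]
    _ ≤ _ := single_le_sum (f := fun ω' => μ ω' * ind (X ω' = X ω))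
      (fun i _ => mul_nonneg (hμ i) (ind_nonneg _)) (mem_univ ω)

lemma pmass_pos {μ : Ω → ℝ} (hμ : ∀ ω, 0 ≤ μ ω) (X : Ω → α) {ω : Ω} (h : μ ω ≠ 0) :
    0 < pmass μ X (X ω) :=
  lt_of_lt_of_le (lt_of_le_of_ne (hμ ω) (Ne.symm h)) (le_pmass hμ X ω)

lemma sum_pmass_mul [Fintype α] (μ : Ω → ℝ) (X : Ω → α) (g : α → ℝ) :
    ∑ a, pmass μ X a * g a = ∑ ω, μ ω * g (X ω) := by
  simp_rw [pmass_eq, sum_mul]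
  rw [sum_comm]
  refine sum_congr rfl fun ω _ => ?_
  simp_rw [mul_assoc]
  rw [← mul_sum, sum_ind_eq]

lemma isPMF_pmass [Fintype α] {μ : Ω → ℝ} (hμ : IsPMF μ) (X : Ω → α) : IsPMF (pmass μ X) := by
  refine ⟨pmass_nonneg hμ.1 X, ?_⟩
  have := sum_pmass_mul μ X (fun _ => 1)
  simpa [hμ.2] using this

lemma pmass_map [Fintype α] (μ : Ω → ℝ) (F : Ω → α) (X : α → β) (b : β) :
    pmass (pmass μ F) X b = pmass μ (fun ω => X (F ω)) b := by
  rw [pmass_eq, sum_pmass_mul μ F (fun a => ind (X a = b)), pmass_eq]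

lemma pmass_id (μ : Ω → ℝ) (ω : Ω) : pmass μ (fun ω' => ω') ω = μ ω := by
  rw [pmass_eq]
  have := sum_ind_eq ω μ
  rw [← this]
  refine sum_congr rfl fun ω' _ => ?_
  rw [mul_comm]; congr 2; exact propext eq_comm

lemma pmass_congr {μ : Ω → ℝ} {X X' : Ω → α} (h : ∀ ω, μ ω ≠ 0 → X ω = X' ω) (a : α) :
    pmass μ X a = pmass μ X' a := by
  simp_rw [pmass_eq]
  refine sum_congr rfl fun ω _ => ?_
  by_cases hω : μ ω = 0
  · simp [hω]
  · rw [h ω hω]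

lemma sum_pmass_fst [Fintype α] [Fintype β] (μ : Ω → ℝ) (X : Ω → α) (Y : Ω → β) (b : β) :
    ∑ a, pmass μ (fun ω => (X ω, Y ω)) (a, b) = pmass μ Y b := by
  simp_rw [pmass_eq]
  rw [sum_comm]
  refine sum_congr rfl fun ω _ => ?_
  simp_rw [Prod.mk.injEq, ind_and]
  rw [← mul_sum, sum_ind_eq (X ω) (fun _ => ind (Y ω = b))]

/-! ### Entropy -/

lemma ent_eq [Fintype α] (μ : Ω → ℝ) (X : Ω → α) :
    ent μ X = -∑ ω, μ ω * logb 2 (pmass μ X (X ω)) := by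
  unfold ent
  rw [sum_neg_distrib, sum_pmass_mul μ X (fun a => logb 2 (pmass μ X a))]

lemma ent_map [Fintype α] [Fintype β] (μ : Ω → ℝ) (F : Ω → α) (X : α → β) :
    ent (pmass μ F) X = ent μ (fun ω => X (F ω)) := by
  unfold ent
  simp_rw [pmass_map]

lemma ent_congr [Fintype α] {μ : Ω → ℝ} {X X' : Ω → α} (h : ∀ ω, μ ω ≠ 0 → X ω = X' ω) :
    ent μ X = ent μ X' := by
  unfold ent
  simp_rw [pmass_congr h]

/-- Entropy depends only on the partition of the sample space induced by the variable. -/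
lemma ent_congr_iff [Fintype α] [Fintype β] (μ : Ω → ℝ) {X : Ω → α} {X' : Ω → β}
    (h : ∀ ω ω', X ω = X ω' ↔ X' ω = X' ω') : ent μ X = ent μ X' := by
  rw [ent_eq, ent_eq]
  congr 1
  refine sum_congr rfl fun ω _ => ?_
  simp_rw [pmass_eq, h]

lemma ent_const [Fintype α] {μ : Ω → ℝ} (hμ : IsPMF μ) (a : α) : ent μ (fun _ => a) = 0 := by
  rw [ent_eq, neg_eq_zero]
  refine sum_eq_zero fun ω _ => ?_
  rw [pmass_eq]
  simp [ind, hμ.2]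

/-- The conditional Gibbs inequality: a conditional entropy is at most the corresponding cross
entropy with respect to any sub-probability kernel. -/
lemma ent_pair_sub_le_cross [Fintype α] [Fintype β] {μ : Ω → ℝ} (hμ : IsPMF μ) (X : Ω → α)
    (T : Ω → β) (q : α → β → ℝ) (hq0 : ∀ a b, 0 ≤ q a b) (hq1 : ∀ b, ∑ a, q a b ≤ 1)
    (hq : ∀ ω, μ ω ≠ 0 → 0 < q (X ω) (T ω)) :
    ent μ (fun ω => (X ω, T ω)) - ent μ T ≤ -∑ ω, μ ω * logb 2 (q (X ω) (T ω)) := by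
  set pXT := pmass μ (fun ω => (X ω, T ω)) with hpXT
  set pT := pmass μ T with hpT
  have hlog2 : 0 < Real.log 2 := Real.log_pos one_lt_two
  have key : ∑ ω, μ ω * (logb 2 (q (X ω) (T ω)) + logb 2 (pT (T ω)) - logb 2 (pXT (X ω, T ω)))
      ≤ 0 := by
    have step : ∀ ω, μ ω * (logb 2 (q (X ω) (T ω)) + logb 2 (pT (T ω)) - logb 2 (pXT (X ω, T ω)))
        ≤ μ ω * ((q (X ω) (T ω) * pT (T ω) / pXT (X ω, T ω) - 1) / Real.log 2) := by
      intro ω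
      by_cases h : μ ω = 0
      · simp [h]
      refine mul_le_mul_of_nonneg_left ?_ (hμ.1 ω)
      have h1 := hq ω h
      have h2 : 0 < pT (T ω) := pmass_pos hμ.1 T h
      have h3 : 0 < pXT (X ω, T ω) := pmass_pos hμ.1 (fun ω => (X ω, T ω)) h
      rw [← logb_mul h1.ne' h2.ne', ← logb_div (mul_pos h1 h2).ne' h3.ne', logb]
      gcongr
      exact Real.log_le_sub_one_of_pos (by positivity)
    refine (sum_le_sum fun ω _ => step ω).trans ?_
    have e1 : ∑ ω, μ ω * ((q (X ω) (T ω) * pT (T ω) / pXT (X ω, T ω) - 1) / Real.log 2)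
        = (∑ ω, μ ω * (q (X ω) (T ω) * pT (T ω) / pXT (X ω, T ω)) - 1) / Real.log 2 := by
      simp_rw [← mul_div_assoc, ← sum_div, mul_sub, mul_one, sum_sub_distrib, hμ.2, mul_div_assoc]
    rw [e1]
    have e2 : ∑ ω, μ ω * (q (X ω) (T ω) * pT (T ω) / pXT (X ω, T ω)) ≤ 1 := by
      rw [← sum_pmass_mul μ (fun ω => (X ω, T ω)) (fun z => q z.1 z.2 * pT z.2 / pXT z)]
      calc _ ≤ ∑ z : α × β, q z.1 z.2 * pT z.2 := by
            refine sum_le_sum fun z _ => ?_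
            change pXT z * _ ≤ _
            have hz : 0 ≤ q z.1 z.2 * pT z.2 := mul_nonneg (hq0 _ _) (pmass_nonneg hμ.1 _ _)
            by_cases h : pXT z = 0
            · simpa [h] using hz
            · rw [mul_div_cancel₀ _ h]
        _ = ∑ b, (∑ a, q a b) * pT b := by
            rw [Fintype.sum_prod_type_right]
            simp_rw [sum_mul]
        _ ≤ ∑ b, 1 * pT b := by
            refine sum_le_sum fun b _ => ?_
            exact mul_le_mul_of_nonneg_right (hq1 b) (pmass_nonneg hμ.1 _ _)
        _ = 1 := by simpa using (isPMF_pmass hμ T).2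
    exact div_nonpos_of_nonpos_of_nonneg (by linarith) hlog2.le
  rw [ent_eq, ent_eq]
  have e3 : ∑ ω, μ ω * (logb 2 (q (X ω) (T ω)) + logb 2 (pT (T ω)) - logb 2 (pXT (X ω, T ω)))
      = ∑ ω, μ ω * logb 2 (q (X ω) (T ω)) + ∑ ω, μ ω * logb 2 (pT (T ω))
        - ∑ ω, μ ω * logb 2 (pXT (X ω, T ω)) := by
    rw [← sum_add_distrib, ← sum_sub_distrib]
    exact sum_congr rfl fun ω _ => by ring
  rw [e3] at key
  linarith

/-- Submodularity of entropy. -/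
lemma ent_submodular [Fintype α] [Fintype β] [Fintype γ] {μ : Ω → ℝ} (hμ : IsPMF μ)
    (X : Ω → α) (Y : Ω → β) (Z : Ω → γ) :
    ent μ (fun ω => (X ω, Y ω, Z ω)) + ent μ Z
      ≤ ent μ (fun ω => (X ω, Z ω)) + ent μ (fun ω => (Y ω, Z ω)) := by
  have h := ent_pair_sub_le_cross hμ X (fun ω => (Y ω, Z ω))
    (fun a b => pmass μ (fun ω => (X ω, Z ω)) (a, b.2) / pmass μ Z b.2)
    (fun a b => div_nonneg (pmass_nonneg hμ.1 _ _) (pmass_nonneg hμ.1 _ _))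
    (fun b => by
      rw [← sum_div, sum_pmass_fst]; exact div_self_le_one _)
    (fun ω h => div_pos (pmass_pos hμ.1 (fun ω => (X ω, Z ω)) h) (pmass_pos hμ.1 Z h))
  have e : ∑ ω, μ ω * logb 2 (pmass μ (fun ω => (X ω, Z ω)) (X ω, Z ω) / pmass μ Z (Z ω))
      = ∑ ω, μ ω * logb 2 (pmass μ (fun ω => (X ω, Z ω)) (X ω, Z ω))
        - ∑ ω, μ ω * logb 2 (pmass μ Z (Z ω)) := by
    rw [← sum_sub_distrib]
    refine sum_congr rfl fun ω _ => ?_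
    by_cases hω : μ ω = 0
    · simp [hω]
    · rw [logb_div (pmass_pos hμ.1 (fun ω => (X ω, Z ω)) hω).ne' (pmass_pos hμ.1 Z hω).ne']
      ring
  have h1 := ent_eq μ (fun ω => (X ω, Z ω))
  have h2 := ent_eq μ Z
  simp only at h
  rw [e] at h
  linarith

/-- Data processing: replacing the second variable by one that it determines does not increase
mutual information. -/
lemma mutInf_le_of_determines [Fintype α] [Fintype β] [Fintype γ] {μ : Ω → ℝ} (hμ : IsPMF μ)
    (X : Ω → α) (Y : Ω → β) (Z : Ω → γ) (h : ∀ ω ω', Y ω = Y ω' → Z ω = Z ω') :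
    mutInf μ X Z ≤ mutInf μ X Y := by
  have h1 := ent_submodular hμ X Y Z
  have h2 : ent μ (fun ω => (X ω, Y ω, Z ω)) = ent μ (fun ω => (X ω, Y ω)) :=
    ent_congr_iff μ fun ω ω' => by
      simp only [Prod.mk.injEq]
      exact ⟨fun hh => ⟨hh.1, hh.2.1⟩, fun hh => ⟨hh.1, hh.2, h _ _ hh.2⟩⟩
  have h3 : ent μ (fun ω => (Y ω, Z ω)) = ent μ Y :=
    ent_congr_iff μ fun ω ω' => by
      simp only [Prod.mk.injEq]
      exact ⟨fun hh => hh.1, fun hh => ⟨hh, h _ _ hh⟩⟩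
  unfold mutInf
  linarith

/-- A list-decoding form of Fano's inequality: if, outside an event of probability `τ`, the value
of `X` lies in a list of size at most `N` determined by `T`, then `H(X | T)` is at most
`1 + log N + τ log |α|`. -/
lemma ent_pair_sub_le_of_list [Fintype α] [Fintype β] [Nonempty α] {μ : Ω → ℝ} (hμ : IsPMF μ)
    (X : Ω → α) (T : Ω → β) (A : α → β → Prop) {N τ : ℝ} (hN : 1 ≤ N)
    (hA : ∀ b, ∑ a, ind (A a b) ≤ N) (hτ : prob μ (fun ω => ¬ A (X ω) (T ω)) ≤ τ) :
    ent μ (fun ω => (X ω, T ω)) - ent μ T ≤ 1 + logb 2 N + τ * logb 2 (Fintype.card α) := by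
  have hN0 : 0 < N := by linarith
  have hc : (1 : ℝ) ≤ Fintype.card α := by exact_mod_cast Fintype.card_pos
  have hc0 : (0 : ℝ) < Fintype.card α := by linarith
  have hlN : 0 ≤ logb 2 N := logb_nonneg one_lt_two hN
  have hlc : 0 ≤ logb 2 (Fintype.card α : ℝ) := logb_nonneg one_lt_two hc
  have h := ent_pair_sub_le_cross hμ X T
    (fun a b => 1 / 2 * (ind (A a b) / N) + 1 / 2 * (1 / Fintype.card α))
    (fun a b => by have := ind_nonneg (A a b); positivity)
    (fun b => by
      rw [sum_add_distrib, ← mul_sum, ← sum_div, sum_const, card_univ, nsmul_eq_mul]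
      have h1 : (∑ a, ind (A a b)) / N ≤ 1 := by rw [div_le_one hN0]; exact hA b
      have h2 : (Fintype.card α : ℝ) * (1 / 2 * (1 / Fintype.card α)) = 1 / 2 := by field_simp
      linarith)
    (fun ω _ => by have := ind_nonneg (A (X ω) (T ω)); positivity)
  refine h.trans ?_
  rw [← sum_neg_distrib]
  have step : ∀ ω, -(μ ω * logb 2 (1 / 2 * (ind (A (X ω) (T ω)) / N)
      + 1 / 2 * (1 / (Fintype.card α : ℝ))))
      ≤ μ ω * (1 + logb 2 N) + μ ω * ind (¬ A (X ω) (T ω)) * logb 2 (Fintype.card α) := by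
    intro ω
    have aux : ∀ t r : ℝ, 0 < r → 1 / 2 * (1 / r) ≤ t → -logb 2 t ≤ 1 + logb 2 r := by
      intro t r hr ht
      have h1 : logb 2 (1 / 2 * (1 / r)) ≤ logb 2 t :=
        logb_le_logb_of_le one_lt_two (by positivity) ht
      have h2 : logb 2 (1 / 2 * (1 / r)) = -1 - logb 2 r := by
        rw [logb_mul (by norm_num) (by positivity), one_div, one_div, logb_inv, logb_inv,
          logb_self_eq_one one_lt_two]
        ring
      linarith
    by_cases hA' : A (X ω) (T ω)
    · rw [ind_of_true hA', ind_of_false (not_not.2 hA')]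
      have := aux (1 / 2 * (1 / N) + 1 / 2 * (1 / (Fintype.card α : ℝ))) N hN0
        (by have : 0 ≤ 1 / 2 * (1 / (Fintype.card α : ℝ)) := by positivity
            linarith)
      nlinarith [hμ.1 ω]
    · rw [ind_of_false hA', ind_of_true hA']
      have := aux (1 / 2 * (0 / N) + 1 / 2 * (1 / (Fintype.card α : ℝ))) _ hc0 (by simp)
      have h3 : 0 ≤ μ ω * logb 2 N := mul_nonneg (hμ.1 ω) hlN
      nlinarith [hμ.1 ω]
  refine (sum_le_sum fun ω _ => step ω).trans ?_
  rw [sum_add_distrib, ← sum_mul, ← sum_mul, hμ.2, one_mul, ← prob_eq]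
  have := mul_le_mul_of_nonneg_right hτ hlc
  linarith

lemma ent_pair_unit [Fintype α] (μ : Ω → ℝ) (X : Ω → α) :
    ent μ (fun ω => (X ω, ())) = ent μ X :=
  ent_congr_iff μ fun ω ω' => by simp

/-- The unconditional version of `ent_pair_sub_le_of_list`. -/
lemma ent_le_of_list [Fintype α] [Nonempty α] {μ : Ω → ℝ} (hμ : IsPMF μ)
    (X : Ω → α) (A : α → Prop) {N τ : ℝ} (hN : 1 ≤ N)
    (hA : ∑ a, ind (A a) ≤ N) (hτ : prob μ (fun ω => ¬ A (X ω)) ≤ τ) :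
    ent μ X ≤ 1 + logb 2 N + τ * logb 2 (Fintype.card α) := by
  have h := ent_pair_sub_le_of_list hμ X (fun _ => ()) (fun a _ => A a) hN (fun _ => hA) hτ
  rw [ent_pair_unit, ent_const hμ] at h
  linarith

lemma ent_le_logb_card [Fintype α] [Nonempty α] {μ : Ω → ℝ} (hμ : IsPMF μ) (X : Ω → α) :
    ent μ X ≤ logb 2 (Fintype.card α) := by
  have hc0 : (0 : ℝ) < Fintype.card α := by exact_mod_cast Fintype.card_pos
  have h := ent_pair_sub_le_cross hμ X (fun _ => ()) (fun _ _ => 1 / Fintype.card α)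
    (fun a b => by positivity)
    (fun b => by rw [sum_const, card_univ, nsmul_eq_mul]; field_simp; rfl)
    (fun ω _ => by positivity)
  rw [ent_pair_unit, ent_const hμ, ← sum_mul, hμ.2, one_div, logb_inv] at h
  linarith

lemma ent_pair_of_indep [Fintype α] [Fintype β] {μ : Ω → ℝ} (hμ : IsPMF μ) (X : Ω → α)
    (Y : Ω → β) (h : ∀ a b, pmass μ (fun ω => (X ω, Y ω)) (a, b) = pmass μ X a * pmass μ Y b) :
    ent μ (fun ω => (X ω, Y ω)) = ent μ X + ent μ Y := by
  rw [ent_eq, ent_eq, ent_eq, ← neg_add, ← sum_add_distrib]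
  congr 1
  refine sum_congr rfl fun ω _ => ?_
  by_cases hω : μ ω = 0
  · simp [hω]
  · rw [h, logb_mul (pmass_pos hμ.1 X hω).ne' (pmass_pos hμ.1 Y hω).ne', mul_add]

/-- Functions of independent variables are independent. -/
lemma pmass_pair_comp_of_indep {α' β' : Type*} [Fintype α] [Fintype β] {μ : Ω → ℝ} (X : Ω → α)
    (Y : Ω → β) (h : ∀ a b, pmass μ (fun ω => (X ω, Y ω)) (a, b) = pmass μ X a * pmass μ Y b)
    (f : α → α') (g : β → β') (a : α') (b : β') :
    pmass μ (fun ω => (f (X ω), g (Y ω))) (a, b)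
      = pmass μ (fun ω => f (X ω)) a * pmass μ (fun ω => g (Y ω)) b := by
  rw [← pmass_map μ (fun ω => (X ω, Y ω)) (fun z => (f z.1, g z.2)), ← pmass_map μ X f,
    ← pmass_map μ Y g, pmass_eq, pmass_eq, pmass_eq, Fintype.sum_prod_type, sum_mul_sum]
  refine sum_congr rfl fun x _ => sum_congr rfl fun y _ => ?_
  rw [h, Prod.mk.injEq, ind_and]
  ring

end Pmass

/-! ### Product probability mass functions -/

section Products

variable {ι α β : Type*} [Fintype ι] [DecidableEq ι] [Fintype α]

lemma sum_prod_mul_prod (p f : ι → α → ℝ) :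
    ∑ ω : ι → α, (∏ i, p i (ω i)) * ∏ i, f i (ω i) = ∏ i, ∑ a, p i a * f i a := by
  simp_rw [← prod_mul_distrib]
  exact (Fintype.prod_sum fun i a => p i a * f i a).symm

lemma isPMF_prod {p : ι → α → ℝ} (hp : ∀ i, IsPMF (p i)) :
    IsPMF (fun ω : ι → α => ∏ i, p i (ω i)) := by
  refine ⟨fun ω => prod_nonneg fun i _ => (hp i).1 _, ?_⟩
  have := sum_prod_mul_prod p (fun _ _ => 1)
  simpa [(hp _).2] using this

lemma sum_prod_coord {p : ι → α → ℝ} (hp : ∀ i, IsPMF (p i)) (k : ι) (f : α → ℝ) :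
    ∑ ω : ι → α, (∏ i, p i (ω i)) * f (ω k) = ∑ a, p k a * f a := by
  have h := sum_prod_mul_prod p (fun i a => if i = k then f a else 1)
  have e1 : ∀ ω : ι → α, ∏ i, (if i = k then f (ω i) else 1) = f (ω k) := fun ω => by
    rw [prod_ite_eq' univ k (fun i => f (ω i))]; simp
  simp_rw [e1] at h
  rw [h, Fintype.prod_eq_single k]
  · simp
  · intro i hi; simp [hi, (hp i).2]

lemma sum_prod_coord_two {p : ι → α → ℝ} (hp : ∀ i, IsPMF (p i)) {k l : ι} (hkl : k ≠ l)
    (f g : α → ℝ) :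
    ∑ ω : ι → α, (∏ i, p i (ω i)) * (f (ω k) * g (ω l))
      = (∑ a, p k a * f a) * ∑ a, p l a * g a := by
  have h := sum_prod_mul_prod p (fun i a => (if i = k then f a else 1) * if i = l then g a else 1)
  have e1 : ∀ ω : ι → α, ∏ i, ((if i = k then f (ω i) else 1) * if i = l then g (ω i) else 1)
      = f (ω k) * g (ω l) := fun ω => by
    rw [prod_mul_distrib, prod_ite_eq' univ k (fun i => f (ω i)),
      prod_ite_eq' univ l (fun i => g (ω i))]; simp
  simp_rw [e1] at h
  rw [h, Fintype.prod_eq_mul k l hkl]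
  · simp [hkl, hkl.symm]
  · intro i hi; simp [hi, (hp i).2]

lemma pmass_pi {p : α → ℝ} (F : α → β) (b : ι → β) :
    pmass (fun ω : ι → α => ∏ i, p (ω i)) (fun ω i => F (ω i)) b = ∏ i, pmass p F (b i) := by
  rw [pmass_eq]
  simp_rw [pmass_eq]
  rw [← sum_prod_mul_prod (fun _ => p) (fun i a => ind (F a = b i))]
  refine sum_congr rfl fun ω _ => ?_
  congr 1
  by_cases h : (fun i => F (ω i)) = b
  · rw [ind_of_true h]
    symm; exact prod_eq_one fun i _ => ind_of_true (congrFun h i)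
  · rw [ind_of_false h]
    obtain ⟨i, hi⟩ := Function.ne_iff.1 h
    symm; exact prod_eq_zero (mem_univ i) (ind_of_false hi)

/-- The entropy of an i.i.d. sequence is additive. -/
lemma ent_pi [Fintype β] {p : α → ℝ} (hp : IsPMF p) (F : α → β) (n : ℕ) :
    ent (fun ω : Fin n → α => ∏ i, p (ω i)) (fun ω i => F (ω i)) = n * ent p F := by
  rw [ent_eq, ent_eq]
  have e : ∀ ω : Fin n → α, (∏ i, p (ω i)) * logb 2 (pmass (fun ω : Fin n → α => ∏ i, p (ω i))
      (fun ω i => F (ω i)) (fun i => F (ω i)))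
      = ∑ i, (∏ i, p (ω i)) * logb 2 (pmass p F (F (ω i))) := fun ω => by
    rw [pmass_pi, ← mul_sum]
    by_cases h : ∏ i, p (ω i) = 0
    · simp [h]
    · rw [logb_prod]
      intro i _
      exact (pmass_pos hp.1 F fun h0 => h (prod_eq_zero (mem_univ i) h0)).ne'
  rw [sum_congr rfl fun ω _ => e ω, sum_comm]
  rw [sum_congr rfl fun i _ => sum_prod_coord (fun _ : Fin n => hp) i
    (fun a => logb 2 (pmass p F (F a)))]
  simp

/-! ### Weak law of large numbers and the asymptotic equipartition property -/

lemma sum_prod_sq {p : α → ℝ} (hp : IsPMF p) (g : α → ℝ) (hg : ∑ a, p a * g a = 0) (n : ℕ) :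
    ∑ ω : Fin n → α, (∏ i, p (ω i)) * (∑ i, g (ω i)) ^ 2 = n * ∑ a, p a * g a ^ 2 := by
  have e : ∀ ω : Fin n → α, (∏ i, p (ω i)) * (∑ i, g (ω i)) ^ 2
      = ∑ i, ∑ j, (∏ i, p (ω i)) * (g (ω i) * g (ω j)) := fun ω => by
    rw [sq, sum_mul_sum, mul_sum]
    exact sum_congr rfl fun i _ => by rw [mul_sum]
  rw [sum_congr rfl fun ω _ => e ω, sum_comm]
  have e2 : ∀ i : Fin n, ∑ ω : Fin n → α, ∑ j, (∏ i, p (ω i)) * (g (ω i) * g (ω j))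
      = ∑ a, p a * g a ^ 2 := fun i => by
    rw [sum_comm, Fintype.sum_eq_single i]
    · rw [sum_prod_coord (fun _ => hp) i (fun a => g a * g a)]
      simp_rw [sq]
    · intro j hj
      rw [sum_prod_coord_two (fun _ => hp) hj.symm, hg, zero_mul]
  simp [e2]

lemma chebyshev_pi {p : α → ℝ} (hp : IsPMF p) (g : α → ℝ) (hg : ∑ a, p a * g a = 0) {n : ℕ}
    (hn : 0 < n) {δ : ℝ} (hδ : 0 < δ) :
    ∑ ω : Fin n → α, (∏ i, p (ω i)) * ind (n * δ < ∑ i, g (ω i))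
      ≤ (∑ a, p a * g a ^ 2) / δ ^ 2 / n := by
  have hn' : (0 : ℝ) < n := by exact_mod_cast hn
  have key : (n * δ) ^ 2 * ∑ ω : Fin n → α, (∏ i, p (ω i)) * ind (n * δ < ∑ i, g (ω i))
      ≤ n * ∑ a, p a * g a ^ 2 := by
    rw [← sum_prod_sq hp g hg, mul_sum]
    refine sum_le_sum fun ω _ => ?_
    have hw : 0 ≤ ∏ i, p (ω i) := prod_nonneg fun i _ => hp.1 _
    by_cases h : n * δ < ∑ i, g (ω i)
    · rw [ind_of_true h, mul_one, mul_comm]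
      gcongr
    · rw [ind_of_false h]
      simp only [mul_zero]
      positivity
  rw [div_div, le_div_iff₀ (by positivity)]
  have : n * (∑ ω : Fin n → α, (∏ i, p (ω i)) * ind (n * δ < ∑ i, g (ω i)) * (δ ^ 2 * n))
      ≤ n * ∑ a, p a * g a ^ 2 := by
    refine le_trans (le_of_eq ?_) key
    rw [← sum_mul]; ring
  rw [← sum_mul] at this
  exact le_of_mul_le_mul_left this hn'

/-- One-sided asymptotic equipartition property for the likelihood ratio of two positive product
functions. -/
lemma aep {p : α → ℝ} (hp : IsPMF p) (r q : α → ℝ) (hr : ∀ a, p a ≠ 0 → 0 < r a)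
    (hq : ∀ a, p a ≠ 0 → 0 < q a) {D : ℝ}
    (hD : ∑ a, p a * (logb 2 (r a) - logb 2 (q a)) = D) {δ η : ℝ} (hδ : 0 < δ) (hη : 0 < η) :
    ∃ N : ℕ, ∀ n ≥ N, ∑ ω : Fin n → α, (∏ i, p (ω i)) *
      ind (¬ ∏ i, r (ω i) ≤ 2 ^ ((n : ℝ) * (D + δ)) * ∏ i, q (ω i)) ≤ η := by
  set g : α → ℝ := fun a => logb 2 (r a) - logb 2 (q a) - D with hg
  have hg0 : ∑ a, p a * g a = 0 := by
    simp_rw [hg, mul_sub]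
    simp_rw [mul_sub] at hD
    rw [sum_sub_distrib, hD, ← sum_mul, hp.2]; ring
  obtain ⟨N, hN⟩ := exists_nat_gt ((∑ a, p a * g a ^ 2) / δ ^ 2 / η)
  refine ⟨N + 1, fun n hn => ?_⟩
  have hn0 : 0 < n := by omega
  have hn' : (0 : ℝ) < n := by exact_mod_cast hn0
  refine le_trans (sum_le_sum fun ω _ => ?_) ((chebyshev_pi hp g hg0 hn0 hδ).trans ?_)
  · by_cases h0 : ∏ i, p (ω i) = 0
    · simp [h0]
    refine mul_le_mul_of_nonneg_left (ind_mono fun h => ?_) (prod_nonneg fun i _ => hp.1 _)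
    have hpi : ∀ i, p (ω i) ≠ 0 := fun i hi => h0 (prod_eq_zero (mem_univ i) hi)
    by_contra hc
    apply h
    have hR : 0 < ∏ i, r (ω i) := prod_pos fun i _ => hr _ (hpi i)
    have hQ : 0 < ∏ i, q (ω i) := prod_pos fun i _ => hq _ (hpi i)
    rw [← logb_le_logb one_lt_two hR (by positivity), logb_mul (by positivity) hQ.ne',
      logb_rpow (by norm_num) (by norm_num), logb_prod _ _ fun i _ => (hr _ (hpi i)).ne',
      logb_prod _ _ fun i _ => (hq _ (hpi i)).ne']
    simp only [hg, sum_sub_distrib, sum_const, card_univ, Fintype.card_fin, nsmul_eq_mul] at hc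
    linarith
  · rw [div_le_iff₀ hn']
    rw [div_lt_iff₀ hη] at hN
    have : (N : ℝ) ≤ n := by exact_mod_cast (by omega : N ≤ n)
    nlinarith

end Products

/-! ### Conditional kernels -/

section Kernels

variable {Ω α β : Type*} [Fintype Ω]

/-- The conditional pmf of `X` given `Y`, completed by the marginal law of `X` at the values of `Y`
of probability zero. -/
noncomputable def condK (μ : Ω → ℝ) (X : Ω → α) (Y : Ω → β) (b : β) (a : α) : ℝ :=
  open Classical in
  if pmass μ Y b = 0 then pmass μ X a else pmass μ (fun ω => (X ω, Y ω)) (a, b) / pmass μ Y b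

lemma isPMF_condK [Fintype α] [Fintype β] {μ : Ω → ℝ} (hμ : IsPMF μ) (X : Ω → α) (Y : Ω → β)
    (b : β) : IsPMF (condK μ X Y b) := by
  unfold condK
  by_cases h : pmass μ Y b = 0
  · simpa [h] using isPMF_pmass hμ X
  · simp only [h, if_false]
    refine ⟨fun a => div_nonneg (pmass_nonneg hμ.1 _ _) (pmass_nonneg hμ.1 _ _), ?_⟩
    rw [← sum_div, sum_pmass_fst, div_self h]

lemma pmass_mul_condK [Fintype α] [Fintype β] {μ : Ω → ℝ} (hμ : IsPMF μ) (X : Ω → α) (Y : Ω → β)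
    (a : α) (b : β) :
    pmass μ Y b * condK μ X Y b a = pmass μ (fun ω => (X ω, Y ω)) (a, b) := by
  unfold condK
  by_cases h : pmass μ Y b = 0
  · simp only [h, if_true, zero_mul]
    rw [← sum_pmass_fst μ X Y b] at h
    exact ((sum_eq_zero_iff_of_nonneg fun a _ => pmass_nonneg hμ.1 _ _).1 h a (mem_univ a)).symm
  · simp only [h, if_false]
    rw [mul_div_cancel₀ _ h]

lemma condK_pos [Fintype α] [Fintype β] {μ : Ω → ℝ} (hμ : IsPMF μ) (X : Ω → α) (Y : Ω → β)
    {ω : Ω} (h : μ ω ≠ 0) : 0 < condK μ X Y (Y ω) (X ω) := by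
  have h1 := pmass_pos hμ.1 (fun ω => (X ω, Y ω)) h
  rw [← pmass_mul_condK hμ] at h1
  exact (pos_iff_pos_of_mul_pos h1).1 (pmass_pos hμ.1 Y h)

lemma sum_logb_condK [Fintype α] [Fintype β] {μ : Ω → ℝ} (hμ : IsPMF μ) (X : Ω → α) (Y : Ω → β) :
    ∑ ω, μ ω * logb 2 (condK μ X Y (Y ω) (X ω)) = ent μ Y - ent μ (fun ω => (X ω, Y ω)) := by
  rw [ent_eq, ent_eq, sub_neg_eq_add, neg_add_eq_sub, ← sum_sub_distrib]
  refine sum_congr rfl fun ω _ => ?_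
  by_cases h : μ ω = 0
  · simp [h]
  · rw [← pmass_mul_condK hμ,
      logb_mul (pmass_pos hμ.1 Y h).ne' (condK_pos hμ X Y h).ne']
    ring

lemma sum_logb_pmass [Fintype α] (μ : Ω → ℝ) (X : Ω → α) :
    ∑ ω, μ ω * logb 2 (pmass μ X (X ω)) = - ent μ X := by
  rw [ent_eq, neg_neg]

end Kernels

/-! ### Weighted averages -/

section Average

variable {α β : Type*} [Fintype α] [Fintype β]

/-- The average of `f` with respect to the weights `w`. -/
noncomputable def avg (w : α → ℝ) (f : α → ℝ) : ℝ := ∑ a, w a * f a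

lemma avg_add (w f g : α → ℝ) : avg w (fun a => f a + g a) = avg w f + avg w g := by
  simp only [avg, mul_add, sum_add_distrib]

lemma avg_const_mul (w : α → ℝ) (c : ℝ) (f : α → ℝ) : avg w (fun a => c * f a) = c * avg w f := by
  simp only [avg, mul_sum]
  exact sum_congr rfl fun a _ => by ring

lemma avg_sum {ι : Type*} [Fintype ι] (w : α → ℝ) (f : ι → α → ℝ) :
    avg w (fun a => ∑ i, f i a) = ∑ i, avg w (f i) := by
  simp only [avg, mul_sum]
  exact sum_comm

lemma avg_comm (w : α → ℝ) (w' : β → ℝ) (f : α → β → ℝ) :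
    avg w (fun a => avg w' (f a)) = avg w' (fun b => avg w (fun a => f a b)) := by
  simp only [avg, mul_sum]
  rw [sum_comm]
  exact sum_congr rfl fun b _ => sum_congr rfl fun a _ => by ring

lemma avg_const {w : α → ℝ} (hw : IsPMF w) (c : ℝ) : avg w (fun _ => c) = c := by
  rw [avg, ← sum_mul, hw.2, one_mul]

lemma avg_mono' {w f g : α → ℝ} (hw : ∀ a, 0 ≤ w a) (h : ∀ a, w a ≠ 0 → f a ≤ g a) :
    avg w f ≤ avg w g := by
  refine sum_le_sum fun a _ => ?_
  by_cases h0 : w a = 0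
  · simp [h0]
  · exact mul_le_mul_of_nonneg_left (h a h0) (hw a)

lemma avg_mono {w f g : α → ℝ} (hw : ∀ a, 0 ≤ w a) (h : ∀ a, f a ≤ g a) :
    avg w f ≤ avg w g :=
  avg_mono' hw fun a _ => h a

lemma avg_nonneg {w f : α → ℝ} (hw : ∀ a, 0 ≤ w a) (h : ∀ a, 0 ≤ f a) : 0 ≤ avg w f :=
  sum_nonneg fun a _ => mul_nonneg (hw a) (h a)

lemma avg_le {w f : α → ℝ} (hw : IsPMF w) {c : ℝ} (h : ∀ a, f a ≤ c) : avg w f ≤ c :=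
  (avg_mono hw.1 h).trans_eq (avg_const hw c)

lemma exists_le_of_avg_le {w f : α → ℝ} (hw : IsPMF w) {c : ℝ} (h : avg w f ≤ c) :
    ∃ a, f a ≤ c := by
  by_contra! hc
  have hlt : ∑ a, w a * c < ∑ a, w a * f a := by
    refine sum_lt_sum (fun a _ => mul_le_mul_of_nonneg_left (hc a).le (hw.1 a)) ?_
    by_contra! h0
    have : ∑ a, w a ≤ 0 := sum_nonpos fun a _ => by
      have := h0 a (mem_univ a)
      by_contra hpos
      push Not at hpos
      exact absurd this (not_le.2 (mul_lt_mul_of_pos_left (hc a) hpos))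
    rw [hw.2] at this
    linarith
  rw [← sum_mul, hw.2, one_mul] at hlt
  exact absurd h (not_le.2 hlt)

lemma avg_ind_not {w : α → ℝ} (hw : IsPMF w) (P : α → Prop) :
    avg w (fun a => ind (¬ P a)) = 1 - avg w (fun a => ind (P a)) := by
  simp only [avg, ind_not, mul_sub, mul_one, sum_sub_distrib, hw.2]

end Average

/-- The product law of a family of pmfs. -/
noncomputable def piW {ι α : Type*} [Fintype ι] (p : ι → α → ℝ) (ω : ι → α) : ℝ := ∏ i, p i (ω i)

lemma isPMF_piW {ι α : Type*} [Fintype ι] [DecidableEq ι] [Fintype α] {p : ι → α → ℝ}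
    (hp : ∀ i, IsPMF (p i)) : IsPMF (piW p) := isPMF_prod hp

lemma avg_piW_coord {ι α : Type*} [Fintype ι] [DecidableEq ι] [Fintype α] {p : ι → α → ℝ}
    (hp : ∀ i, IsPMF (p i)) (k : ι) (f : α → ℝ) :
    avg (piW p) (fun ω => f (ω k)) = avg (p k) f := sum_prod_coord hp k f

lemma avg_piW_prod {ι α : Type*} [Fintype ι] [DecidableEq ι] [Fintype α] (p f : ι → α → ℝ) :
    avg (piW p) (fun ω => ∏ i, f i (ω i)) = ∏ i, avg (p i) (f i) := sum_prod_mul_prod p f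

lemma ind_forall_not {ι : Type*} [Fintype ι] (P : ι → Prop) :
    ind (∀ i, ¬ P i) = ∏ i, ind (¬ P i) := by
  by_cases h : ∀ i, ¬ P i
  · rw [ind_of_true h]
    symm; exact prod_eq_one fun i _ => ind_of_true (h i)
  · rw [ind_of_false h]
    push Not at h
    obtain ⟨i, hi⟩ := h
    symm; exact prod_eq_zero (mem_univ i) (ind_of_false (not_not.2 hi))

lemma one_sub_pow_le {J : ℕ} (hJ : 0 < J) {a t : ℝ} (ha : 0 < a) (hat : a ≤ t) (ht : t ≤ 1) :
    (1 - t) ^ J ≤ 1 / (J * a) := by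
  have hJ' : (0 : ℝ) < J := by exact_mod_cast hJ
  have h1 : (1 - t) ^ J ≤ Real.exp (-a) ^ J := by
    refine pow_le_pow_left₀ (by linarith) ?_ J
    exact (by linarith : 1 - t ≤ 1 - a).trans (Real.one_sub_le_exp_neg a)
  rw [← Real.exp_nat_mul, mul_neg, Real.exp_neg] at h1
  refine h1.trans ?_
  rw [one_div]
  refine inv_anti₀ (by positivity) ?_
  linarith [Real.add_one_le_exp ((J : ℝ) * a)]

/-- The probability that none of `J` independent samples hits a set of probability at least `a`. -/
lemma avg_no_hit_le {α : Type*} [Fintype α] {p : α → ℝ} (hp : IsPMF p) {J : ℕ} (hJ : 0 < J)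
    {a : ℝ} (ha : 0 < a) (P : α → Prop) (h : a ≤ avg p (fun x => ind (P x))) :
    avg (piW fun _ : Fin J => p) (fun ω => ind (∀ j, ¬ P (ω j))) ≤ 1 / (J * a) := by
  simp_rw [ind_forall_not]
  rw [avg_piW_prod (fun _ : Fin J => p) (fun _ x => ind (¬ P x))]
  rw [prod_const, card_univ, Fintype.card_fin, avg_ind_not hp]
  exact one_sub_pow_le hJ ha h (avg_le hp fun _ => ind_le_one _)

/-- The uniform pmf on `Fin B`. -/
noncomputable def unifW (B : ℕ) (_ : Fin B) : ℝ := 1 / B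

lemma isPMF_unifW {B : ℕ} (hB : 0 < B) : IsPMF (unifW B) := by
  have : (0 : ℝ) < B := by exact_mod_cast hB
  refine ⟨fun _ => by unfold unifW; positivity, ?_⟩
  simp [unifW, this.ne']

lemma avg_hash_collision {K B : ℕ} (hB : 0 < B) {k k' : Fin K} (hk : k' ≠ k) :
    avg (piW fun _ : Fin K => unifW B) (fun h => ind (h k' = h k)) = 1 / B := by
  have hB' : (0 : ℝ) < B := by exact_mod_cast hB
  have e : ∀ h : Fin K → Fin B, ind (h k' = h k)
      = ∑ b, (ind (b = h k') * ind (b = h k)) := fun h => by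
    have := sum_ind_eq (h k') (fun b => ind (b = h k))
    rw [← this]
    refine sum_congr rfl fun b _ => ?_
    congr 2; exact propext eq_comm
  simp_rw [e]
  rw [avg_sum]
  have e2 : ∀ b : Fin B, avg (piW fun _ : Fin K => unifW B)
      (fun h => ind (b = h k') * ind (b = h k)) = 1 / B * (1 / B) := fun b => by
    refine (sum_prod_coord_two (fun _ : Fin K => isPMF_unifW hB) hk (fun c => ind (b = c))
      (fun c => ind (b = c))).trans ?_
    have : ∑ a : Fin B, unifW B a * ind (b = a) = 1 / B := by
      simp_rw [mul_comm (unifW B _)]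
      exact sum_ind_eq b _
    rw [this]
  simp_rw [e2]
  rw [sum_const, card_univ, Fintype.card_fin, nsmul_eq_mul]
  field_simp

/-! ### Selecting a codeword -/

open Classical in
/-- Some index satisfying `P`, if there is one. -/
noncomputable def pick {ι : Type*} (P : ι → Prop) : Option ι :=
  if h : ∃ i, P i then some h.choose else none

lemma pick_spec {ι : Type*} {P : ι → Prop} {i : ι} (h : pick P = some i) : P i := by
  unfold pick at h
  split_ifs at h with h'
  rw [← Option.some.inj h]; exact h'.choose_spec

lemma pick_none {ι : Type*} {P : ι → Prop} (h : pick P = none) : ∀ i, ¬ P i := by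
  unfold pick at h
  split_ifs at h with h'
  exact not_exists.1 h'

/-! ### The one-shot random coding argument -/

section OneShot

variable {𝕌 𝕍 𝕏 𝔹 : Type*}

/-- The index pair chosen by the encoder: first a `U`-codeword related to `x` by `G₁`, then a
`V`-codeword related to it and to `x` by `G₂`. -/
noncomputable def select {J K : ℕ} (G₁ : 𝕌 → 𝕏 → Prop) (G₂ : 𝕌 → 𝕍 → 𝕏 → Prop) (u : Fin J → 𝕌)
    (v : Fin J → Fin K → 𝕍) (x : 𝕏) : Option (Fin J × Fin K) :=
  (pick fun j => G₁ (u j) x).bind fun j => (pick fun k => G₂ (u j) (v j k) x).map fun k => (j, k)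

lemma select_eq_some {J K : ℕ} {G₁ : 𝕌 → 𝕏 → Prop} {G₂ : 𝕌 → 𝕍 → 𝕏 → Prop} {u : Fin J → 𝕌}
    {v : Fin J → Fin K → 𝕍} {x : 𝕏} {j : Fin J} {k : Fin K}
    (h : select G₁ G₂ u v x = some (j, k)) :
    (pick fun j => G₁ (u j) x) = some j ∧ G₁ (u j) x ∧ G₂ (u j) (v j k) x := by
  unfold select at h
  rw [Option.bind_eq_some_iff] at h
  obtain ⟨j', hj', h⟩ := h
  rw [Option.map_eq_some_iff] at h
  obtain ⟨k', hk', h⟩ := h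
  obtain ⟨rfl, rfl⟩ := Prod.mk.inj h
  exact ⟨hj', pick_spec (P := fun j => G₁ (u j) x) hj',
    pick_spec (P := fun k => G₂ _ (v _ k) x) hk'⟩

lemma select_eq_none {J K : ℕ} {G₁ : 𝕌 → 𝕏 → Prop} {G₂ : 𝕌 → 𝕍 → 𝕏 → Prop} {u : Fin J → 𝕌}
    {v : Fin J → Fin K → 𝕍} {x : 𝕏} (h : select G₁ G₂ u v x = none) :
    (∀ j, ¬ G₁ (u j) x) ∨
      ∃ j, (pick fun j => G₁ (u j) x) = some j ∧ ∀ k, ¬ G₂ (u j) (v j k) x := by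
  unfold select at h
  rcases hp : (pick fun j => G₁ (u j) x) with _ | j
  · exact Or.inl (pick_none hp)
  · rw [hp, Option.bind_some, Option.map_eq_none_iff] at h
    exact Or.inr ⟨j, rfl, pick_none h⟩

/-- The law of the `U`-codebook. -/
noncomputable abbrev lawU (J : ℕ) (pU : 𝕌 → ℝ) : (Fin J → 𝕌) → ℝ := piW fun _ => pU

/-- The law of the `V`-codebook given the `U`-codebook. -/
noncomputable abbrev lawV {J : ℕ} (K : ℕ) (pVU : 𝕌 → 𝕍 → ℝ) (u : Fin J → 𝕌) :
    (Fin J → Fin K → 𝕍) → ℝ := piW fun j => piW fun _ => pVU (u j)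

lemma isPMF_lawU [Fintype 𝕌] (J : ℕ) {pU : 𝕌 → ℝ} (h : IsPMF pU) : IsPMF (lawU J pU) :=
  isPMF_piW fun _ => h

lemma isPMF_lawV [Fintype 𝕍] {J : ℕ} (K : ℕ) {pVU : 𝕌 → 𝕍 → ℝ} (h : ∀ u, IsPMF (pVU u))
    (u : Fin J → 𝕌) : IsPMF (lawV K pVU u) := isPMF_piW fun _ => isPMF_piW fun _ => h _

variable [Fintype 𝕌] [Fintype 𝕍] [Fintype 𝕏] [Fintype 𝔹]

variable {J K : ℕ} {pU : 𝕌 → ℝ} {pVU : 𝕌 → 𝕍 → ℝ} {PX : 𝕏 → ℝ}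
  {G₁ : 𝕌 → 𝕏 → Prop} {G₂ : 𝕌 → 𝕍 → 𝕏 → Prop}

lemma avg_select_none_le (hU : IsPMF pU) (hVU : ∀ u, IsPMF (pVU u)) (hX : IsPMF PX)
    (hJ : 0 < J) (hK : 0 < K) {a₁ a₂ η₀ : ℝ} (ha₁ : 0 < a₁) (ha₂ : 0 < a₂)
    (h₀ : avg PX (fun x => ind (¬ a₁ ≤ avg pU fun u => ind (G₁ u x))) ≤ η₀)
    (h₁ : ∀ u x, G₁ u x → a₂ ≤ avg (pVU u) fun v => ind (G₂ u v x)) :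
    avg (lawU J pU) (fun u => avg (lawV K pVU u) fun v =>
      avg PX fun x => ind (select G₁ G₂ u v x = none)) ≤ η₀ + 1 / (J * a₁) + 1 / (K * a₂) := by
  have hJ' : (0 : ℝ) < J := by exact_mod_cast hJ
  have hK' : (0 : ℝ) < K := by exact_mod_cast hK
  have e : ∀ u : Fin J → 𝕌, avg (lawV K pVU u) (fun v =>
      avg PX fun x => ind (select G₁ G₂ u v x = none))
      ≤ avg PX (fun x => ind (∀ j, ¬ G₁ (u j) x) + 1 / (K * a₂)) := by
    intro u
    rw [avg_comm]
    refine avg_mono hX.1 fun x => ?_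
    have hle : avg (lawV K pVU u) (fun v => ind (select G₁ G₂ u v x = none))
        ≤ avg (lawV K pVU u) (fun v => ind (∀ j, ¬ G₁ (u j) x) +
          ind (∃ j, (pick fun j => G₁ (u j) x) = some j ∧ ∀ k, ¬ G₂ (u j) (v j k) x)) :=
      avg_mono (isPMF_lawV K hVU u).1 fun v =>
        (ind_mono select_eq_none).trans (ind_or_le _ _)
    refine hle.trans ?_
    rw [avg_add, avg_const (isPMF_lawV K hVU u)]
    gcongr
    rcases hp : (pick fun j => G₁ (u j) x) with _ | j
    · rw [show (fun v : Fin J → Fin K → 𝕍 => ind (∃ j, (none : Option (Fin J)) = some j ∧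
        ∀ k, ¬ G₂ (u j) (v j k) x)) = fun _ => 0 from funext fun v => ind_of_false (by simp),
        avg_const (isPMF_lawV K hVU u)]
      positivity
    · have hG : G₁ (u j) x := pick_spec (P := fun j => G₁ (u j) x) hp
      simp only [Option.some.injEq, exists_eq_left']
      rw [avg_piW_coord (fun j => isPMF_piW fun _ : Fin K => hVU (u j)) j
        (fun vj => ind (∀ k, ¬ G₂ (u j) (vj k) x))]
      exact avg_no_hit_le (hVU _) hK ha₂ (fun v => G₂ (u j) v x) (h₁ _ _ hG)
  refine (avg_mono (isPMF_lawU J hU).1 e).trans ?_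
  simp_rw [avg_add]
  rw [avg_const hX, avg_const (isPMF_lawU J hU)]
  gcongr
  rw [avg_comm]
  have e2 : ∀ x, avg (lawU J pU) (fun u => ind (∀ j, ¬ G₁ (u j) x))
      ≤ ind (¬ a₁ ≤ avg pU fun u => ind (G₁ u x)) + 1 / (J * a₁) := by
    intro x
    by_cases hx : a₁ ≤ avg pU fun u => ind (G₁ u x)
    · have h1 := avg_no_hit_le hU hJ ha₁ (fun u => G₁ u x) hx
      have h2 := ind_nonneg (¬ a₁ ≤ avg pU fun u => ind (G₁ u x))
      linarith
    · rw [ind_of_true hx]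
      have h1 : avg (lawU J pU) (fun u => ind (∀ j, ¬ G₁ (u j) x)) ≤ 1 :=
        avg_le (isPMF_lawU J hU) fun _ => ind_le_one _
      have h2 : 0 ≤ 1 / (J * a₁) := by positivity
      linarith
  refine (avg_mono hX.1 e2).trans ?_
  rw [avg_add, avg_const hX]
  gcongr

lemma avg_sum_codewordU_le (hU : IsPMF pU) {c : ℝ} (P : 𝕌 → Prop)
    (h : avg pU (fun u => ind (P u)) ≤ c) :
    avg (lawU J pU) (fun u => ∑ j, ind (P (u j))) ≤ J * c := by
  rw [avg_sum]
  refine (sum_le_sum fun j _ => ?_).trans_eq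
    (b := ∑ _j : Fin J, c) (by simp)
  rw [avg_piW_coord (fun _ => hU) j (fun u => ind (P u))]
  exact h

lemma avg_sum_codewordV_le (hVU : ∀ u, IsPMF (pVU u)) {c : ℝ} (hc : 0 ≤ c) (u : Fin J → 𝕌)
    (o : Option (Fin J)) (P : 𝕌 → 𝕍 → Prop) (h : ∀ u, avg (pVU u) (fun v => ind (P u v)) ≤ c) :
    avg (lawV K pVU u) (fun v => ∑ k, ind (∃ j, o = some j ∧ P (u j) (v j k))) ≤ K * c := by
  rw [avg_sum]
  refine (sum_le_sum fun k _ => ?_).trans_eq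
    (b := ∑ _k : Fin K, c) (by simp)
  rcases o with _ | j
  · rw [show (fun v : Fin J → Fin K → 𝕍 => ind (∃ j, (none : Option (Fin J)) = some j ∧
      P (u j) (v j k))) = fun _ => 0 from funext fun v => ind_of_false (by simp),
      avg_const (isPMF_lawV K hVU u)]
    exact hc
  · simp only [Option.some.injEq, exists_eq_left']
    rw [avg_piW_coord (fun j => isPMF_piW fun _ : Fin K => hVU (u j)) j
      (fun vj => ind (P (u j) (vj k))), avg_piW_coord (fun _ => hVU (u j)) k
      (fun v => ind (P (u j) v))]
    exact h _

/-- The number of `U`-codewords confusable with the observation. -/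
noncomputable def confU (PX : 𝕏 → ℝ) (kQ : 𝕏 → 𝔹 → ℝ) (TU : 𝕌 → 𝔹 → Prop) (u : Fin J → 𝕌) : ℝ :=
  avg PX fun x => avg (kQ x) fun b => ∑ j, ind (TU (u j) b)

/-- The number of `U`-codewords eligible for an independent source sequence and confusable with
the observation. -/
noncomputable def confUX (PX : 𝕏 → ℝ) (kQ : 𝕏 → 𝔹 → ℝ) (TU : 𝕌 → 𝔹 → Prop) (G₁ : 𝕌 → 𝕏 → Prop)
    (u : Fin J → 𝕌) : ℝ :=
  avg PX fun x' => avg PX fun x => avg (kQ x) fun b => ∑ j, ind (G₁ (u j) x' ∧ TU (u j) b)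

/-- The number of `V`-codewords confusable with the observation. -/
noncomputable def confV (PX : 𝕏 → ℝ) (kQ : 𝕏 → 𝔹 → ℝ) (TV : 𝕌 → 𝕍 → 𝔹 → Prop)
    (G₁ : 𝕌 → 𝕏 → Prop) (u : Fin J → 𝕌) (v : Fin J → Fin K → 𝕍) : ℝ :=
  avg PX fun x => avg (kQ x) fun b =>
    ∑ k, ind (∃ j, (pick fun j => G₁ (u j) x) = some j ∧ TV (u j) (v j k) b)

variable {kQ : 𝕏 → 𝔹 → ℝ}

lemma avg_confU_le (hU : IsPMF pU) (hX : IsPMF PX) (hQ : ∀ x, IsPMF (kQ x)) {c : ℝ}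
    (TU : 𝕌 → 𝔹 → Prop) (h : ∀ b, avg pU (fun u => ind (TU u b)) ≤ c) :
    avg (lawU J pU) (confU PX kQ TU) ≤ J * c := by
  unfold confU
  rw [avg_comm]
  refine avg_le hX fun x => ?_
  rw [avg_comm]
  exact avg_le (hQ x) fun b => avg_sum_codewordU_le hU (fun u => TU u b) (h b)

lemma avg_confUX_le (hU : IsPMF pU) (hX : IsPMF PX) (hQ : ∀ x, IsPMF (kQ x)) {c c' : ℝ}
    (hc' : 0 ≤ c') (TU : 𝕌 → 𝔹 → Prop) (h : ∀ b, avg pU (fun u => ind (TU u b)) ≤ c)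
    (h' : ∀ u, avg PX (fun x => ind (G₁ u x)) ≤ c') :
    avg (lawU J pU) (confUX PX kQ TU G₁) ≤ J * (c * c') := by
  unfold confUX
  have e : ∀ u : Fin J → 𝕌, (avg PX fun x' => avg PX fun x => avg (kQ x) fun b =>
      ∑ j, ind (G₁ (u j) x' ∧ TU (u j) b))
      = avg PX fun x => avg (kQ x) fun b =>
        ∑ j, avg PX fun x' => ind (TU (u j) b) * ind (G₁ (u j) x') := by
    intro u
    rw [avg_comm]
    congr 1; funext x
    rw [avg_comm]
    congr 1; funext b
    rw [avg_sum]
    simp_rw [ind_and, mul_comm]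
  simp_rw [e]
  rw [avg_comm]
  refine avg_le hX fun x => ?_
  rw [avg_comm]
  refine avg_le (hQ x) fun b => ?_
  have e3 : ∀ u : Fin J → 𝕌, ∑ j, avg PX (fun x' => ind (TU (u j) b) * ind (G₁ (u j) x'))
      ≤ c' * ∑ j, ind (TU (u j) b) := fun u => by
    rw [mul_sum]
    refine sum_le_sum fun j _ => ?_
    rw [avg_const_mul, mul_comm]
    exact mul_le_mul_of_nonneg_right (h' _) (ind_nonneg _)
  refine (avg_mono (isPMF_lawU J hU).1 e3).trans ?_
  rw [avg_const_mul]
  calc _ ≤ c' * (J * c) :=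
        mul_le_mul_of_nonneg_left (avg_sum_codewordU_le hU (fun u => TU u b) (h b)) hc'
    _ = J * (c * c') := by ring

lemma avg_confV_le (hVU : ∀ u, IsPMF (pVU u)) (hX : IsPMF PX) (hQ : ∀ x, IsPMF (kQ x)) {c : ℝ}
    (hc : 0 ≤ c) (TV : 𝕌 → 𝕍 → 𝔹 → Prop) (h : ∀ u b, avg (pVU u) (fun v => ind (TV u v b)) ≤ c)
    (u : Fin J → 𝕌) :
    avg (lawV K pVU u) (confV PX kQ TV G₁ u) ≤ K * c := by
  unfold confV
  rw [avg_comm]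
  refine avg_le hX fun x => ?_
  rw [avg_comm]
  exact avg_le (hQ x) fun b =>
    avg_sum_codewordV_le hVU hc u _ (fun u v => TV u v b) fun u => h u b

/-- Existence of a codebook that simultaneously covers the source and has few confusable
codewords. -/
lemma exists_codebook (hU : IsPMF pU) (hVU : ∀ u, IsPMF (pVU u)) (hX : IsPMF PX)
    (hQ : ∀ x, IsPMF (kQ x)) (hJ : 0 < J) (hK : 0 < K) {a₁ a₂ η₀ c₁ c₂ c₃ c₄ : ℝ}
    (ha₁ : 0 < a₁) (ha₂ : 0 < a₂)
    (h₀ : avg PX (fun x => ind (¬ a₁ ≤ avg pU fun u => ind (G₁ u x))) ≤ η₀)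
    (h₁ : ∀ u x, G₁ u x → a₂ ≤ avg (pVU u) fun v => ind (G₂ u v x))
    (hc₂ : 0 ≤ c₂) (hc₃ : 0 ≤ c₃) (hc₄ : 0 ≤ c₄)
    (TU : 𝕌 → 𝔹 → Prop) (hTU : ∀ b, avg pU (fun u => ind (TU u b)) ≤ c₁)
    (hG₁ : ∀ u, avg PX (fun x => ind (G₁ u x)) ≤ c₂)
    (TV TV' : 𝕌 → 𝕍 → 𝔹 → Prop) (hTV : ∀ u b, avg (pVU u) (fun v => ind (TV u v b)) ≤ c₃)
    (hTV' : ∀ u b, avg (pVU u) (fun v => ind (TV' u v b)) ≤ c₄)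
    {α₁ α₂ α₃ α₄ : ℝ} (hα₁ : 0 ≤ α₁) (hα₂ : 0 ≤ α₂) (hα₃ : 0 ≤ α₃) (hα₄ : 0 ≤ α₄) :
    ∃ (u : Fin J → 𝕌) (v : Fin J → Fin K → 𝕍),
      avg PX (fun x => ind (select G₁ G₂ u v x = none)) + α₁ * confU PX kQ TU u
        + α₂ * confUX PX kQ TU G₁ u + α₃ * confV PX kQ TV G₁ u v + α₄ * confV PX kQ TV' G₁ u v
      ≤ η₀ + 1 / (J * a₁) + 1 / (K * a₂) + α₁ * (J * c₁) + α₂ * (J * (c₁ * c₂))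
        + α₃ * (K * c₃) + α₄ * (K * c₄) := by
  have key : avg (lawU J pU) (fun u => avg (lawV K pVU u) fun v =>
      avg PX (fun x => ind (select G₁ G₂ u v x = none)) + α₁ * confU PX kQ TU u
        + α₂ * confUX PX kQ TU G₁ u + α₃ * confV PX kQ TV G₁ u v + α₄ * confV PX kQ TV' G₁ u v)
      ≤ η₀ + 1 / (J * a₁) + 1 / (K * a₂) + α₁ * (J * c₁) + α₂ * (J * (c₁ * c₂))
        + α₃ * (K * c₃) + α₄ * (K * c₄) := by
    simp_rw [avg_add, avg_const_mul]
    have hc : ∀ (u : Fin J → 𝕌) (c : ℝ), avg (lawV K pVU u) (fun _ => c) = c :=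
      fun u c => avg_const (isPMF_lawV K hVU u) c
    simp_rw [hc]
    have n1 := avg_select_none_le (G₁ := G₁) (G₂ := G₂) hU hVU hX hJ hK ha₁ ha₂ h₀ h₁
    have n2 := avg_confU_le (J := J) hU hX hQ TU hTU
    have n3 := avg_confUX_le (J := J) hU hX hQ hc₂ TU hTU hG₁
    have n4 : avg (lawU J pU) (fun u => avg (lawV K pVU u) (confV PX kQ TV G₁ u)) ≤ K * c₃ :=
      avg_le (isPMF_lawU J hU) fun u => avg_confV_le hVU hX hQ hc₃ TV hTV u
    have n5 : avg (lawU J pU) (fun u => avg (lawV K pVU u) (confV PX kQ TV' G₁ u)) ≤ K * c₄ :=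
      avg_le (isPMF_lawU J hU) fun u => avg_confV_le hVU hX hQ hc₄ TV' hTV' u
    gcongr
  obtain ⟨u, hu⟩ := exists_le_of_avg_le (isPMF_lawU J hU) key
  obtain ⟨v, hv⟩ := exists_le_of_avg_le (isPMF_lawV K hVU u) hu
  exact ⟨u, v, hv⟩

end OneShot

/-- A codebook together with the encoder's choice of codewords, the two hash functions that
describe the chosen indices, and the key extracted from the second index. -/
structure HashedBook (𝕌 𝕍 𝕏 : Type*) (J K B₁ B₂ S : ℕ) where
  u : Fin J → 𝕌
  v : Fin J → Fin K → 𝕍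
  sel : 𝕏 → Option (Fin J × Fin K)
  h₁ : Fin J → Fin B₁
  h₂ : Fin K → Fin B₂
  key : Fin K → Fin S

namespace HashedBook

variable {𝕌 𝕍 𝕏 𝔹 : Type*} {J K B₁ B₂ S : ℕ}

/-- The presented user's observation `b` does not determine the indices chosen for `x`. -/
def BadOwn (c : HashedBook 𝕌 𝕍 𝕏 J K B₁ B₂ S) (T : 𝕌 → 𝕍 → 𝕏 → 𝔹 → Prop) (TU : 𝕌 → 𝔹 → Prop)
    (TV TV' : 𝕌 → 𝕍 → 𝔹 → Prop) (x : 𝕏) (b : 𝔹) : Prop :=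
  c.sel x = none ∨ ∃ j k, c.sel x = some (j, k) ∧
    (¬ T (c.u j) (c.v j k) x b ∨
      (∃ j', j' ≠ j ∧ c.h₁ j' = c.h₁ j ∧ TU (c.u j') b) ∨
      (∃ k', k' ≠ k ∧ c.h₂ k' = c.h₂ k ∧ TV (c.u j) (c.v j k') b) ∨
      (∃ k', k' ≠ k ∧ c.h₂ k' = c.h₂ k ∧ c.key k' = c.key k ∧ TV' (c.u j) (c.v j k') b))

/-- The observation `b` is compatible with the description of another user's sequence `x'`. -/
def BadOther (c : HashedBook 𝕌 𝕍 𝕏 J K B₁ B₂ S) (TU : 𝕌 → 𝔹 → Prop) (x' : 𝕏) (b : 𝔹) : Prop :=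
  ∃ j k, c.sel x' = some (j, k) ∧ ∃ j', c.h₁ j' = c.h₁ j ∧ TU (c.u j') b

end HashedBook

section Hash

/-- The law of a random hash function. -/
noncomputable abbrev hashW (K B : ℕ) : (Fin K → Fin B) → ℝ := piW fun _ => unifW B

lemma isPMF_hashW {K B : ℕ} (hB : 0 < B) : IsPMF (hashW K B) := isPMF_piW fun _ => isPMF_unifW hB

lemma avg_hash_sum_le {K B : ℕ} (hB : 0 < B) (k : Fin K) {g : Fin K → ℝ} (hg : ∀ k, 0 ≤ g k) :
    avg (hashW K B) (fun h => ∑ k', ind (k' ≠ k ∧ h k' = h k) * g k') ≤ 1 / B * ∑ k', g k' := by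
  rw [avg_sum, mul_sum]
  refine sum_le_sum fun k' _ => ?_
  simp_rw [mul_comm _ (g k')]
  rw [avg_const_mul]
  refine mul_le_mul_of_nonneg_left ?_ (hg k')
  by_cases hk : k' = k
  · rw [show (fun h : Fin K → Fin B => ind (k' ≠ k ∧ h k' = h k)) = fun _ => 0 from
      funext fun h => ind_of_false (by simp [hk]), avg_const (isPMF_hashW hB)]
    positivity
  · rw [← avg_hash_collision hB hk]
    exact avg_mono (isPMF_hashW hB).1 fun h => ind_mono fun h' => h'.2

variable {𝕌 𝕍 𝕏 𝔹 : Type*}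
  {J K B₁ B₂ S : ℕ}

/-- The average over the three hash functions. -/
noncomputable def avgHash (J K B₁ B₂ S : ℕ)
    (f : (Fin J → Fin B₁) → (Fin K → Fin B₂) → (Fin K → Fin S) → ℝ) : ℝ :=
  avg (hashW J B₁) fun h₁ => avg (hashW K B₂) fun h₂ => avg (hashW K S) fun s => f h₁ h₂ s

lemma avgHash_mono (hB₁ : 0 < B₁) (hB₂ : 0 < B₂) (hS : 0 < S)
    {f g : (Fin J → Fin B₁) → (Fin K → Fin B₂) → (Fin K → Fin S) → ℝ}
    (h : ∀ h₁ h₂ s, f h₁ h₂ s ≤ g h₁ h₂ s) : avgHash J K B₁ B₂ S f ≤ avgHash J K B₁ B₂ S g :=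
  avg_mono (isPMF_hashW hB₁).1 fun h₁ => avg_mono (isPMF_hashW hB₂).1 fun h₂ =>
    avg_mono (isPMF_hashW hS).1 fun s => h h₁ h₂ s

lemma avgHash_const (hB₁ : 0 < B₁) (hB₂ : 0 < B₂) (hS : 0 < S) (c : ℝ) :
    avgHash J K B₁ B₂ S (fun _ _ _ => c) = c := by
  rw [avgHash]
  simp_rw [avg_const (isPMF_hashW hS), avg_const (isPMF_hashW hB₂), avg_const (isPMF_hashW hB₁)]

lemma avgHash_avg [Fintype 𝕏] (w : 𝕏 → ℝ)
    (f : 𝕏 → (Fin J → Fin B₁) → (Fin K → Fin B₂) → (Fin K → Fin S) → ℝ) :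
    avgHash J K B₁ B₂ S (fun h₁ h₂ s => avg w fun x => f x h₁ h₂ s)
      = avg w fun x => avgHash J K B₁ B₂ S (f x) := by
  unfold avgHash
  simp_rw [avg_comm _ w]

lemma avgHash_badOwn_le (hB₁ : 0 < B₁) (hB₂ : 0 < B₂) (hS : 0 < S)
    (u : Fin J → 𝕌) (v : Fin J → Fin K → 𝕍) (sel : 𝕏 → Option (Fin J × Fin K))
    (T : 𝕌 → 𝕍 → 𝕏 → 𝔹 → Prop) (TU : 𝕌 → 𝔹 → Prop) (TV TV' : 𝕌 → 𝕍 → 𝔹 → Prop)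
    (o : 𝕏 → Option (Fin J)) (ho : ∀ x j k, sel x = some (j, k) → o x = some j) (x : 𝕏) (b : 𝔹) :
    avgHash J K B₁ B₂ S (fun h₁ h₂ s =>
        ind ((HashedBook.mk u v sel h₁ h₂ s).BadOwn T TU TV TV' x b))
      ≤ ind (sel x = none) + ind (∃ j k, sel x = some (j, k) ∧ ¬ T (u j) (v j k) x b)
        + 1 / B₁ * ∑ j, ind (TU (u j) b)
        + 1 / B₂ * ∑ k, ind (∃ j, o x = some j ∧ TV (u j) (v j k) b)
        + 1 / (B₂ * S) * ∑ k, ind (∃ j, o x = some j ∧ TV' (u j) (v j k) b) := by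
  have p1 : 0 ≤ 1 / (B₁ : ℝ) * ∑ j, ind (TU (u j) b) :=
    mul_nonneg (by positivity) (sum_nonneg fun _ _ => ind_nonneg _)
  have p2 : 0 ≤ 1 / (B₂ : ℝ) * ∑ k, ind (∃ j, o x = some j ∧ TV (u j) (v j k) b) :=
    mul_nonneg (by positivity) (sum_nonneg fun _ _ => ind_nonneg _)
  have p3 : 0 ≤ 1 / ((B₂ : ℝ) * S) * ∑ k, ind (∃ j, o x = some j ∧ TV' (u j) (v j k) b) :=
    mul_nonneg (by positivity) (sum_nonneg fun _ _ => ind_nonneg _)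
  have p4 := ind_nonneg (∃ j k, sel x = some (j, k) ∧ ¬ T (u j) (v j k) x b)
  rcases hx : sel x with _ | ⟨j, k⟩
  · have h1 : avgHash J K B₁ B₂ S
        (fun h₁ h₂ s => ind ((HashedBook.mk u v sel h₁ h₂ s).BadOwn T TU TV TV' x b)) ≤ 1 :=
      (avgHash_mono hB₁ hB₂ hS fun _ _ _ => ind_le_one _).trans_eq (avgHash_const hB₁ hB₂ hS 1)
    rw [hx] at p4
    rw [ind_of_true (rfl : (none : Option (Fin J × Fin K)) = none)]
    linarith
  · have hoj := ho x j k hx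
    simp only [hoj, Option.some.injEq, exists_eq_left', reduceCtorEq] at p2 p3 ⊢
    rw [ind_of_false not_false]
    have hT : ind (∃ j_1 k_1, (j, k) = (j_1, k_1) ∧ ¬ T (u j_1) (v j_1 k_1) x b)
        = ind (¬ T (u j) (v j k) x b) := by
      congr 1
      simp
    rw [hT]
    have hpt : ∀ (h₁ : Fin J → Fin B₁) (h₂ : Fin K → Fin B₂) (s : Fin K → Fin S),
        ind ((HashedBook.mk u v sel h₁ h₂ s).BadOwn T TU TV TV' x b)
        ≤ ind (¬ T (u j) (v j k) x b)
          + ∑ j', ind (j' ≠ j ∧ h₁ j' = h₁ j) * ind (TU (u j') b)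
          + ∑ k', ind (k' ≠ k ∧ h₂ k' = h₂ k) * ind (TV (u j) (v j k') b)
          + ∑ k', ind (k' ≠ k ∧ h₂ k' = h₂ k) *
              (ind (k' ≠ k ∧ s k' = s k) * ind (TV' (u j) (v j k') b)) := by
      intro h₁ h₂ s
      refine (ind_mono (R := ¬ T (u j) (v j k) x b ∨
        (∃ j', (j' ≠ j ∧ h₁ j' = h₁ j) ∧ TU (u j') b) ∨
        (∃ k', (k' ≠ k ∧ h₂ k' = h₂ k) ∧ TV (u j) (v j k') b) ∨
        (∃ k', (k' ≠ k ∧ h₂ k' = h₂ k) ∧ (k' ≠ k ∧ s k' = s k) ∧ TV' (u j) (v j k') b)) ?_).trans ?_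
      · rintro (h | ⟨j₀, k₀, h, h'⟩)
        · simp [hx] at h
        · simp only [hx, Option.some.injEq, Prod.mk.injEq] at h
          obtain ⟨rfl, rfl⟩ := h
          rcases h' with h' | ⟨i, a, b', c⟩ | ⟨i, a, b', c⟩ | ⟨i, a, b', c, d⟩
          · exact Or.inl h'
          · exact Or.inr (Or.inl ⟨i, ⟨a, b'⟩, c⟩)
          · exact Or.inr (Or.inr (Or.inl ⟨i, ⟨a, b'⟩, c⟩))
          · exact Or.inr (Or.inr (Or.inr ⟨i, ⟨a, b'⟩, ⟨a, c⟩, d⟩))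
      · refine (ind_or_le _ _).trans ?_
        rw [add_assoc, add_assoc]
        refine add_le_add le_rfl ((ind_or_le _ _).trans ?_)
        refine add_le_add ?_ ((ind_or_le _ _).trans (add_le_add ?_ ?_))
        · refine (ind_exists_le _).trans_eq (sum_congr rfl fun _ _ => ind_and _ _)
        · refine (ind_exists_le _).trans_eq (sum_congr rfl fun _ _ => ind_and _ _)
        · refine (ind_exists_le _).trans_eq (sum_congr rfl fun _ _ => ?_)
          rw [ind_and, ind_and (_ ∧ _) (TV' _ _ _)]
    refine (avgHash_mono hB₁ hB₂ hS hpt).trans ?_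
    unfold avgHash
    simp_rw [avg_add, avg_const (isPMF_hashW hS), avg_const (isPMF_hashW hB₂),
      avg_const (isPMF_hashW hB₁)]
    rw [zero_add]
    refine add_le_add (add_le_add (add_le_add le_rfl ?_) ?_) ?_
    · exact avg_hash_sum_le hB₁ j fun _ => ind_nonneg _
    · exact avg_hash_sum_le hB₂ k fun _ => ind_nonneg _
    · have e : ∀ h₂ : Fin K → Fin B₂, avg (hashW K S) (fun s =>
          ∑ k', ind (k' ≠ k ∧ h₂ k' = h₂ k) *
              (ind (k' ≠ k ∧ s k' = s k) * ind (TV' (u j) (v j k') b)))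
          ≤ 1 / S * ∑ k', ind (k' ≠ k ∧ h₂ k' = h₂ k) * ind (TV' (u j) (v j k') b) := by
        intro h₂
        simp_rw [mul_left_comm (ind (_ ≠ k ∧ h₂ _ = h₂ k))]
        exact avg_hash_sum_le hS k fun _ => mul_nonneg (ind_nonneg _) (ind_nonneg _)
      refine (avg_mono (isPMF_hashW hB₂).1 e).trans ?_
      rw [avg_const_mul]
      calc _ ≤ 1 / (S : ℝ) * (1 / B₂ * ∑ k', ind (TV' (u j) (v j k') b)) :=
            mul_le_mul_of_nonneg_left (avg_hash_sum_le hB₂ k fun _ => ind_nonneg _) (by positivity)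
        _ = _ := by rw [← mul_assoc, one_div_mul_one_div, mul_comm (S : ℝ)]

lemma avgHash_badOther_le (hB₁ : 0 < B₁) (hB₂ : 0 < B₂) (hS : 0 < S)
    (u : Fin J → 𝕌) (v : Fin J → Fin K → 𝕍) (sel : 𝕏 → Option (Fin J × Fin K))
    (TU : 𝕌 → 𝔹 → Prop) (G₁ : 𝕌 → 𝕏 → Prop) (hG : ∀ x j k, sel x = some (j, k) → G₁ (u j) x)
    (x' : 𝕏) (b : 𝔹) :
    avgHash J K B₁ B₂ S (fun h₁ h₂ s => ind ((HashedBook.mk u v sel h₁ h₂ s).BadOther TU x' b))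
      ≤ ∑ j, ind (G₁ (u j) x' ∧ TU (u j) b) + 1 / B₁ * ∑ j, ind (TU (u j) b) := by
  have p1 : 0 ≤ 1 / (B₁ : ℝ) * ∑ j, ind (TU (u j) b) :=
    mul_nonneg (by positivity) (sum_nonneg fun _ _ => ind_nonneg _)
  have p2 : 0 ≤ ∑ j, ind (G₁ (u j) x' ∧ TU (u j) b) := sum_nonneg fun _ _ => ind_nonneg _
  rcases hx : sel x' with _ | ⟨j, k⟩
  · have : (fun h₁ h₂ s => ind
        ((HashedBook.mk u v sel h₁ h₂ s : HashedBook 𝕌 𝕍 𝕏 J K B₁ B₂ S).BadOther TU x' b))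
          = fun _ _ _ => 0 := by
      funext h₁ h₂ s
      refine ind_of_false ?_
      rintro ⟨j, k, h, -⟩
      simp [hx] at h
    rw [this, avgHash_const hB₁ hB₂ hS]
    linarith
  · have hpt : ∀ (h₁ : Fin J → Fin B₁) (h₂ : Fin K → Fin B₂) (s : Fin K → Fin S),
        ind ((HashedBook.mk u v sel h₁ h₂ s).BadOther TU x' b)
        ≤ ∑ j, ind (G₁ (u j) x' ∧ TU (u j) b)
          + ∑ j', ind (j' ≠ j ∧ h₁ j' = h₁ j) * ind (TU (u j') b) := by
      intro h₁ h₂ s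
      refine (ind_mono (R := (∃ j, G₁ (u j) x' ∧ TU (u j) b) ∨
        (∃ j', (j' ≠ j ∧ h₁ j' = h₁ j) ∧ TU (u j') b)) ?_).trans ?_
      · rintro ⟨j₀, k₀, h, j', h', h''⟩
        simp only [hx, Option.some.injEq, Prod.mk.injEq] at h
        obtain ⟨rfl, rfl⟩ := h
        by_cases hj : j' = j
        · exact Or.inl ⟨j, hG x' j k hx, hj ▸ h''⟩
        · exact Or.inr ⟨j', ⟨hj, h'⟩, h''⟩
      · refine (ind_or_le _ _).trans (add_le_add (ind_exists_le _) ?_)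
        exact (ind_exists_le _).trans_eq (sum_congr rfl fun _ _ => ind_and _ _)
    refine (avgHash_mono hB₁ hB₂ hS hpt).trans ?_
    unfold avgHash
    simp_rw [avg_const (isPMF_hashW hS), avg_const (isPMF_hashW hB₂), avg_add,
      avg_const (isPMF_hashW hB₁)]
    exact add_le_add le_rfl (avg_hash_sum_le hB₁ j fun _ => ind_nonneg _)

lemma exists_le_of_avgHash_le (hB₁ : 0 < B₁) (hB₂ : 0 < B₂) (hS : 0 < S)
    {f : (Fin J → Fin B₁) → (Fin K → Fin B₂) → (Fin K → Fin S) → ℝ} {c : ℝ}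
    (h : avgHash J K B₁ B₂ S f ≤ c) : ∃ h₁ h₂ s, f h₁ h₂ s ≤ c := by
  obtain ⟨h₁, h⟩ := exists_le_of_avg_le (isPMF_hashW hB₁) h
  obtain ⟨h₂, h⟩ := exists_le_of_avg_le (isPMF_hashW hB₂) h
  obtain ⟨s, h⟩ := exists_le_of_avg_le (isPMF_hashW hS) h
  exact ⟨h₁, h₂, s, h⟩

end Hash

section

variable {𝕌 𝕍 𝕏 𝔹 : Type*} [Fintype 𝕌] [Fintype 𝕍] [Fintype 𝕏] [Fintype 𝔹]

/-- Markov's inequality. -/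
lemma ind_not_le_div {a θ : ℝ} (hθ : 0 < θ) (ha : 0 ≤ a) : ind (¬ a ≤ θ) ≤ a / θ := by
  by_cases h : a ≤ θ
  · rw [ind_of_false (not_not.2 h)]; positivity
  · rw [ind_of_true h, le_div_iff₀ hθ]; linarith

/-- If `w` is dominated by `C • p` on `G`, then `p` gives `G` probability at least `a / C`. -/
lemma div_le_avg_of_le {α : Type*} [Fintype α] {w p : α → ℝ} {C a : ℝ} (hC : 0 < C)
    (G : α → Prop) (hG : ∀ x, G x → w x ≤ C * p x)
    (ha : a ≤ avg w fun x => ind (G x)) : 1 / (C / a) ≤ avg p fun x => ind (G x) := by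
  rw [one_div_div, div_le_iff₀ hC]
  refine ha.trans ?_
  rw [avg, avg, sum_mul]
  refine sum_le_sum fun x _ => ?_
  by_cases h : G x
  · rw [ind_of_true h]
    linarith [hG x h]
  · rw [ind_of_false h]; simp

/-- Existence of a good hashed codebook. -/
theorem exists_hashedBook {J K B₁ B₂ S : ℕ} {pU : 𝕌 → ℝ} {pVU : 𝕌 → 𝕍 → ℝ} {PX : 𝕏 → ℝ}
    {kQ : 𝕏 → 𝔹 → ℝ} {k₁ : 𝕏 → 𝕌 → ℝ} {k₂ : 𝕏 → 𝕌 → 𝕍 → ℝ}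
    (hU : IsPMF pU) (hVU : ∀ u, IsPMF (pVU u)) (hX : IsPMF PX)
    (hQ : ∀ x, IsPMF (kQ x)) (hk₁ : ∀ x, IsPMF (k₁ x)) (hk₂ : ∀ x u, IsPMF (k₂ x u))
    (hJ : 0 < J) (hK : 0 < K) (hB₁ : 0 < B₁) (hB₂ : 0 < B₂) (hS : 0 < S)
    (T : 𝕌 → 𝕍 → 𝕏 → 𝔹 → Prop) {η θ : ℝ} (hθ : 0 < θ) (hθ1 : θ < 1)
    (hT : avg PX (fun x => avg (k₁ x) fun u => avg (k₂ x u) fun v => avg (kQ x) fun b =>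
      ind (¬ T u v x b)) ≤ η)
    {C₁ C₂ : ℝ} (hC₁ : 0 < C₁) (hC₂ : 0 < C₂)
    (t₁ : ∀ u v x b, T u v x b → k₁ x u ≤ C₁ * pU u)
    (t₂ : ∀ u v x b, T u v x b → k₂ x u v ≤ C₂ * pVU u v)
    {c₁ c₂ c₃ c₄ : ℝ} (hc₂ : 0 ≤ c₂) (hc₃ : 0 ≤ c₃) (hc₄ : 0 ≤ c₄)
    (TUX : 𝕌 → 𝕏 → Prop) (hTTUX : ∀ u v x b, T u v x b → TUX u x)
    (hTUX : ∀ u, avg PX (fun x => ind (TUX u x)) ≤ c₂)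
    (TU : 𝕌 → 𝔹 → Prop) (hTU : ∀ b, avg pU (fun u => ind (TU u b)) ≤ c₁)
    (TV TV' : 𝕌 → 𝕍 → 𝔹 → Prop) (hTV : ∀ u b, avg (pVU u) (fun v => ind (TV u v b)) ≤ c₃)
    (hTV' : ∀ u b, avg (pVU u) (fun v => ind (TV' u v b)) ≤ c₄) {W : ℝ} (hW : 0 ≤ W) :
    ∃ c : HashedBook 𝕌 𝕍 𝕏 J K B₁ B₂ S,
      avg PX (fun x => avg (kQ x) fun b => ind (c.BadOwn T TU TV TV' x b))
        + W * avg PX (fun x' => avg PX fun x => avg (kQ x) fun b => ind (c.BadOther TU x' b))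
      ≤ θ + 4 * η / θ + 2 * C₁ / J + 2 * C₂ / K + (W + 1) / B₁ * (J * c₁) + W * (J * (c₁ * c₂))
        + 1 / B₂ * (K * c₃) + 1 / (B₂ * S) * (K * c₄) := by
  set G₂ : 𝕌 → 𝕍 → 𝕏 → Prop := fun u v x => avg (kQ x) (fun b => ind (¬ T u v x b)) ≤ θ with hG₂
  set G₁ : 𝕌 → 𝕏 → Prop := fun u x => 1 / 2 ≤ avg (k₂ x u) fun v => ind (G₂ u v x) with hG₁
  have exT : ∀ u v x, G₂ u v x → ∃ b, T u v x b := by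
    intro u v x h
    by_contra! hn
    have : avg (kQ x) (fun b => ind (¬ T u v x b)) = 1 := by
      simp_rw [fun b => ind_of_true (hn b)]
      exact avg_const (hQ x) 1
    have h' : avg (kQ x) (fun b => ind (¬ T u v x b)) ≤ θ := h
    linarith
  have exV : ∀ u x, G₁ u x → ∃ v b, T u v x b := by
    intro u x h
    by_contra! hn
    have h0 : ∀ v, ind (G₂ u v x) = 0 := fun v => ind_of_false fun hv => by
      obtain ⟨b, hb⟩ := exT u v x hv
      exact hn v b hb
    have h' : 1 / 2 ≤ avg (k₂ x u) fun v => ind (G₂ u v x) := h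
    simp_rw [h0] at h'
    rw [avg_const (hk₂ x u)] at h'
    norm_num at h'
  have h₁ : ∀ u x, G₁ u x → 1 / (C₂ / (1 / 2)) ≤ avg (pVU u) fun v => ind (G₂ u v x) := by
    intro u x h
    refine div_le_avg_of_le hC₂ _ (fun v hv => ?_) h
    obtain ⟨b, hb⟩ := exT u v x hv
    exact t₂ u v x b hb
  have h₀' : ∀ x, ¬ 1 / (C₁ / (1 / 2)) ≤ avg pU (fun u => ind (G₁ u x)) →
      ¬ 1 / 2 ≤ avg (k₁ x) fun u => ind (G₁ u x) := by
    intro x hx hn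
    refine hx (div_le_avg_of_le hC₁ _ (fun u hu => ?_) hn)
    obtain ⟨v, b, hb⟩ := exV u x hu
    exact t₁ u v x b hb
  have h₀ : avg PX (fun x => ind (¬ 1 / (C₁ / (1 / 2)) ≤ avg pU fun u => ind (G₁ u x)))
      ≤ 4 * η / θ := by
    have e : ∀ x, ind (¬ 1 / (C₁ / (1 / 2)) ≤ avg pU fun u => ind (G₁ u x))
        ≤ 4 / θ * avg (k₁ x) (fun u => avg (k₂ x u) fun v => avg (kQ x) fun b =>
          ind (¬ T u v x b)) := by
      intro x
      have b2 : ∀ u v, ind (¬ G₂ u v x) ≤ 1 / θ * avg (kQ x) (fun b => ind (¬ T u v x b)) := by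
        intro u v
        refine (ind_not_le_div hθ (avg_nonneg (hQ x).1 fun _ => ind_nonneg _)).trans_eq ?_
        ring
      have b1 : ∀ u, ind (¬ G₁ u x) ≤ 2 * avg (k₂ x u) (fun v => ind (¬ G₂ u v x)) := by
        intro u
        by_cases h : G₁ u x
        · rw [ind_of_false (not_not.2 h)]
          exact mul_nonneg zero_le_two (avg_nonneg (hk₂ x u).1 fun _ => ind_nonneg _)
        · rw [ind_of_true h, avg_ind_not (hk₂ x u)]
          have h' : avg (k₂ x u) (fun v => ind (G₂ u v x)) < 1 / 2 := not_le.1 h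
          linarith
      have b0 : ind (¬ 1 / (C₁ / (1 / 2)) ≤ avg pU fun u => ind (G₁ u x))
          ≤ 2 * avg (k₁ x) (fun u => ind (¬ G₁ u x)) := by
        refine (ind_mono (h₀' x)).trans ?_
        by_cases h : 1 / 2 ≤ avg (k₁ x) fun u => ind (G₁ u x)
        · rw [ind_of_false (not_not.2 h)]
          exact mul_nonneg zero_le_two (avg_nonneg (hk₁ x).1 fun _ => ind_nonneg _)
        · rw [ind_of_true h, avg_ind_not (hk₁ x)]
          have h' := not_le.1 h
          linarith
      refine b0.trans ?_
      have b3 : avg (k₁ x) (fun u => ind (¬ G₁ u x)) ≤ avg (k₁ x) fun u =>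
          2 * avg (k₂ x u) fun v => 1 / θ * avg (kQ x) (fun b => ind (¬ T u v x b)) :=
        avg_mono (hk₁ x).1 fun u => (b1 u).trans
          (mul_le_mul_of_nonneg_left (avg_mono (hk₂ x u).1 (b2 u)) zero_le_two)
      simp_rw [avg_const_mul] at b3
      calc _ ≤ 2 * (2 * (1 / θ * _)) := mul_le_mul_of_nonneg_left b3 zero_le_two
        _ = _ := by ring
    refine (avg_mono hX.1 e).trans ?_
    rw [avg_const_mul, div_mul_eq_mul_div]
    gcongr
  have hG₁X : ∀ u, avg PX (fun x => ind (G₁ u x)) ≤ c₂ := fun u =>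
    (avg_mono hX.1 fun x => ind_mono fun h => by
      obtain ⟨v, b, hb⟩ := exV u x h
      exact hTTUX u v x b hb).trans (hTUX u)
  obtain ⟨u, v, huv⟩ := exists_codebook (G₁ := G₁) (G₂ := G₂) hU hVU hX hQ hJ hK
    (a₁ := 1 / (C₁ / (1 / 2))) (a₂ := 1 / (C₂ / (1 / 2))) (by positivity) (by positivity) h₀ h₁
    hc₂ hc₃ hc₄ TU hTU hG₁X TV TV' hTV hTV' (α₁ := (W + 1) / B₁) (α₂ := W) (α₃ := 1 / B₂)
    (α₄ := 1 / (B₂ * S)) (by positivity) hW (by positivity) (by positivity)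
  set sel := select G₁ G₂ u v with hsel
  have hmain : avgHash J K B₁ B₂ S (fun h₁ h₂ s =>
      avg PX (fun x => avg (kQ x) fun b =>
          ind ((HashedBook.mk u v sel h₁ h₂ s).BadOwn T TU TV TV' x b))
        + W * avg PX (fun x' => avg PX fun x => avg (kQ x) fun b =>
          ind ((HashedBook.mk u v sel h₁ h₂ s).BadOther TU x' b)))
      ≤ θ + (avg PX (fun x => ind (sel x = none)) + (W + 1) / B₁ * confU PX kQ TU u
        + W * confUX PX kQ TU G₁ u + 1 / B₂ * confV PX kQ TV G₁ u v
        + 1 / (B₂ * S) * confV PX kQ TV' G₁ u v) := by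
    have split : avgHash J K B₁ B₂ S (fun h₁ h₂ s =>
      avg PX (fun x => avg (kQ x) fun b =>
          ind ((HashedBook.mk u v sel h₁ h₂ s).BadOwn T TU TV TV' x b))
        + W * avg PX (fun x' => avg PX fun x => avg (kQ x) fun b =>
          ind ((HashedBook.mk u v sel h₁ h₂ s).BadOther TU x' b)))
      = avg PX (fun x => avg (kQ x) fun b => avgHash J K B₁ B₂ S fun h₁ h₂ s =>
          ind ((HashedBook.mk u v sel h₁ h₂ s).BadOwn T TU TV TV' x b))
        + W * avg PX (fun x' => avg PX fun x => avg (kQ x) fun b =>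
          avgHash J K B₁ B₂ S fun h₁ h₂ s =>
            ind ((HashedBook.mk u v sel h₁ h₂ s).BadOther TU x' b)) := by
      simp_rw [← avgHash_avg]
      unfold avgHash
      simp_rw [avg_add, avg_const_mul]
    rw [split]
    have i1 : avg PX (fun x => avg (kQ x) fun b => avgHash J K B₁ B₂ S fun h₁ h₂ s =>
          ind ((HashedBook.mk u v sel h₁ h₂ s).BadOwn T TU TV TV' x b))
        ≤ avg PX (fun x => ind (sel x = none)) + θ + 1 / B₁ * confU PX kQ TU u
          + 1 / B₂ * confV PX kQ TV G₁ u v + 1 / (B₂ * S) * confV PX kQ TV' G₁ u v := by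
      have hθx : avg PX (fun x => avg (kQ x) fun b =>
          ind (∃ j k, sel x = some (j, k) ∧ ¬ T (u j) (v j k) x b)) ≤ θ := by
        refine avg_le hX fun x => ?_
        rcases hx : sel x with _ | ⟨j, k⟩
        · rw [show (fun b => ind (∃ j k, (none : Option (Fin J × Fin K)) = some (j, k) ∧
            ¬ T (u j) (v j k) x b)) = fun _ => 0 from funext fun b => ind_of_false (by simp),
            avg_const (hQ x)]
          exact hθ.le
        · have hg : G₂ (u j) (v j k) x := (select_eq_some hx).2.2
          refine (avg_mono (hQ x).1 fun b => ind_mono ?_).trans hg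
          rintro ⟨j', k', h, h'⟩
          obtain ⟨rfl, rfl⟩ := Prod.mk.inj (Option.some.inj h)
          exact h'
      have step : avg PX (fun x => avg (kQ x) fun b => avgHash J K B₁ B₂ S fun h₁ h₂ s =>
          ind ((HashedBook.mk u v sel h₁ h₂ s).BadOwn T TU TV TV' x b))
          ≤ _ := avg_mono hX.1 fun x => avg_mono (hQ x).1 fun b =>
        avgHash_badOwn_le hB₁ hB₂ hS u v sel T TU TV TV' (fun x => pick fun j => G₁ (u j) x)
          (fun x j k h => (select_eq_some h).1) x b
      simp_rw [avg_add, avg_const_mul, fun x => avg_const (hQ x)] at step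
      unfold confU confV
      linarith
    have i2 : avg PX (fun x' => avg PX fun x => avg (kQ x) fun b =>
          avgHash J K B₁ B₂ S fun h₁ h₂ s =>
            ind ((HashedBook.mk u v sel h₁ h₂ s).BadOther TU x' b))
        ≤ confUX PX kQ TU G₁ u + 1 / B₁ * confU PX kQ TU u := by
      have step : avg PX (fun x' => avg PX fun x => avg (kQ x) fun b =>
          avgHash J K B₁ B₂ S fun h₁ h₂ s =>
            ind ((HashedBook.mk u v sel h₁ h₂ s).BadOther TU x' b))
          ≤ _ := avg_mono hX.1 fun x' => avg_mono hX.1 fun x => avg_mono (hQ x).1 fun b =>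
        avgHash_badOther_le hB₁ hB₂ hS u v sel TU G₁
          (fun x j k h => (select_eq_some h).2.1) x' b
      simp_rw [avg_add, avg_const_mul, avg_const hX] at step
      unfold confU confUX
      linarith
    have i3 := mul_le_mul_of_nonneg_left i2 hW
    have : (W + 1) / B₁ * confU PX kQ TU u
        = W * (1 / B₁ * confU PX kQ TU u) + 1 / B₁ * confU PX kQ TU u := by ring
    rw [this]
    linarith
  obtain ⟨h₁, h₂, s, h⟩ := exists_le_of_avgHash_le hB₁ hB₂ hS hmain
  refine ⟨⟨u, v, sel, h₁, h₂, s⟩, h.trans ?_⟩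
  have e1 : 1 / ((J : ℝ) * (1 / (C₁ / (1 / 2)))) = 2 * C₁ / J := by
    field_simp
  have e2 : 1 / ((K : ℝ) * (1 / (C₂ / (1 / 2)))) = 2 * C₂ / K := by
    field_simp
  rw [e1, e2] at huv
  linarith

end

/-! ### The law of a code in which all users apply the same deterministic encoder -/

section CodeLaw

lemma sum_mul_ind_eq {α : Type*} [Fintype α] (a : α) (g : α → ℝ) :
    ∑ b, g b * ind (b = a) = g a := by
  rw [← sum_ind_eq a g]
  exact sum_congr rfl fun b _ => by rw [mul_comm, show (b = a) = (a = b) from propext eq_comm]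

/-- The law of `n` i.i.d. source symbols. -/
noncomputable def seqX {𝒳 : Type} {n : ℕ} (PX : 𝒳 → ℝ) (x : Fin n → 𝒳) : ℝ := ∏ i, PX (x i)

/-- The transition law of `n` uses of the channel. -/
noncomputable def seqQ {𝒳 𝔅 : Type} {n : ℕ} (Q : 𝒳 → 𝔅 → ℝ) (x : Fin n → 𝒳) (b : Fin n → 𝔅) : ℝ :=
  ∏ i, Q (x i) (b i)

/-- The joint law of a source sequence and the corresponding observations. -/
noncomputable def seqXQ {𝒳 𝔅 : Type} {n : ℕ} (PX : 𝒳 → ℝ) (Q : 𝒳 → 𝔅 → ℝ)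
    (p : (Fin n → 𝒳) × (Fin n → 𝔅)) : ℝ := seqX PX p.1 * seqQ Q p.1 p.2

lemma isPMF_seqX {𝒳 : Type} [Fintype 𝒳] {n : ℕ} {PX : 𝒳 → ℝ} (h : IsPMF PX) :
    IsPMF (seqX PX : (Fin n → 𝒳) → ℝ) := isPMF_prod fun _ => h

lemma isPMF_seqQ {𝒳 𝔅 : Type} [Fintype 𝔅] {n : ℕ} {Q : 𝒳 → 𝔅 → ℝ} (h : ∀ x, IsPMF (Q x))
    (x : Fin n → 𝒳) : IsPMF (seqQ Q x) := isPMF_prod fun i => h (x i)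

lemma sum_seqXQ {𝒳 𝔅 : Type} [Fintype 𝒳] [Fintype 𝔅] {n : ℕ} (PX : 𝒳 → ℝ) (Q : 𝒳 → 𝔅 → ℝ)
    (F : (Fin n → 𝒳) → (Fin n → 𝔅) → ℝ) :
    ∑ p, seqXQ PX Q p * F p.1 p.2 = avg (seqX PX) fun x => avg (seqQ Q x) fun b => F x b := by
  simp only [avg, Fintype.sum_prod_type, seqXQ, mul_sum, mul_assoc]

lemma isPMF_seqXQ {𝒳 𝔅 : Type} [Fintype 𝒳] [Fintype 𝔅] {n : ℕ} {PX : 𝒳 → ℝ} {Q : 𝒳 → 𝔅 → ℝ}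
    (hX : IsPMF PX) (hQ : ∀ x, IsPMF (Q x)) :
    IsPMF (seqXQ PX Q : (Fin n → 𝒳) × (Fin n → 𝔅) → ℝ) := by
  refine ⟨fun p => mul_nonneg ((isPMF_seqX hX).1 _) ((isPMF_seqQ hQ _).1 _), ?_⟩
  have := sum_seqXQ (n := n) PX Q fun _ _ => 1
  simp only [mul_one] at this
  rw [this]
  simp_rw [fun x : Fin n → 𝒳 => avg_const (isPMF_seqQ hQ x)]
  exact avg_const (isPMF_seqX hX) 1

variable {𝒳 𝒴 𝒵 : Type} [Fintype 𝒳] [Fintype 𝒴] [Fintype 𝒵] {PX : 𝒳 → ℝ} {Q : 𝒳 → 𝒴 × 𝒵 → ℝ}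
  {n Mc Wc Sc : ℕ}

lemma sum_codeDist (C : IACode 𝒳 𝒴 n Mc Wc Sc) (w : Fin Wc)
    (F : (Fin Wc → Fin n → 𝒳) → (Fin n → 𝒴 × 𝒵) → ℝ) :
    ∑ ω, codeDist PX Q C w ω * F ω.1 ω.2.2
      = ∑ o, piW (fun _ => seqX PX) o * ∑ b, seqQ Q (o w) b * F o b := by
  rw [Fintype.sum_prod_type]
  refine sum_congr rfl fun o _ => ?_
  rw [Fintype.sum_prod_type, sum_comm, mul_sum]
  refine sum_congr rfl fun b _ => ?_
  have h : ∑ m : Fin Wc → Fin Mc × Fin Sc, ∏ w', C.enc w' (o w') (m w') = 1 :=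
    (isPMF_prod fun w' => C.enc_pmf w' (o w')).2
  simp only [codeDist]
  calc _ = ∑ m : Fin Wc → Fin Mc × Fin Sc, (∏ w', C.enc w' (o w') (m w')) *
        (piW (fun _ => seqX PX) o * (seqQ Q (o w) b * F o b)) :=
        sum_congr rfl fun m _ => by simp only [piW, seqX, seqQ]; ring
    _ = _ := by rw [← sum_mul, h, one_mul]

/-- The sequences of the users who are not presented. -/
def others (w : Fin Wc) (ω : CodeSpace 𝒳 𝒴 𝒵 n Mc Wc Sc) : {w' // w' ≠ w} → Fin n → 𝒳 :=
  fun w' => ω.1 w'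

/-- The source sequence of the presented user and the corresponding observations. -/
def own (w : Fin Wc) (ω : CodeSpace 𝒳 𝒴 𝒵 n Mc Wc Sc) : (Fin n → 𝒳) × (Fin n → 𝒴 × 𝒵) :=
  (ω.1 w, ω.2.2)

lemma sum_codeDist_own_others (C : IACode 𝒳 𝒴 n Mc Wc Sc) (w : Fin Wc)
    (F : (Fin n → 𝒳) × (Fin n → 𝒴 × 𝒵) → ({w' // w' ≠ w} → Fin n → 𝒳) → ℝ) :
    ∑ ω, codeDist PX Q C w ω * F (own w ω) (others w ω)
      = ∑ p, seqXQ PX Q p * ∑ o, piW (fun _ => seqX PX) o * F p o := by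
  refine (sum_codeDist C w fun o b => F (o w, b) fun w' => o w').trans ?_
  rw [← (Equiv.funSplitAt w (Fin n → 𝒳)).symm.sum_comp, Fintype.sum_prod_type,
    Fintype.sum_prod_type]
  refine sum_congr rfl fun x _ => ?_
  have h1 : ∀ o : {w' // w' ≠ w} → Fin n → 𝒳,
      (Equiv.funSplitAt w (Fin n → 𝒳)).symm (x, o) w = x := fun o => by
    simp [Equiv.funSplitAt]
  have h2 : ∀ o : {w' // w' ≠ w} → Fin n → 𝒳,
      (fun w' : {w' // w' ≠ w} => (Equiv.funSplitAt w (Fin n → 𝒳)).symm (x, o) w') = o :=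
      fun o => by
    funext w'
    simp [Equiv.funSplitAt, w'.2]
  have h3 : ∀ o : {w' // w' ≠ w} → Fin n → 𝒳,
      piW (fun _ => seqX PX) ((Equiv.funSplitAt w (Fin n → 𝒳)).symm (x, o))
        = seqX PX x * piW (fun _ => seqX PX) o := fun o => by
    rw [piW, Fintype.prod_eq_mul_prod_subtype_ne _ w, h1]
    congr 1
    exact prod_congr rfl fun w' _ => by rw [congrFun (h2 o) w']
  simp_rw [h1, h2, h3, mul_sum]
  rw [sum_comm]
  refine sum_congr rfl fun b _ => sum_congr rfl fun o _ => ?_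
  simp only [seqXQ]
  ring

lemma isPMF_codeDist (hX : IsPMF PX) (hQ : ∀ x, IsPMF (Q x))
    (C : IACode 𝒳 𝒴 n Mc Wc Sc) (w : Fin Wc) :
    IsPMF (codeDist PX Q C w) := by
  refine ⟨fun ω => ?_, ?_⟩
  · exact mul_nonneg (mul_nonneg (prod_nonneg fun _ _ => prod_nonneg fun _ _ => hX.1 _)
      (prod_nonneg fun _ _ => (C.enc_pmf _ _).1 _)) (prod_nonneg fun _ _ => (hQ _).1 _)
  · have := sum_codeDist_own_others (PX := PX) (Q := Q) C w fun _ _ => 1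
    simp only [mul_one, (isPMF_piW fun _ : {w' // w' ≠ w} => isPMF_seqX (n := n) hX).2,
      (isPMF_seqXQ (n := n) hX hQ).2] at this
    exact this

lemma pmass_own (hX : IsPMF PX) (C : IACode 𝒳 𝒴 n Mc Wc Sc) (w : Fin Wc)
    (p : (Fin n → 𝒳) × (Fin n → 𝒴 × 𝒵)) :
    pmass (codeDist PX Q C w) (own w) p = seqXQ PX Q p := by
  rw [pmass_eq, sum_codeDist_own_others C w fun p' _ => ind (p' = p)]
  simp_rw [← sum_mul, (isPMF_piW fun _ : {w' // w' ≠ w} => isPMF_seqX (n := n) hX).2, one_mul]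
  exact sum_mul_ind_eq p _

lemma own_indep_others (hX : IsPMF PX) (hQ : ∀ x, IsPMF (Q x))
    (C : IACode 𝒳 𝒴 n Mc Wc Sc) (w : Fin Wc)
    (p : (Fin n → 𝒳) × (Fin n → 𝒴 × 𝒵)) (o : {w' // w' ≠ w} → Fin n → 𝒳) :
    pmass (codeDist PX Q C w) (fun ω => (own w ω, others w ω)) (p, o)
      = pmass (codeDist PX Q C w) (own w) p * pmass (codeDist PX Q C w) (others w) o := by
  have hO : pmass (codeDist PX Q C w) (others w) o = piW (fun _ => seqX PX) o := by
    rw [pmass_eq, sum_codeDist_own_others C w fun _ o' => ind (o' = o), ← sum_mul,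
      (isPMF_seqXQ (n := n) hX hQ).2, one_mul, sum_mul_ind_eq]
  rw [hO, pmass_own hX, pmass_eq,
    sum_codeDist_own_others C w fun p' o' => ind ((p', o') = (p, o))]
  simp_rw [Prod.mk.injEq, ind_and, mul_left_comm _ (ind (_ = p)), ← mul_sum, sum_mul_ind_eq,
    ← mul_assoc, ← sum_mul, sum_mul_ind_eq]

lemma mutInf_own_le (hX : IsPMF PX) (hQ : ∀ x, IsPMF (Q x))
    {α β γ δ : Type} [Fintype α] [Fintype β] [Fintype γ] [Fintype δ]
    (C : IACode 𝒳 𝒴 n Mc Wc Sc) (w : Fin Wc)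
    {G : CodeSpace 𝒳 𝒴 𝒵 n Mc Wc Sc → α} {H : CodeSpace 𝒳 𝒴 𝒵 n Mc Wc Sc → γ}
    (g : (Fin n → 𝒳) × (Fin n → 𝒴 × 𝒵) → α) (t : (Fin n → 𝒳) × (Fin n → 𝒴 × 𝒵) → β)
    (d : ({w' // w' ≠ w} → Fin n → 𝒳) → δ) (h : β → δ → γ)
    (hG : ∀ ω, codeDist PX Q C w ω ≠ 0 → G ω = g (own w ω))
    (hH : ∀ ω, codeDist PX Q C w ω ≠ 0 → H ω = h (t (own w ω)) (d (others w ω))) :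
    mutInf (codeDist PX Q C w) G H ≤ mutInf (seqXQ PX Q) g t := by
  have hμ := isPMF_codeDist hX hQ C w
  have e1 : mutInf (codeDist PX Q C w) G H = mutInf (codeDist PX Q C w) (fun ω => g (own w ω))
      (fun ω => h (t (own w ω)) (d (others w ω))) := by
    unfold mutInf
    rw [ent_congr hG, ent_congr hH,
      ent_congr (X := fun ω => (G ω, H ω)) fun ω hω => by rw [hG ω hω, hH ω hω]]
  rw [e1]
  refine (mutInf_le_of_determines hμ _ (fun ω => (t (own w ω), d (others w ω))) _
    fun ω ω' hh => ?_).trans_eq ?_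
  · obtain ⟨h1, h2⟩ := Prod.mk.inj hh
    rw [h1, h2]
  · have ind := own_indep_others hX hQ C w
    have i1 := ent_pair_of_indep hμ (fun ω => t (own w ω)) (fun ω => d (others w ω))
      (pmass_pair_comp_of_indep _ _ ind t d)
    have i2 := ent_pair_of_indep hμ (fun ω => (g (own w ω), t (own w ω))) (fun ω => d (others w ω))
      (pmass_pair_comp_of_indep _ _ ind (fun p => (g p, t p)) d)
    have i3 : ent (codeDist PX Q C w) (fun ω => (g (own w ω), t (own w ω), d (others w ω)))
        = ent (codeDist PX Q C w) (fun ω => ((g (own w ω), t (own w ω)), d (others w ω))) :=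
      ent_congr_iff _ fun ω ω' => by simp only [Prod.mk.injEq, and_assoc]
    have hown : pmass (codeDist PX Q C w) (own w) = seqXQ PX Q := funext (pmass_own hX C w)
    unfold mutInf
    rw [i3, i1, i2, ← hown, ent_map, ent_map, ent_map]
    ring

lemma ent_own_eq (hX : IsPMF PX) {α : Type} [Fintype α]
    (C : IACode 𝒳 𝒴 n Mc Wc Sc) (w : Fin Wc)
    {G : CodeSpace 𝒳 𝒴 𝒵 n Mc Wc Sc → α}
    (g : (Fin n → 𝒳) × (Fin n → 𝒴 × 𝒵) → α)
    (hG : ∀ ω, codeDist PX Q C w ω ≠ 0 → G ω = g (own w ω)) :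
    ent (codeDist PX Q C w) G = ent (seqXQ PX Q) g := by
  have hown : pmass (codeDist PX Q C w) (own w) = seqXQ PX Q := funext (pmass_own hX C w)
  rw [ent_congr hG, ← hown, ent_map]

lemma prob_codeDist_le (hX : IsPMF PX) (hQ : ∀ x, IsPMF (Q x))
    (C : IACode 𝒳 𝒴 n Mc Wc Sc) (w : Fin Wc)
    (E : CodeSpace 𝒳 𝒴 𝒵 n Mc Wc Sc → Prop) (E₁ E₂ : (Fin n → 𝒳) → (Fin n → 𝒴 × 𝒵) → Prop)
    (hE : ∀ ω, codeDist PX Q C w ω ≠ 0 → E ω →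
      E₁ (ω.1 w) ω.2.2 ∨ ∃ w', w' ≠ w ∧ E₂ (ω.1 w') ω.2.2) :
    prob (codeDist PX Q C w) E
      ≤ avg (seqX PX) (fun x => avg (seqQ Q x) fun b => ind (E₁ x b))
        + ((Wc : ℝ) - 1) * avg (seqX PX) fun x' => avg (seqX PX) fun x => avg (seqQ Q x) fun b =>
          ind (E₂ x' b) := by
  have hμ := isPMF_codeDist hX hQ C w
  set F : (Fin n → 𝒳) × (Fin n → 𝒴 × 𝒵) → ({w' // w' ≠ w} → Fin n → 𝒳) → ℝ :=
    fun p o => ind (E₁ p.1 p.2) + ∑ w', ind (E₂ (o w') p.2) with hF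
  have step : prob (codeDist PX Q C w) E ≤ ∑ ω, codeDist PX Q C w ω * F (own w ω) (others w ω) := by
    rw [prob_eq]
    refine avg_mono' (w := codeDist PX Q C w) hμ.1 fun ω hω => ?_
    refine (ind_mono (R := E₁ (own w ω).1 (own w ω).2 ∨ ∃ w' : {w' // w' ≠ w},
      E₂ (others w ω w') (own w ω).2) fun h => ?_).trans
      ((ind_or_le _ _).trans (add_le_add le_rfl (ind_exists_le _)))
    rcases hE ω hω h with h | ⟨w', h1, h2⟩
    · exact Or.inl h
    · exact Or.inr ⟨⟨w', h1⟩, h2⟩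
  refine step.trans ?_
  rw [sum_codeDist_own_others C w F]
  have hO := isPMF_piW fun _ : {w' // w' ≠ w} => isPMF_seqX (n := n) hX
  have e : ∀ p : (Fin n → 𝒳) × (Fin n → 𝒴 × 𝒵),
      ∑ o, piW (fun _ : {w' // w' ≠ w} => seqX PX) o * F p o
      ≤ ind (E₁ p.1 p.2) + ((Wc : ℝ) - 1) * avg (seqX PX) fun x' => ind (E₂ x' p.2) := by
    intro p
    change avg _ (fun o => F p o) ≤ _
    rw [hF, avg_add, avg_const hO, avg_sum]
    gcongr
    refine (sum_le_card_nsmul _ _ (avg (seqX PX) fun x' => ind (E₂ x' p.2))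
      fun w' _ => ?_).trans ?_
    · exact (avg_piW_coord (fun _ : {w' // w' ≠ w} => isPMF_seqX hX) w'
        (fun x' => ind (E₂ x' p.2))).le
    · rw [nsmul_eq_mul]
      refine mul_le_mul_of_nonneg_right ?_ (avg_nonneg (isPMF_seqX hX).1 fun _ => ind_nonneg _)
      have h1 : Fintype.card {w' // w' ≠ w} = Wc - 1 := by simp
      rw [card_univ, h1, Nat.cast_sub w.pos, Nat.cast_one]
  refine (sum_le_sum fun p _ => mul_le_mul_of_nonneg_left (e p)
    ((isPMF_seqXQ (n := n) hX hQ).1 p)).trans_eq ?_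
  rw [sum_seqXQ PX Q fun x b =>
    ind (E₁ x b) + ((Wc : ℝ) - 1) * avg (seqX PX) fun x' => ind (E₂ x' b)]
  simp_rw [avg_add, avg_const_mul]
  congr 2
  rw [avg_comm]
  congr 1
  funext x
  rw [avg_comm]

end CodeLaw

lemma pick_eq_some_of_unique {ι : Type*} {P : ι → Prop} {i : ι} (h : P i)
    (hu : ∀ i', P i' → i' = i) : pick P = some i := by
  rcases hp : pick P with _ | i'
  · exact absurd h (pick_none hp i)
  · rw [hu i' (pick_spec hp)]

namespace HashedBook

variable {𝕌 𝕍 𝕏 𝕐 : Type*} {J K B₁ B₂ S : ℕ}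

/-- The description stored for the source sequence `x`. -/
def desc (c : HashedBook 𝕌 𝕍 𝕏 J K B₁ B₂ S) (x : 𝕏) : Option (Fin B₁ × Fin B₂) :=
  (c.sel x).map fun p => (c.h₁ p.1, c.h₂ p.2)

/-- The first index and the hash of the second index chosen for the source sequence `x`. -/
def fine (c : HashedBook 𝕌 𝕍 𝕏 J K B₁ B₂ S) (x : 𝕏) : Option (Fin J × Fin B₂) :=
  (c.sel x).map fun p => (p.1, c.h₂ p.2)

lemma desc_eq_fine (c : HashedBook 𝕌 𝕍 𝕏 J K B₁ B₂ S) (x : 𝕏) :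
    c.desc x = (c.fine x).map fun p => (c.h₁ p.1, p.2) := by
  simp [desc, fine, Function.comp_def]

/-- The key extracted from the source sequence `x`. -/
def keyOf (c : HashedBook 𝕌 𝕍 𝕏 J K B₁ B₂ S) (s₀ : Fin S) (x : 𝕏) : Fin S :=
  ((c.sel x).map fun p => c.key p.2).getD s₀

lemma desc_of_sel {c : HashedBook 𝕌 𝕍 𝕏 J K B₁ B₂ S} {x : 𝕏} {j : Fin J} {k : Fin K}
    (h : c.sel x = some (j, k)) : c.desc x = some (c.h₁ j, c.h₂ k) := by simp [desc, h]

lemma keyOf_of_sel {c : HashedBook 𝕌 𝕍 𝕏 J K B₁ B₂ S} {s₀ : Fin S} {x : 𝕏} {j : Fin J} {k : Fin K}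
    (h : c.sel x = some (j, k)) : c.keyOf s₀ x = c.key k := by simp [keyOf, h]

/-- The description `m` is compatible with the measurement `y`. -/
def Cand (c : HashedBook 𝕌 𝕍 𝕏 J K B₁ B₂ S) (TU : 𝕌 → 𝕐 → Prop)
    (m : Option (Fin B₁ × Fin B₂)) (y : 𝕐) : Prop :=
  ∃ j p, m = some p ∧ c.h₁ j = p.1 ∧ TU (c.u j) y

/-- The key `s` is compatible with the description `m` and the measurement `y`. -/
def KeyCand (c : HashedBook 𝕌 𝕍 𝕏 J K B₁ B₂ S) (TU : 𝕌 → 𝕐 → Prop) (TV : 𝕌 → 𝕍 → 𝕐 → Prop)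
    (m : Option (Fin B₁ × Fin B₂)) (y : 𝕐) (s : Fin S) : Prop :=
  ∃ j k p, m = some p ∧ c.h₁ j = p.1 ∧ c.h₂ k = p.2 ∧ TU (c.u j) y ∧ TV (c.u j) (c.v j k) y ∧
    c.key k = s

/-- Identification from the stored descriptions and a measurement. -/
noncomputable def decId {W : ℕ} (c : HashedBook 𝕌 𝕍 𝕏 J K B₁ B₂ S) (TU : 𝕌 → 𝕐 → Prop)
    (w₀ : Fin W) (m : Fin W → Option (Fin B₁ × Fin B₂)) (y : 𝕐) : Fin W :=
  (pick fun w => c.Cand TU (m w) y).getD w₀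

/-- Authentication from the stored descriptions and a measurement. -/
noncomputable def decAu {W : ℕ} (c : HashedBook 𝕌 𝕍 𝕏 J K B₁ B₂ S) (TU : 𝕌 → 𝕐 → Prop)
    (TV : 𝕌 → 𝕍 → 𝕐 → Prop) (w₀ : Fin W) (s₀ : Fin S) (m : Fin W → Option (Fin B₁ × Fin B₂))
    (y : 𝕐) : Fin S :=
  (pick fun s => c.KeyCand TU TV (m (c.decId TU w₀ m y)) y s).getD s₀

lemma decode_correct {𝔹 : Type*} {W : ℕ} (c : HashedBook 𝕌 𝕍 𝕏 J K B₁ B₂ S) (Y : 𝔹 → 𝕐)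
    (T : 𝕌 → 𝕍 → 𝕏 → 𝔹 → Prop) (TU : 𝕌 → 𝕐 → Prop) (TV : 𝕌 → 𝕍 → 𝕐 → Prop)
    (TV' : 𝕌 → 𝕍 → 𝔹 → Prop) (hTU : ∀ u v x b, T u v x b → TU u (Y b))
    (hTV : ∀ u v x b, T u v x b → TV u v (Y b)) (w₀ : Fin W) (s₀ : Fin S) (x : Fin W → 𝕏) (b : 𝔹)
    (w : Fin W) (h₁ : ¬ c.BadOwn T (fun u b => TU u (Y b)) (fun u v b => TV u v (Y b)) TV' (x w) b)
    (h₂ : ∀ w', w' ≠ w → ¬ c.BadOther (fun u b => TU u (Y b)) (x w') b) :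
    c.decId TU w₀ (fun w => c.desc (x w)) (Y b) = w ∧
      c.decAu TU TV w₀ s₀ (fun w => c.desc (x w)) (Y b) = c.keyOf s₀ (x w) := by
  unfold BadOwn at h₁
  push Not at h₁
  obtain ⟨hne, h₁⟩ := h₁
  obtain ⟨⟨j, k⟩, hjk⟩ := Option.ne_none_iff_exists'.1 hne
  obtain ⟨hT, hU, hV, -⟩ := h₁ j k hjk
  have hId : c.decId TU w₀ (fun w => c.desc (x w)) (Y b) = w := by
    unfold decId
    rw [pick_eq_some_of_unique (i := w), Option.getD_some]
    · exact ⟨j, _, desc_of_sel hjk, rfl, hTU _ _ _ _ hT⟩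
    · rintro w' ⟨j', p, hp, hj', hj''⟩
      change c.desc (x w') = some p at hp
      by_contra hw
      refine h₂ w' hw ?_
      rcases hs : c.sel (x w') with _ | ⟨j₁, k₁⟩
      · simp [desc, hs] at hp
      · rw [desc_of_sel hs] at hp
        obtain rfl := Option.some.inj hp
        exact ⟨j₁, k₁, hs, j', hj', hj''⟩
  refine ⟨hId, ?_⟩
  unfold decAu
  rw [hId, pick_eq_some_of_unique (i := c.key k), Option.getD_some, keyOf_of_sel hjk]
  · exact ⟨j, k, _, desc_of_sel hjk, rfl, rfl, hTU _ _ _ _ hT, hTV _ _ _ _ hT, rfl⟩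
  · rintro s ⟨j', k', p, hp, hj', hk', hu', hv', rfl⟩
    simp only [desc_of_sel hjk, Option.some.injEq] at hp
    subst hp
    have hj : j' = j := by
      by_contra hj
      exact hU j' hj hj' hu'
    subst hj
    have hk : k' = k := by
      by_contra hk
      exact hV k' hk hk' hv'
    rw [hk]

/-- Descriptions as elements of `Fin`. -/
noncomputable def descEquiv (B₁ B₂ : ℕ) : Option (Fin B₁ × Fin B₂) ≃ Fin (B₁ * B₂ + 1) :=
  Fintype.equivFinOfCardEq (by simp)

/-- The code in which all users encode deterministically with the same hashed codebook. -/
noncomputable def toCode {𝒳 𝒴 : Type} {n W : ℕ} (c : HashedBook 𝕌 𝕍 (Fin n → 𝒳) J K B₁ B₂ S)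
    (TU : 𝕌 → (Fin n → 𝒴) → Prop) (TV : 𝕌 → 𝕍 → (Fin n → 𝒴) → Prop) (w₀ : Fin W) (s₀ : Fin S) :
    IACode 𝒳 𝒴 n (B₁ * B₂ + 1) W S where
  enc _ x p := ind ((descEquiv B₁ B₂ (c.desc x), c.keyOf s₀ x) = p)
  enc_pmf _ x := ⟨fun _ => ind_nonneg _, by
    have := sum_ind_eq (descEquiv B₁ B₂ (c.desc x), c.keyOf s₀ x) fun _ => 1
    simpa only [mul_one] using this⟩
  gId m y := c.decId TU w₀ (fun w => (descEquiv B₁ B₂).symm (m w)) y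
  gAu m y := c.decAu TU TV w₀ s₀ (fun w => (descEquiv B₁ B₂).symm (m w)) y

section

variable {𝒳 𝒴 𝒵 : Type} [Fintype 𝒳] {PX : 𝒳 → ℝ} {Q : 𝒳 → 𝒴 × 𝒵 → ℝ}
  {n W : ℕ} (c : HashedBook 𝕌 𝕍 (Fin n → 𝒳) J K B₁ B₂ S)
  (TU : 𝕌 → (Fin n → 𝒴) → Prop) (TV : 𝕌 → 𝕍 → (Fin n → 𝒴) → Prop) (w₀ : Fin W) (s₀ : Fin S)

lemma toCode_support {w : Fin W} {ω : CodeSpace 𝒳 𝒴 𝒵 n (B₁ * B₂ + 1) W S}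
    (h : codeDist PX Q (c.toCode TU TV w₀ s₀) w ω ≠ 0) (w' : Fin W) :
    ω.2.1 w' = (descEquiv B₁ B₂ (c.desc (ω.1 w')), c.keyOf s₀ (ω.1 w')) := by
  have h1 := left_ne_zero_of_mul h
  have h2 := prod_ne_zero_iff.1 (right_ne_zero_of_mul h1) w' (mem_univ _)
  by_contra hne
  exact h2 (ind_of_false fun h => hne h.symm)

variable [Fintype 𝒴] [Fintype 𝒵]

lemma toCode_error_le (hX : IsPMF PX) (hQ : ∀ x, IsPMF (Q x))
    (T : 𝕌 → 𝕍 → (Fin n → 𝒳) → (Fin n → 𝒴 × 𝒵) → Prop) (TV' : 𝕌 → 𝕍 → (Fin n → 𝒴 × 𝒵) → Prop)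
    (hTU : ∀ u v x b, T u v x b → TU u fun i => (b i).1)
    (hTV : ∀ u v x b, T u v x b → TV u v fun i => (b i).1) (w : Fin W) :
    prob (codeDist PX Q (c.toCode TU TV w₀ s₀) w (𝒵 := 𝒵))
      (fun ω => ¬ ((c.toCode TU TV w₀ s₀).gId (Mbar ω) (Yseq ω) = w ∧
        (c.toCode TU TV w₀ s₀).gAu (Mbar ω) (Yseq ω) = (ω.2.1 w).2))
    ≤ avg (seqX PX) (fun x => avg (seqQ Q x) fun b => ind (c.BadOwn T
        (fun u b => TU u fun i => (b i).1) (fun u v b => TV u v fun i => (b i).1) TV' x b))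
      + ((W : ℝ) - 1) * avg (seqX PX) fun x' => avg (seqX PX) fun x => avg (seqQ Q x) fun b =>
        ind (c.BadOther (fun u b => TU u fun i => (b i).1) x' b) := by
  refine prob_codeDist_le hX hQ _ w _ _ _ fun ω hω hE => ?_
  by_contra hn
  push Not at hn
  refine hE ?_
  have hM : (fun w' => (descEquiv B₁ B₂).symm (Mbar ω w')) = fun w' => c.desc (ω.1 w') := by
    funext w'
    rw [Mbar, c.toCode_support TU TV w₀ s₀ hω w', Equiv.symm_apply_apply]
  have := c.decode_correct (fun b : Fin n → 𝒴 × 𝒵 => fun i => (b i).1) T TU TV TV' hTU hTV w₀ s₀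
    ω.1 ω.2.2 w hn.1 hn.2
  rw [c.toCode_support TU TV w₀ s₀ hω w]
  change c.decId TU w₀ (fun w' => (descEquiv B₁ B₂).symm (Mbar ω w')) (Yseq ω) = w ∧
    c.decAu TU TV w₀ s₀ (fun w' => (descEquiv B₁ B₂).symm (Mbar ω w')) (Yseq ω) = _
  rw [hM]
  exact this

lemma toCode_mutInf_le (hX : IsPMF PX) (hQ : ∀ x, IsPMF (Q x)) {α : Type} [Fintype α] (w : Fin W)
    {G : CodeSpace 𝒳 𝒴 𝒵 n (B₁ * B₂ + 1) W S → α} (g : (Fin n → 𝒳) → α)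
    (hG : ∀ ω, codeDist PX Q (c.toCode TU TV w₀ s₀) w ω ≠ 0 → G ω = g (ω.1 w)) :
    mutInf (codeDist PX Q (c.toCode TU TV w₀ s₀) w (𝒵 := 𝒵)) G (fun ω => (Mbar ω, Zseq ω))
      ≤ mutInf (seqXQ PX Q) (fun p => g p.1) (fun p => (c.fine p.1, fun i => (p.2 i).2)) := by
  refine mutInf_own_le hX hQ _ w (fun p => g p.1) (fun p => (c.fine p.1, fun i => (p.2 i).2))
    (fun o w' => c.desc (o w'))
    (fun t d => (fun w' => descEquiv B₁ B₂ (if h : w' = w then t.1.map fun p => (c.h₁ p.1, p.2)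
      else d ⟨w', h⟩), t.2)) hG
    fun ω hω => ?_
  refine Prod.ext (funext fun w' => ?_) rfl
  change (ω.2.1 w').1 = _
  rw [c.toCode_support TU TV w₀ s₀ hω w']
  by_cases h : w' = w
  · subst h
    simp [own, desc_eq_fine]
  · simp [h, others]

end

end HashedBook

namespace HashedBook

variable {𝕌 𝕍 𝕏 𝔹 𝕑 : Type*} [Fintype 𝕏] [Fintype 𝔹] [Fintype 𝕑] {J K B₁ B₂ S : ℕ}

lemma ent_fine_le [Nonempty 𝕑] (c : HashedBook 𝕌 𝕍 𝕏 J K B₁ B₂ S) {μ : 𝕏 × 𝔹 → ℝ} (hμ : IsPMF μ)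
    (Z : 𝔹 → 𝕑) {T : 𝕌 → 𝕍 → 𝕏 → 𝔹 → Prop} {TU : 𝕌 → 𝔹 → Prop} {TV TV' : 𝕌 → 𝕍 → 𝔹 → Prop}
    (TZ : 𝕌 → 𝕑 → Prop) (hTZ : ∀ u v x b, T u v x b → TZ u (Z b)) {N τ : ℝ}
    (hJ : 0 < J) (hB₂ : 0 < B₂) (hN : 1 ≤ N)
    (hcard : ∀ u, ∑ z, ind (TZ u z) ≤ N)
    (hτ : prob μ (fun p => c.BadOwn T TU TV TV' p.1 p.2) ≤ τ) :
    ent μ (fun p => (c.fine p.1, Z p.2))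
      ≤ 1 + logb 2 (J * (B₂ * N)) + τ * logb 2 ((J * B₂ + 1) * Fintype.card 𝕑) := by
  have hJ' : (1 : ℝ) ≤ J := by exact_mod_cast hJ
  have hB' : (1 : ℝ) ≤ B₂ := by exact_mod_cast hB₂
  have hcard' : ((J : ℝ) * B₂ + 1) * Fintype.card 𝕑
      = Fintype.card (Option (Fin J × Fin B₂) × 𝕑) := by
    simp
  rw [hcard']
  refine ent_le_of_list hμ _ (fun p => ∃ j q, p.1 = some (j, q) ∧ TZ (c.u j) p.2)
    (one_le_mul_of_one_le_of_one_le hJ' (one_le_mul_of_one_le_of_one_le hB' hN)) ?_ ?_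
  · have hpt : ∀ p : Option (Fin J × Fin B₂) × 𝕑,
        ind (∃ j q, p.1 = some (j, q) ∧ TZ (c.u j) p.2)
        ≤ ∑ j, ∑ q, ind (some (j, q) = p.1) * ind (TZ (c.u j) p.2) := fun p =>
      (ind_exists_le _).trans (sum_le_sum fun j _ => (ind_exists_le _).trans_eq
        (sum_congr rfl fun q _ => by rw [ind_and, show (p.1 = some (j, q)) = (some (j, q) = p.1)
          from propext eq_comm]))
    calc _ ≤ ∑ p : Option (Fin J × Fin B₂) × 𝕑,
          ∑ j, ∑ q, ind (some (j, q) = p.1) * ind (TZ (c.u j) p.2) := sum_le_sum fun p _ => hpt p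
      _ = ∑ j : Fin J, ∑ _q : Fin B₂, ∑ z, ind (TZ (c.u j) z) := by
        rw [sum_comm]
        refine sum_congr rfl fun j _ => ?_
        rw [sum_comm]
        refine sum_congr rfl fun q _ => ?_
        rw [Fintype.sum_prod_type, sum_comm]
        refine sum_congr rfl fun z _ => ?_
        exact sum_ind_eq (some (j, q)) fun _ => ind (TZ (c.u j) z)
      _ ≤ ∑ _j : Fin J, ∑ _q : Fin B₂, N :=
        sum_le_sum fun j _ => sum_le_sum fun _ _ => hcard _
      _ = _ := by simp
  · refine le_trans ?_ hτ
    rw [prob_eq, prob_eq]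
    refine sum_le_sum fun p _ => mul_le_mul_of_nonneg_left (ind_mono fun h => ?_) (hμ.1 p)
    by_contra hn
    unfold BadOwn at hn
    push Not at hn
    obtain ⟨⟨j, k⟩, hjk⟩ := Option.ne_none_iff_exists'.1 hn.1
    exact h ⟨j, c.h₂ k, by simp [fine, hjk], hTZ _ _ _ _ (hn.2 j k hjk).1⟩

lemma ent_key_fine_ge [Nonempty 𝕏] (c : HashedBook 𝕌 𝕍 𝕏 J K B₁ B₂ S) (s₀ : Fin S)
    {μ : 𝕏 × 𝔹 → ℝ} (hμ : IsPMF μ)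
    (Z : 𝔹 → 𝕑) {T : 𝕌 → 𝕍 → 𝕏 → 𝔹 → Prop} {TU : 𝕌 → 𝔹 → Prop} {TV : 𝕌 → 𝕍 → 𝔹 → Prop}
    (TVZ : 𝕌 → 𝕍 → 𝕑 → Prop) (hTVZ : ∀ u v x b, T u v x b → TVZ u v (Z b))
    (TX : 𝕍 → 𝕏 → 𝕑 → Prop) (hTX : ∀ u v x b, T u v x b → TX v x (Z b)) {N τ : ℝ}
    (hN : 1 ≤ N) (hcard : ∀ v z, ∑ x, ind (TX v x z) ≤ N)
    (hτ : prob μ (fun p => c.BadOwn T TU TV (fun u v b => TVZ u v (Z b)) p.1 p.2) ≤ τ) :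
    ent μ (fun p => (p.1, Z p.2)) - (1 + logb 2 N + τ * logb 2 (Fintype.card 𝕏))
      ≤ ent μ (fun p => (c.keyOf s₀ p.1, c.fine p.1, Z p.2)) := by
  have e : ent μ (fun p => (p.1, Z p.2))
      = ent μ (fun p => (p.1, c.keyOf s₀ p.1, c.fine p.1, Z p.2)) :=
    ent_congr_iff _ fun p p' => by
      simp only [Prod.mk.injEq]
      constructor
      · rintro ⟨h1, h2⟩
        exact ⟨h1, by rw [h1], by rw [h1], h2⟩
      · rintro ⟨h1, -, -, h2⟩
        exact ⟨h1, h2⟩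
  have := ent_pair_sub_le_of_list hμ (fun p => p.1) (fun p => (c.keyOf s₀ p.1, c.fine p.1, Z p.2))
    (fun x t => ∃ j k, t.2.1 = some (j, c.h₂ k) ∧ t.1 = c.key k ∧ TVZ (c.u j) (c.v j k) t.2.2 ∧
      (∀ k', c.h₂ k' = c.h₂ k → c.key k' = c.key k → TVZ (c.u j) (c.v j k') t.2.2 → k' = k) ∧
      TX (c.v j k) x t.2.2) hN ?_ (τ := τ) ?_
  · rw [e]
    linarith
  · rintro ⟨s, t, z⟩
    by_cases h : ∃ j k, t = some (j, c.h₂ k) ∧ s = c.key k ∧ TVZ (c.u j) (c.v j k) z ∧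
      (∀ k', c.h₂ k' = c.h₂ k → c.key k' = c.key k → TVZ (c.u j) (c.v j k') z → k' = k)
    · obtain ⟨j, k, rfl, rfl, hV, huniq⟩ := h
      refine (sum_le_sum fun x _ => ind_mono ?_).trans (hcard (c.v j k) z)
      rintro ⟨j', k', h1, h2, h3, -, h5⟩
      simp only [Option.some.injEq, Prod.mk.injEq] at h1
      obtain ⟨rfl, h1⟩ := h1
      obtain rfl := huniq k' h1.symm h2.symm h3
      exact h5
    · rw [sum_eq_zero]
      · linarith
      · refine fun x _ => ind_of_false ?_
        rintro ⟨j, k, h1, h2, h3, h4, -⟩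
        exact h ⟨j, k, h1, h2, h3, h4⟩
  · refine le_trans ?_ hτ
    rw [prob_eq, prob_eq]
    refine sum_le_sum fun p _ => mul_le_mul_of_nonneg_left (ind_mono fun h => ?_) (hμ.1 p)
    by_contra hn
    unfold BadOwn at hn
    push Not at hn
    obtain ⟨⟨j, k⟩, hjk⟩ := Option.ne_none_iff_exists'.1 hn.1
    obtain ⟨hT, -, -, h4⟩ := hn.2 j k hjk
    refine h ⟨j, k, by simp [fine, hjk], keyOf_of_sel hjk, hTVZ _ _ _ _ hT, fun k' a b d => ?_,
      hTX _ _ _ _ hT⟩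
    by_contra hk
    exact h4 k' hk a b d

lemma mutInf_fine (c : HashedBook 𝕌 𝕍 𝕏 J K B₁ B₂ S) (μ : 𝕏 × 𝔹 → ℝ) (Z : 𝔹 → 𝕑) :
    mutInf μ (fun p => p.1) (fun p => (c.fine p.1, Z p.2))
      = ent μ (fun p => p.1) + ent μ (fun p => (c.fine p.1, Z p.2))
        - ent μ (fun p => (p.1, Z p.2)) := by
  unfold mutInf
  congr 1
  refine ent_congr_iff _ fun p p' => ?_
  simp only [Prod.mk.injEq]
  constructor
  · rintro ⟨h1, -, h2⟩
    exact ⟨h1, h2⟩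
  · rintro ⟨h1, h2⟩
    exact ⟨h1, by rw [h1], h2⟩

end HashedBook

lemma mutInf_nonneg {Ω α β : Type*} [Fintype Ω] [Fintype α] [Fintype β] {μ : Ω → ℝ} (hμ : IsPMF μ)
    (X : Ω → α) (Y : Ω → β) : 0 ≤ mutInf μ X Y := by
  refine le_trans ?_ (mutInf_le_of_determines hμ X Y (fun _ => ()) fun _ _ _ => rfl)
  rw [mutInf, ent_const hμ, ent_pair_unit]
  linarith

/-! ### Events of probability tending to one for i.i.d. sequences -/

section Typical

lemma avg_ind_le_mul {α : Type*} [Fintype α] {r q : α → ℝ} {κ : ℝ} (hκ : 0 ≤ κ)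
    (hq : IsPMF q) : avg r (fun a => ind (r a ≤ κ * q a)) ≤ κ := by
  calc avg r (fun a => ind (r a ≤ κ * q a)) ≤ ∑ a, κ * q a := by
        refine sum_le_sum fun a _ => ?_
        change r a * ind (r a ≤ κ * q a) ≤ κ * q a
        by_cases h : r a ≤ κ * q a
        · rw [ind_of_true h, mul_one]; exact h
        · rw [ind_of_false h, mul_zero]; exact mul_nonneg hκ (hq.1 a)
    _ = κ := by rw [← mul_sum, hq.2, mul_one]

variable {α : Type*} [Fintype α]

/-- The event `E n` has probability tending to one under the law of `n` i.i.d. symbols. -/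
def AlmostSure (p : α → ℝ) (E : ∀ n : ℕ, (Fin n → α) → Prop) : Prop :=
  ∀ η : ℝ, 0 < η → ∃ N : ℕ, ∀ n ≥ N, ∑ ω : Fin n → α, (∏ i, p (ω i)) * ind (¬ E n ω) ≤ η

lemma AlmostSure.and {p : α → ℝ} (hp : IsPMF p) {E F : ∀ n : ℕ, (Fin n → α) → Prop}
    (hE : AlmostSure p E) (hF : AlmostSure p F) : AlmostSure p fun n ω => E n ω ∧ F n ω := by
  intro η hη
  obtain ⟨N₁, h₁⟩ := hE (η / 2) (by linarith)
  obtain ⟨N₂, h₂⟩ := hF (η / 2) (by linarith)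
  refine ⟨max N₁ N₂, fun n hn => ?_⟩
  calc ∑ ω : Fin n → α, (∏ i, p (ω i)) * ind (¬ (E n ω ∧ F n ω))
      ≤ ∑ ω : Fin n → α, ((∏ i, p (ω i)) * ind (¬ E n ω) + (∏ i, p (ω i)) * ind (¬ F n ω)) := by
        refine sum_le_sum fun ω _ => ?_
        rw [← mul_add, not_and_or]
        exact mul_le_mul_of_nonneg_left (ind_or_le _ _) (prod_nonneg fun i _ => hp.1 _)
    _ ≤ η := by
        rw [sum_add_distrib]
        linarith [h₁ n (le_of_max_le_left hn), h₂ n (le_of_max_le_right hn)]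

/-- The likelihoods satisfy `r ≤ 2 ^ (n * D) * q` along the sequence `ω`. -/
def LikeLe (r q : α → ℝ) (D : ℝ) (n : ℕ) (ω : Fin n → α) : Prop :=
  ∏ i, r (ω i) ≤ 2 ^ ((n : ℝ) * D) * ∏ i, q (ω i)

lemma almostSure_likeLe {p : α → ℝ} (hp : IsPMF p) (r q : α → ℝ) (hr : ∀ a, p a ≠ 0 → 0 < r a)
    (hq : ∀ a, p a ≠ 0 → 0 < q a) {D D' : ℝ}
    (hD : ∑ a, p a * (logb 2 (r a) - logb 2 (q a)) = D) (h : D < D') :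
    AlmostSure p (LikeLe r q D') := by
  intro η hη
  obtain ⟨N, hN⟩ := aep hp r q hr hq hD (sub_pos.2 h) hη
  refine ⟨N, fun n hn => ?_⟩
  simpa only [LikeLe, add_sub_cancel] using hN n hn

end Typical

section Sequences

variable {𝒰 𝒱 𝒳 𝔅 : Type} [Fintype 𝒰] [Fintype 𝒱] [Fintype 𝒳] [Fintype 𝔅]

/-- A sequence of quadruples as a quadruple of sequences. -/
def quadEquiv (𝒰 𝒱 𝒳 𝔅 : Type) (n : ℕ) :
    ((Fin n → 𝒳) × (Fin n → 𝒰) × (Fin n → 𝒱) × (Fin n → 𝔅)) ≃ (Fin n → 𝒰 × 𝒱 × 𝒳 × 𝔅) where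
  toFun t i := (t.2.1 i, t.2.2.1 i, t.1 i, t.2.2.2 i)
  invFun ω := (fun i => (ω i).2.2.1, fun i => (ω i).1, fun i => (ω i).2.1, fun i => (ω i).2.2.2)

lemma avg_seq_eq {n : ℕ} {μ : 𝒰 × 𝒱 × 𝒳 × 𝔅 → ℝ} (pX : 𝒳 → ℝ) (k₁ : 𝒳 → 𝒰 → ℝ)
    (k₂ : 𝒰 × 𝒳 → 𝒱 → ℝ) (Q : 𝒳 → 𝔅 → ℝ)
    (hμ : ∀ u v x b, μ (u, v, x, b) = pX x * k₁ x u * k₂ (u, x) v * Q x b)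
    (F : (Fin n → 𝒰 × 𝒱 × 𝒳 × 𝔅) → ℝ) :
    avg (seqX pX) (fun x => avg (seqQ k₁ x) fun u => avg (seqQ k₂ fun i => (u i, x i)) fun v =>
      avg (seqQ Q x) fun b => F fun i => (u i, v i, x i, b i)) = ∑ ω, (∏ i, μ (ω i)) * F ω := by
  rw [← (quadEquiv 𝒰 𝒱 𝒳 𝔅 n).sum_comp]
  simp only [Fintype.sum_prod_type, avg, mul_sum, seqX, seqQ, quadEquiv, Equiv.coe_fn_mk, hμ,
    prod_mul_distrib, mul_assoc]

end Sequences

section GoodBook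

variable {𝒰 𝒱 𝒳 𝒴 𝒵 : Type} [Fintype 𝒰] [Fintype 𝒱] [Fintype 𝒳] [Fintype 𝒴] [Fintype 𝒵]

theorem exists_typical_hashedBook {μ : 𝒰 × 𝒱 × 𝒳 × 𝒴 × 𝒵 → ℝ} (hμ : IsPMF μ) {PX : 𝒳 → ℝ}
    {Q : 𝒳 → 𝒴 × 𝒵 → ℝ} (hPX : pmass μ (fun ω => ω.2.2.1) = PX) (hQ : ∀ x, IsPMF (Q x))
    (hfac : ∀ u v x b, μ (u, v, x, b) = PX x * condK μ (fun ω => ω.1) (fun ω => ω.2.2.1) x u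
      * condK μ (fun ω => ω.2.1) (fun ω => (ω.1, ω.2.2.1)) (u, x) v * Q x b)
    {a b c d e f g : ℝ}
    (ha : ent μ (fun ω => ω.1) + ent μ (fun ω => ω.2.2.1) - ent μ (fun ω => (ω.1, ω.2.2.1)) = a)
    (hb : ent μ (fun ω => (ω.2.1, ω.1)) + ent μ (fun ω => (ω.1, ω.2.2.1))
      - ent μ (fun ω => (ω.2.1, ω.1, ω.2.2.1)) - ent μ (fun ω => ω.1) = b)
    (hc : ent μ (fun ω => ω.1) + ent μ (fun ω => ω.2.2.2.1)
      - ent μ (fun ω => (ω.1, ω.2.2.2.1)) = c)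
    (hd : ent μ (fun ω => (ω.2.1, ω.1)) + ent μ (fun ω => (ω.1, ω.2.2.2.1))
      - ent μ (fun ω => (ω.2.1, ω.1, ω.2.2.2.1)) - ent μ (fun ω => ω.1) = d)
    (he : ent μ (fun ω => (ω.2.1, ω.1)) + ent μ (fun ω => (ω.1, ω.2.2.2.2))
      - ent μ (fun ω => (ω.2.1, ω.1, ω.2.2.2.2)) - ent μ (fun ω => ω.1) = e)
    (hf : ent μ (fun ω => (ω.2.2.2.2, ω.1)) - ent μ (fun ω => ω.1) = f)
    (hg : ent μ (fun ω => (ω.2.2.1, ω.2.1, ω.2.2.2.2))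
      - ent μ (fun ω => (ω.2.1, ω.2.2.2.2)) = g)
    {ε θ : ℝ} (hε : 0 < ε) (hθ : 0 < θ) (hθ1 : θ < 1) :
    ∃ N : ℕ, ∀ n ≥ N, ∀ J K B₁ B₂ S : ℕ, 0 < J → 0 < K → 0 < B₁ → 0 < B₂ → 0 < S →
      ∀ W : ℝ, 0 ≤ W →
      ∃ (cb : HashedBook (Fin n → 𝒰) (Fin n → 𝒱) (Fin n → 𝒳) J K B₁ B₂ S)
        (T : (Fin n → 𝒰) → (Fin n → 𝒱) → (Fin n → 𝒳) → (Fin n → 𝒴 × 𝒵) → Prop)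
        (TU : (Fin n → 𝒰) → (Fin n → 𝒴) → Prop)
        (TV : (Fin n → 𝒰) → (Fin n → 𝒱) → (Fin n → 𝒴) → Prop)
        (TVZ : (Fin n → 𝒰) → (Fin n → 𝒱) → (Fin n → 𝒵) → Prop)
        (TZ : (Fin n → 𝒰) → (Fin n → 𝒵) → Prop)
        (TX : (Fin n → 𝒱) → (Fin n → 𝒳) → (Fin n → 𝒵) → Prop),
        (∀ u v x b, T u v x b → TU u (fun i => (b i).1) ∧ TV u v (fun i => (b i).1) ∧
          TVZ u v (fun i => (b i).2) ∧ TZ u (fun i => (b i).2) ∧ TX v x (fun i => (b i).2)) ∧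
        (∀ u, ∑ z, ind (TZ u z) ≤ 2 ^ ((n : ℝ) * (f + ε))) ∧
        (∀ v z, ∑ x, ind (TX v x z) ≤ 2 ^ ((n : ℝ) * (g + ε))) ∧
        avg (seqX PX) (fun x => avg (seqQ Q x) fun b => ind (cb.BadOwn T
            (fun u b => TU u fun i => (b i).1) (fun u v b => TV u v fun i => (b i).1)
            (fun u v b => TVZ u v fun i => (b i).2) x b))
          + W * avg (seqX PX) (fun x' => avg (seqX PX) fun x => avg (seqQ Q x) fun b =>
            ind (cb.BadOther (fun u b => TU u fun i => (b i).1) x' b))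
        ≤ 5 * θ + 2 * 2 ^ ((n : ℝ) * (a + ε)) / J + 2 * 2 ^ ((n : ℝ) * (b + ε)) / K
          + (W + 1) / B₁ * (J * 2 ^ ((n : ℝ) * (-c + ε)))
          + W * (J * (2 ^ ((n : ℝ) * (-c + ε)) * 2 ^ ((n : ℝ) * (-a + ε))))
          + 1 / B₂ * (K * 2 ^ ((n : ℝ) * (-d + ε)))
          + 1 / (B₂ * S) * (K * 2 ^ ((n : ℝ) * (-e + ε))) := by
  have hX : IsPMF PX := hPX ▸ isPMF_pmass hμ _
  have swap : ent μ (fun ω => (ω.2.2.1, ω.1)) = ent μ (fun ω => (ω.1, ω.2.2.1)) :=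
    ent_congr_iff μ fun ω ω' => by simp only [Prod.mk.injEq]; tauto
  have D : ∀ r q : 𝒰 × 𝒱 × 𝒳 × 𝒴 × 𝒵 → ℝ, ∑ ω, μ ω * (logb 2 (r ω) - logb 2 (q ω))
      = ∑ ω, μ ω * logb 2 (r ω) - ∑ ω, μ ω * logb 2 (q ω) := fun r q => by
    simp only [mul_sub, sum_sub_distrib]
  have e₁ := almostSure_likeLe (D' := a + ε) hμ
    (fun ω => condK μ (fun ω => ω.1) (fun ω => ω.2.2.1) ω.2.2.1 ω.1)
    (fun ω => pmass μ (fun ω => ω.1) ω.1) (fun ω h => condK_pos hμ _ _ h)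
    (fun ω h => pmass_pos hμ.1 _ h) rfl (by
      rw [D, sum_logb_condK hμ, sum_logb_pmass]; linarith)
  have e₂ := almostSure_likeLe (D' := b + ε) hμ
    (fun ω => condK μ (fun ω => ω.2.1) (fun ω => (ω.1, ω.2.2.1)) (ω.1, ω.2.2.1) ω.2.1)
    (fun ω => condK μ (fun ω => ω.2.1) (fun ω => ω.1) ω.1 ω.2.1)
    (fun ω h => condK_pos hμ _ _ h) (fun ω h => condK_pos hμ _ _ h) rfl (by
      rw [D, sum_logb_condK hμ (fun ω => ω.2.1) (fun ω => (ω.1, ω.2.2.1)), sum_logb_condK hμ]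
      linarith)
  have e₃ := almostSure_likeLe (D' := -a + ε) hμ
    (fun ω => pmass μ (fun ω => ω.2.2.1) ω.2.2.1)
    (fun ω => condK μ (fun ω => ω.2.2.1) (fun ω => ω.1) ω.1 ω.2.2.1)
    (fun ω h => pmass_pos hμ.1 _ h) (fun ω h => condK_pos hμ _ _ h) rfl (by
      rw [D, sum_logb_condK hμ, sum_logb_pmass]; linarith)
  have e₄ := almostSure_likeLe (D' := -c + ε) hμ
    (fun ω => pmass μ (fun ω => ω.1) ω.1)
    (fun ω => condK μ (fun ω => ω.1) (fun ω => ω.2.2.2.1) ω.2.2.2.1 ω.1)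
    (fun ω h => pmass_pos hμ.1 _ h) (fun ω h => condK_pos hμ _ _ h) rfl (by
      rw [D, sum_logb_condK hμ, sum_logb_pmass]; linarith)
  have e₅ := almostSure_likeLe (D' := -d + ε) hμ
    (fun ω => condK μ (fun ω => ω.2.1) (fun ω => ω.1) ω.1 ω.2.1)
    (fun ω => condK μ (fun ω => ω.2.1) (fun ω => (ω.1, ω.2.2.2.1)) (ω.1, ω.2.2.2.1) ω.2.1)
    (fun ω h => condK_pos hμ _ _ h) (fun ω h => condK_pos hμ _ _ h) rfl (by
      rw [D, sum_logb_condK hμ (fun ω => ω.2.1) (fun ω => (ω.1, ω.2.2.2.1)), sum_logb_condK hμ]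
      linarith)
  have e₆ := almostSure_likeLe (D' := -e + ε) hμ
    (fun ω => condK μ (fun ω => ω.2.1) (fun ω => ω.1) ω.1 ω.2.1)
    (fun ω => condK μ (fun ω => ω.2.1) (fun ω => (ω.1, ω.2.2.2.2)) (ω.1, ω.2.2.2.2) ω.2.1)
    (fun ω h => condK_pos hμ _ _ h) (fun ω h => condK_pos hμ _ _ h) rfl (by
      rw [D, sum_logb_condK hμ (fun ω => ω.2.1) (fun ω => (ω.1, ω.2.2.2.2)), sum_logb_condK hμ]
      linarith)
  have e₇ := almostSure_likeLe (D' := f + ε) hμ (fun _ => 1)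
    (fun ω => condK μ (fun ω => ω.2.2.2.2) (fun ω => ω.1) ω.1 ω.2.2.2.2)
    (fun ω h => one_pos) (fun ω h => condK_pos hμ _ _ h) rfl (by
      rw [D, sum_logb_condK hμ]; simp only [logb_one, mul_zero, sum_const_zero]; linarith)
  have e₈ := almostSure_likeLe (D' := g + ε) hμ (fun _ => 1)
    (fun ω => condK μ (fun ω => ω.2.2.1) (fun ω => (ω.2.1, ω.2.2.2.2)) (ω.2.1, ω.2.2.2.2) ω.2.2.1)
    (fun ω h => one_pos) (fun ω h => condK_pos hμ _ _ h) rfl (by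
      rw [D, sum_logb_condK hμ (fun ω => ω.2.2.1) (fun ω => (ω.2.1, ω.2.2.2.2))]
      simp only [logb_one, mul_zero, sum_const_zero]; linarith)
  obtain ⟨N, hN⟩ := (e₁.and hμ (e₂.and hμ (e₃.and hμ (e₄.and hμ (e₅.and hμ (e₆.and hμ
    (e₇.and hμ e₈))))))) (θ ^ 2) (by positivity)
  refine ⟨N, fun n hn J K B₁ B₂ S hJ hK hB₁ hB₂ hS W hW => ?_⟩
  have hT := hN n hn
  rw [← avg_seq_eq PX _ _ Q hfac] at hT
  have cp : ∀ D : ℝ, (0 : ℝ) < 2 ^ ((n : ℝ) * D) := fun D => rpow_pos_of_pos two_pos _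
  have hK' : ∀ {α β : Type} [Fintype α] [Fintype β] (A : 𝒰 × 𝒱 × 𝒳 × 𝒴 × 𝒵 → α)
      (B : 𝒰 × 𝒱 × 𝒳 × 𝒴 × 𝒵 → β) (y : Fin n → β), IsPMF (seqQ (condK μ A B) y) :=
    fun A B y => isPMF_seqQ (isPMF_condK hμ A B) y
  obtain ⟨cb, hcb⟩ := exists_hashedBook (pU := seqX (pmass μ fun ω => ω.1))
    (pVU := seqQ (condK μ (fun ω => ω.2.1) (fun ω => ω.1))) (PX := seqX PX) (kQ := seqQ Q)
    (k₁ := seqQ (condK μ (fun ω => ω.1) (fun ω => ω.2.2.1)))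
    (k₂ := fun x u => seqQ (condK μ (fun ω => ω.2.1) (fun ω => (ω.1, ω.2.2.1)))
      fun i => (u i, x i)) (isPMF_seqX (isPMF_pmass hμ _)) (hK' _ _) (isPMF_seqX hX)
    (isPMF_seqQ hQ) (hK' _ _) (fun x u => hK' _ _ _) hJ hK hB₁ hB₂ hS _ hθ hθ1 hT
    (cp (a + ε)) (cp (b + ε)) (fun u v x b h => h.1) (fun u v x b h => h.2.1)
    (cp (-a + ε)).le (cp (-d + ε)).le (cp (-e + ε)).le
    (fun u x => seqX PX x ≤ 2 ^ ((n : ℝ) * (-a + ε))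
      * seqQ (condK μ (fun ω => ω.2.2.1) (fun ω => ω.1)) u x)
    (fun u v x b h => hPX ▸ h.2.2.1)
    (fun u => avg_ind_le_mul (cp _).le (hK' _ _ _))
    (fun u b => seqX (pmass μ fun ω => ω.1) u ≤ 2 ^ ((n : ℝ) * (-c + ε))
      * seqQ (condK μ (fun ω => ω.1) (fun ω => ω.2.2.2.1)) (fun i => (b i).1) u)
    (fun b => avg_ind_le_mul (cp _).le (hK' _ _ _))
    (fun u v b => seqQ (condK μ (fun ω => ω.2.1) (fun ω => ω.1)) u v ≤ 2 ^ ((n : ℝ) * (-d + ε))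
      * seqQ (condK μ (fun ω => ω.2.1) (fun ω => (ω.1, ω.2.2.2.1))) (fun i => (u i, (b i).1)) v)
    (fun u v b => seqQ (condK μ (fun ω => ω.2.1) (fun ω => ω.1)) u v ≤ 2 ^ ((n : ℝ) * (-e + ε))
      * seqQ (condK μ (fun ω => ω.2.1) (fun ω => (ω.1, ω.2.2.2.2))) (fun i => (u i, (b i).2)) v)
    (fun u b => avg_ind_le_mul (cp _).le (hK' _ _ _))
    (fun u b => avg_ind_le_mul (cp _).le (hK' _ _ _)) hW
  have card : ∀ {A : Type} [Fintype A] {q : A → ℝ} {D : ℝ}, IsPMF q →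
      ∑ z, ind (∏ _i : Fin n, (1 : ℝ) ≤ 2 ^ ((n : ℝ) * D) * q z) ≤ 2 ^ ((n : ℝ) * D) := by
    intro A _ q D hq
    have := avg_ind_le_mul (r := fun _ => (1 : ℝ)) (cp D).le hq
    simpa only [avg, one_mul, prod_const_one] using this
  refine ⟨cb, _, fun u y => seqX (pmass μ fun ω => ω.1) u ≤ 2 ^ ((n : ℝ) * (-c + ε))
      * seqQ (condK μ (fun ω => ω.1) (fun ω => ω.2.2.2.1)) y u,
    fun u v y => seqQ (condK μ (fun ω => ω.2.1) (fun ω => ω.1)) u v ≤ 2 ^ ((n : ℝ) * (-d + ε))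
      * seqQ (condK μ (fun ω => ω.2.1) (fun ω => (ω.1, ω.2.2.2.1))) (fun i => (u i, y i)) v,
    fun u v z => seqQ (condK μ (fun ω => ω.2.1) (fun ω => ω.1)) u v ≤ 2 ^ ((n : ℝ) * (-e + ε))
      * seqQ (condK μ (fun ω => ω.2.1) (fun ω => (ω.1, ω.2.2.2.2))) (fun i => (u i, z i)) v,
    fun u z => ∏ _i : Fin n, (1 : ℝ) ≤ 2 ^ ((n : ℝ) * (f + ε))
      * seqQ (condK μ (fun ω => ω.2.2.2.2) (fun ω => ω.1)) u z,
    fun v x z => ∏ _i : Fin n, (1 : ℝ) ≤ 2 ^ ((n : ℝ) * (g + ε))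
      * seqQ (condK μ (fun ω => ω.2.2.1) (fun ω => (ω.2.1, ω.2.2.2.2))) (fun i => (v i, z i)) x,
    fun u v x b h => ⟨h.2.2.2.1, h.2.2.2.2.1, h.2.2.2.2.2.1, h.2.2.2.2.2.2.1, h.2.2.2.2.2.2.2⟩,
    fun u => card (hK' _ _ _), fun v z => card (hK' _ _ _), hcb.trans_eq ?_⟩
  have : 4 * θ ^ 2 / θ = 4 * θ := by field_simp
  rw [this]
  ring

end GoodBook

section Markov

variable {Ω α β γ : Type*} [Fintype Ω] [Fintype α] [Fintype β] [Fintype γ]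

lemma ent_add_ent_of_mul {α₁ α₂ α₃ α₄ : Type*} [Fintype α₁] [Fintype α₂] [Fintype α₃] [Fintype α₄]
    {μ : Ω → ℝ} (hμ : IsPMF μ) (X₁ : Ω → α₁) (X₂ : Ω → α₂) (X₃ : Ω → α₃) (X₄ : Ω → α₄)
    (h : ∀ ω, pmass μ X₁ (X₁ ω) * pmass μ X₂ (X₂ ω) = pmass μ X₃ (X₃ ω) * pmass μ X₄ (X₄ ω)) :
    ent μ X₁ + ent μ X₂ = ent μ X₃ + ent μ X₄ := by
  have key : ∑ ω, μ ω * logb 2 (pmass μ X₁ (X₁ ω)) + ∑ ω, μ ω * logb 2 (pmass μ X₂ (X₂ ω))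
      = ∑ ω, μ ω * logb 2 (pmass μ X₃ (X₃ ω)) + ∑ ω, μ ω * logb 2 (pmass μ X₄ (X₄ ω)) := by
    rw [← sum_add_distrib, ← sum_add_distrib]
    refine sum_congr rfl fun ω _ => ?_
    by_cases hω : μ ω = 0
    · simp [hω]
    rw [← mul_add, ← mul_add, ← logb_mul (pmass_pos hμ.1 _ hω).ne' (pmass_pos hμ.1 _ hω).ne',
      ← logb_mul (pmass_pos hμ.1 _ hω).ne' (pmass_pos hμ.1 _ hω).ne', h ω]
  rw [ent_eq, ent_eq, ent_eq, ent_eq]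
  linarith

lemma ent_markov {μ : Ω → ℝ} (hμ : IsPMF μ) (A : Ω → α) (B : Ω → β) (C : Ω → γ)
    (φ : α → β → ℝ) (ψ : β → γ → ℝ)
    (h : ∀ a b c, pmass μ (fun ω => (A ω, B ω, C ω)) (a, b, c) = φ a b * ψ b c) :
    ent μ (fun ω => (A ω, B ω, C ω)) + ent μ B
      = ent μ (fun ω => (A ω, B ω)) + ent μ (fun ω => (B ω, C ω)) := by
  classical
  have hAB : ∀ a b, pmass μ (fun ω => (A ω, B ω)) (a, b) = φ a b * ∑ c, ψ b c := fun a b => by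
    rw [← pmass_map μ (fun ω => (A ω, B ω, C ω)) (fun t => (t.1, t.2.1)) (a, b), pmass_eq]
    simp only [Fintype.sum_prod_type, h, Prod.mk.injEq, ind_and, mul_sum]
    rw [sum_eq_single a, sum_eq_single b]
    · simp [ind_of_true]
    · intro b' _ hb; simp [ind_of_false hb]
    · simp
    · intro b' _ hb; simp [ind_of_false hb]
    · simp
  have hBC : ∀ b c, pmass μ (fun ω => (B ω, C ω)) (b, c) = (∑ a, φ a b) * ψ b c := fun b c => by
    rw [← sum_pmass_fst μ A, sum_mul]
    exact sum_congr rfl fun a _ => h a b c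
  have hB : ∀ b, pmass μ B b = (∑ a, φ a b) * ∑ c, ψ b c := fun b => by
    rw [← sum_pmass_fst μ A, sum_mul]
    exact sum_congr rfl fun a _ => hAB a b
  refine ent_add_ent_of_mul hμ _ _ _ _ fun ω => ?_
  rw [h, hB, hAB, hBC]
  ring

lemma pmass_markov_map {α' γ' : Type*} {μ : Ω → ℝ} (A : Ω → α) (B : Ω → β)
    (C : Ω → γ) (φ : α → β → ℝ) (ψ : β → γ → ℝ)
    (h : ∀ a b c, pmass μ (fun ω => (A ω, B ω, C ω)) (a, b, c) = φ a b * ψ b c)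
    (F : α → α') (G : γ → γ') (a : α') (b : β) (c : γ') :
    pmass μ (fun ω => (F (A ω), B ω, G (C ω))) (a, b, c)
      = (∑ a', φ a' b * ind (F a' = a)) * ∑ c', ψ b c' * ind (G c' = c) := by
  classical
  rw [← pmass_map μ (fun ω => (A ω, B ω, C ω)) (fun t => (F t.1, t.2.1, G t.2.2)) (a, b, c),
    pmass_eq, sum_mul_sum]
  simp only [Fintype.sum_prod_type, h, Prod.mk.injEq, ind_and]
  refine sum_congr rfl fun a' _ => ?_
  rw [sum_eq_single b]
  · exact sum_congr rfl fun c' _ => by rw [ind_of_true rfl]; ring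
  · intro b' _ hb; simp [ind_of_false hb]
  · simp

end Markov

section SingleLetter

variable {𝒰 𝒱 𝒳 𝒴 𝒵 : Type} [Fintype 𝒰] [Fintype 𝒱] [Fintype 𝒳] [Fintype 𝒴] [Fintype 𝒵]
  {PX : 𝒳 → ℝ} {Q : 𝒳 → 𝒴 × 𝒵 → ℝ} {PVX : 𝒳 → 𝒱 → ℝ} {PUV : 𝒱 → 𝒰 → ℝ}

lemma sum_slDist (F : 𝒰 → 𝒱 → 𝒳 → 𝒴 × 𝒵 → ℝ) :
    ∑ ω, slDist PX Q PVX PUV ω * F ω.1 ω.2.1 ω.2.2.1 ω.2.2.2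
      = avg PX fun x => avg (PVX x) fun v => avg (PUV v) fun u => avg (Q x) fun b => F u v x b := by
  let s : 𝒳 × 𝒱 × 𝒰 × 𝒴 × 𝒵 ≃ 𝒰 × 𝒱 × 𝒳 × 𝒴 × 𝒵 :=
    ⟨fun t => (t.2.2.1, t.2.1, t.1, t.2.2.2), fun ω => (ω.2.2.1, ω.2.1, ω.1, ω.2.2.2),
      fun _ => rfl, fun _ => rfl⟩
  have := (s.sum_comp fun ω => slDist PX Q PVX PUV ω * F ω.1 ω.2.1 ω.2.2.1 ω.2.2.2).symm
  rw [this]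
  simp only [Fintype.sum_prod_type, avg, mul_sum, slDist, s, Equiv.coe_fn_mk, mul_assoc]

lemma isPMF_slDist (hPX : IsPMF PX) (hQ : ∀ x, IsPMF (Q x)) (hPVX : ∀ x, IsPMF (PVX x))
    (hPUV : ∀ v, IsPMF (PUV v)) : IsPMF (slDist PX Q PVX PUV) := by
  refine ⟨fun ω => mul_nonneg (mul_nonneg (mul_nonneg (hPX.1 _) ((hPVX _).1 _)) ((hPUV _).1 _))
    ((hQ _).1 _), ?_⟩
  have := sum_slDist (PX := PX) (Q := Q) (PVX := PVX) (PUV := PUV) fun _ _ _ _ => 1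
  simp only [mul_one] at this
  rw [this]
  simp_rw [fun x => avg_const (hQ x) 1, fun v => avg_const (hPUV v) 1,
    fun x => avg_const (hPVX x) 1]
  exact avg_const hPX 1

lemma pmass_slDist_X (hQ : ∀ x, IsPMF (Q x)) (hPVX : ∀ x, IsPMF (PVX x))
    (hPUV : ∀ v, IsPMF (PUV v)) : pmass (slDist PX Q PVX PUV) (fun ω => ω.2.2.1) = PX := by
  funext x
  rw [pmass_eq, sum_slDist fun _ _ x' _ => ind (x' = x)]
  simp_rw [fun x' => avg_const (hQ x') (ind (x' = x))]
  simp_rw [fun v c => avg_const (hPUV v) c, fun x c => avg_const (hPVX x) c]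
  exact sum_mul_ind_eq x PX

lemma pmass_slDist_VUX (hQ : ∀ x, IsPMF (Q x)) (u : 𝒰) (v : 𝒱) (x : 𝒳) :
    pmass (slDist PX Q PVX PUV) (fun ω => (ω.2.1, ω.1, ω.2.2.1)) (v, u, x)
      = PX x * PVX x v * PUV v u := by
  rw [pmass_eq, sum_slDist fun u' v' x' _ => ind ((v', u', x') = (v, u, x))]
  simp_rw [fun x' c => avg_const (hQ x') c, Prod.mk.injEq, ind_and, avg]
  rw [sum_eq_single x, sum_eq_single v, sum_eq_single u]
  · simp [ind_of_true, mul_assoc]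
  · intro u' _ h; simp [ind_of_false h]
  · simp
  · intro v' _ h; simp [ind_of_false h]
  · simp
  · intro x' _ h; simp [ind_of_false h]
  · simp

lemma slDist_factor (hPX : IsPMF PX) (hQ : ∀ x, IsPMF (Q x)) (hPVX : ∀ x, IsPMF (PVX x))
    (hPUV : ∀ v, IsPMF (PUV v)) (u : 𝒰) (v : 𝒱) (x : 𝒳) (b : 𝒴 × 𝒵) :
    slDist PX Q PVX PUV (u, v, x, b)
      = PX x * condK (slDist PX Q PVX PUV) (fun ω => ω.1) (fun ω => ω.2.2.1) x u
        * condK (slDist PX Q PVX PUV) (fun ω => ω.2.1) (fun ω => (ω.1, ω.2.2.1)) (u, x) v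
        * Q x b := by
  have hμ := isPMF_slDist hPX hQ hPVX hPUV
  have h1 := pmass_mul_condK hμ (fun ω => ω.1) (fun ω => ω.2.2.1) u x
  have h2 := pmass_mul_condK hμ (fun ω => ω.2.1) (fun ω => (ω.1, ω.2.2.1)) v (u, x)
  rw [pmass_slDist_X hQ hPVX hPUV] at h1
  rw [h1, h2, pmass_slDist_VUX hQ]
  rfl

lemma slDist_markov_U {γ : Type*} [Fintype γ] {μ : 𝒰 × 𝒱 × 𝒳 × 𝒴 × 𝒵 → ℝ} (hμ : IsPMF μ)
    (hdef : μ = slDist PX Q PVX PUV) (G : 𝒳 × 𝒴 × 𝒵 → γ) :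
    ent μ (fun ω => (ω.1, ω.2.1, G ω.2.2)) + ent μ (fun ω => ω.2.1)
      = ent μ (fun ω => (ω.1, ω.2.1)) + ent μ (fun ω => (ω.2.1, G ω.2.2)) :=
  ent_markov hμ (fun ω => ω.1) (fun ω => ω.2.1) (fun ω => G ω.2.2) _ _
    (pmass_markov_map (μ := μ) (fun ω => ω.1) (fun ω => ω.2.1) (fun ω => ω.2.2) (fun u v => PUV v u)
      (fun v t => PX t.1 * PVX t.1 v * Q t.1 t.2)
      (fun u v t => (pmass_id _ (u, v, t)).trans (by
        simp only [hdef, slDist]; ring)) (fun u => u) G)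

lemma slDist_markov_X {α γ : Type*} [Fintype α] [Fintype γ] {μ : 𝒰 × 𝒱 × 𝒳 × 𝒴 × 𝒵 → ℝ}
    (hμ : IsPMF μ) (hdef : μ = slDist PX Q PVX PUV) (F : 𝒰 × 𝒱 → α) (G : 𝒴 × 𝒵 → γ) :
    ent μ (fun ω => (F (ω.1, ω.2.1), ω.2.2.1, G ω.2.2.2)) + ent μ (fun ω => ω.2.2.1)
      = ent μ (fun ω => (F (ω.1, ω.2.1), ω.2.2.1)) + ent μ (fun ω => (ω.2.2.1, G ω.2.2.2)) := by
  refine ent_markov hμ (fun ω => F (ω.1, ω.2.1)) (fun ω => ω.2.2.1) (fun ω => G ω.2.2.2) _ _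
    (pmass_markov_map (μ := μ) (fun ω => (ω.1, ω.2.1)) (fun ω => ω.2.2.1) (fun ω => ω.2.2.2)
      (fun t x => PX x * PVX x t.2 * PUV t.2 t.1) Q (fun t x b => ?_) F G)
  rw [pmass_eq]
  have : ∀ ω : 𝒰 × 𝒱 × 𝒳 × 𝒴 × 𝒵, (((ω.1, ω.2.1), ω.2.2.1, ω.2.2.2) = (t, x, b))
      = (ω = (t.1, t.2, x, b)) := fun ω => by
    refine propext ⟨fun h => ?_, fun h => by rw [h]⟩
    simp only [Prod.ext_iff] at h ⊢
    tauto
  simp_rw [this]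
  rw [sum_mul_ind_eq, hdef]
  rfl

lemma slDist_entropies {μ : 𝒰 × 𝒱 × 𝒳 × 𝒴 × 𝒵 → ℝ} (hμ : IsPMF μ)
    (hdef : μ = slDist PX Q PVX PUV) {a b c d e f g : ℝ}
    (ha : ent μ (fun ω => ω.1) + ent μ (fun ω => ω.2.2.1) - ent μ (fun ω => (ω.1, ω.2.2.1)) = a)
    (hb : ent μ (fun ω => (ω.2.1, ω.1)) + ent μ (fun ω => (ω.1, ω.2.2.1))
      - ent μ (fun ω => (ω.2.1, ω.1, ω.2.2.1)) - ent μ (fun ω => ω.1) = b)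
    (hc : ent μ (fun ω => ω.1) + ent μ (fun ω => ω.2.2.2.1)
      - ent μ (fun ω => (ω.1, ω.2.2.2.1)) = c)
    (hd : ent μ (fun ω => (ω.2.1, ω.1)) + ent μ (fun ω => (ω.1, ω.2.2.2.1))
      - ent μ (fun ω => (ω.2.1, ω.1, ω.2.2.2.1)) - ent μ (fun ω => ω.1) = d)
    (he : ent μ (fun ω => (ω.2.1, ω.1)) + ent μ (fun ω => (ω.1, ω.2.2.2.2))
      - ent μ (fun ω => (ω.2.1, ω.1, ω.2.2.2.2)) - ent μ (fun ω => ω.1) = e)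
    (hf : ent μ (fun ω => (ω.2.2.2.2, ω.1)) - ent μ (fun ω => ω.1) = f)
    (hg : ent μ (fun ω => (ω.2.2.1, ω.2.1, ω.2.2.2.2))
      - ent μ (fun ω => (ω.2.1, ω.2.2.2.2)) = g) :
    c ≤ a ∧ d ≤ b ∧ mutInf μ (fun ω => ω.2.2.2.1) (fun ω => ω.1) = c ∧
    condMutInf μ (fun ω => ω.2.2.1) (fun ω => ω.2.1) (fun ω => ω.2.2.2.1) = a + b - c - d ∧
    mutInf μ (fun ω => ω.2.2.1) (fun ω => (ω.2.1, ω.2.2.2.1))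
      - condMutInf μ (fun ω => ω.2.2.1) (fun ω => ω.2.2.2.1) (fun ω => ω.1)
      + condMutInf μ (fun ω => ω.2.2.1) (fun ω => ω.2.2.2.2) (fun ω => ω.1)
      = a + b - d + f + ent μ (fun ω => ω.2.2.1) - ent μ (fun ω => (ω.2.2.1, ω.2.2.2.2)) ∧
    condMutInf μ (fun ω => ω.2.1) (fun ω => ω.2.2.2.1) (fun ω => ω.1)
      - condMutInf μ (fun ω => ω.2.1) (fun ω => ω.2.2.2.2) (fun ω => ω.1) = d - e ∧
    a + b - e + f + g = ent μ (fun ω => (ω.2.2.1, ω.2.2.2.2)) := by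
  have u₁ := slDist_markov_U hμ hdef fun t => t.1
  have u₂ := slDist_markov_U hμ hdef fun t => t.2.1
  have u₃ := slDist_markov_U hμ hdef fun t => t.2.2
  have x₁ := slDist_markov_X hμ hdef (fun t => t.1) fun t => t.1
  have x₂ := slDist_markov_X hμ hdef (fun t => t.1) fun t => t.2
  have x₃ := slDist_markov_X hμ hdef (fun t => t.2) fun t => t.1
  have x₄ := slDist_markov_X hμ hdef (fun t => t.2) fun t => t.2
  have x₅ := slDist_markov_X hμ hdef (fun t => t) fun t => t.1
  have m₁ := ent_submodular hμ (fun ω => ω.1) (fun ω => ω.2.2.1) (fun ω => ω.2.2.2.1)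
  have m₂ := ent_submodular hμ (fun ω => ω.2.1) (fun ω => ω.2.2.1) (fun ω => (ω.1, ω.2.2.2.1))
  have vu : ent μ (fun ω => (ω.2.1, ω.1)) = ent μ (fun ω => (ω.1, ω.2.1)) :=
    ent_congr_iff μ fun _ _ => by simp only [Prod.mk.injEq]; tauto
  have xu : ent μ (fun ω => (ω.2.2.1, ω.1)) = ent μ (fun ω => (ω.1, ω.2.2.1)) :=
    ent_congr_iff μ fun _ _ => by simp only [Prod.mk.injEq]; tauto
  have yu : ent μ (fun ω => (ω.2.2.2.1, ω.1)) = ent μ (fun ω => (ω.1, ω.2.2.2.1)) :=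
    ent_congr_iff μ fun _ _ => by simp only [Prod.mk.injEq]; tauto
  have zu : ent μ (fun ω => (ω.2.2.2.2, ω.1)) = ent μ (fun ω => (ω.1, ω.2.2.2.2)) :=
    ent_congr_iff μ fun _ _ => by simp only [Prod.mk.injEq]; tauto
  have vux : ent μ (fun ω => (ω.2.1, ω.1, ω.2.2.1)) = ent μ (fun ω => (ω.1, ω.2.1, ω.2.2.1)) :=
    ent_congr_iff μ fun _ _ => by simp only [Prod.mk.injEq]; tauto
  have uvx : ent μ (fun ω => ((ω.1, ω.2.1), ω.2.2.1)) = ent μ (fun ω => (ω.1, ω.2.1, ω.2.2.1)) :=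
    ent_congr_iff μ fun _ _ => by simp only [Prod.mk.injEq]; tauto
  have vuy : ent μ (fun ω => (ω.2.1, ω.1, ω.2.2.2.1)) = ent μ (fun ω => (ω.1, ω.2.1, ω.2.2.2.1)) :=
    ent_congr_iff μ fun _ _ => by simp only [Prod.mk.injEq]; tauto
  have vuz : ent μ (fun ω => (ω.2.1, ω.1, ω.2.2.2.2)) = ent μ (fun ω => (ω.1, ω.2.1, ω.2.2.2.2)) :=
    ent_congr_iff μ fun _ _ => by simp only [Prod.mk.injEq]; tauto
  have vyu : ent μ (fun ω => (ω.2.1, ω.2.2.2.1, ω.1)) = ent μ (fun ω => (ω.1, ω.2.1, ω.2.2.2.1)) :=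
    ent_congr_iff μ fun _ _ => by simp only [Prod.mk.injEq]; tauto
  have vzu : ent μ (fun ω => (ω.2.1, ω.2.2.2.2, ω.1)) = ent μ (fun ω => (ω.1, ω.2.1, ω.2.2.2.2)) :=
    ent_congr_iff μ fun _ _ => by simp only [Prod.mk.injEq]; tauto
  have xvy : ent μ (fun ω => (ω.2.2.1, ω.2.1, ω.2.2.2.1))
      = ent μ (fun ω => (ω.2.1, ω.2.2.1, ω.2.2.2.1)) :=
    ent_congr_iff μ fun _ _ => by simp only [Prod.mk.injEq]; tauto
  have xvz : ent μ (fun ω => (ω.2.2.1, ω.2.1, ω.2.2.2.2))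
      = ent μ (fun ω => (ω.2.1, ω.2.2.1, ω.2.2.2.2)) :=
    ent_congr_iff μ fun _ _ => by simp only [Prod.mk.injEq]; tauto
  have xyu : ent μ (fun ω => (ω.2.2.1, ω.2.2.2.1, ω.1))
      = ent μ (fun ω => (ω.1, ω.2.2.1, ω.2.2.2.1)) :=
    ent_congr_iff μ fun _ _ => by simp only [Prod.mk.injEq]; tauto
  have xuy : ent μ (fun ω => (ω.2.2.1, ω.1, ω.2.2.2.1))
      = ent μ (fun ω => (ω.1, ω.2.2.1, ω.2.2.2.1)) :=
    ent_congr_iff μ fun _ _ => by simp only [Prod.mk.injEq]; tauto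
  have xzu : ent μ (fun ω => (ω.2.2.1, ω.2.2.2.2, ω.1))
      = ent μ (fun ω => (ω.1, ω.2.2.1, ω.2.2.2.2)) :=
    ent_congr_iff μ fun _ _ => by simp only [Prod.mk.injEq]; tauto
  have vxuy : ent μ (fun ω => (ω.2.1, ω.2.2.1, ω.1, ω.2.2.2.1))
      = ent μ (fun ω => ((ω.1, ω.2.1), ω.2.2.1, ω.2.2.2.1)) :=
    ent_congr_iff μ fun _ _ => by simp only [Prod.mk.injEq]; tauto
  simp only [mutInf, condMutInf]
  beta_reduce at u₁ u₂ u₃ x₁ x₂ x₃ x₄ x₅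
  refine ⟨?_, ?_, ?_, ?_, ?_, ?_, ?_⟩ <;> linarith

end SingleLetter

section Sizes

lemma exists_nat_between {x : ℝ} (hx : 0 ≤ x) :
    ∃ J : ℕ, 0 < J ∧ 2 ^ x ≤ (J : ℝ) ∧ (J : ℝ) ≤ 2 * 2 ^ x := by
  have h1 : (1 : ℝ) ≤ 2 ^ x := one_le_rpow one_le_two hx
  refine ⟨⌈(2 : ℝ) ^ x⌉₊, Nat.ceil_pos.2 (by positivity), Nat.le_ceil _, ?_⟩
  linarith [Nat.ceil_lt_add_one (zero_le_one.trans h1)]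

lemma logb_le_of_le_two_mul {J : ℕ} (hJ : 0 < J) {x : ℝ} (h : (J : ℝ) ≤ 2 * 2 ^ x) :
    logb 2 J ≤ 1 + x := by
  rw [logb_le_iff_le_rpow one_lt_two (by exact_mod_cast hJ), rpow_add two_pos, rpow_one]
  exact h

lemma error_terms_le {n a b c d e r ε J K B₁ B₂ S W : ℝ} (hn : 0 ≤ n) (hε : 0 ≤ ε) (hr : 0 ≤ r)
    (hrc : r ≤ c) (hJ : 2 ^ (n * (a + 2 * ε)) ≤ J) (hJ' : J ≤ 2 * 2 ^ (n * (a + 2 * ε)))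
    (hK : 2 ^ (n * (b + 2 * ε)) ≤ K) (hK' : K ≤ 2 * 2 ^ (n * (b + 2 * ε)))
    (hB₁ : 2 ^ (n * (r + a - c + 4 * ε)) ≤ B₁) (hB₂ : 2 ^ (n * (b - d + 4 * ε)) ≤ B₂)
    (hS : 2 ^ (n * (d - e)) ≤ S) (hW : W ≤ 2 ^ (n * (r - 6 * ε))) :
    2 * 2 ^ (n * (a + ε)) / J + 2 * 2 ^ (n * (b + ε)) / K
      + (W + 1) / B₁ * (J * 2 ^ (n * (-c + ε)))
      + W * (J * (2 ^ (n * (-c + ε)) * 2 ^ (n * (-a + ε))))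
      + 1 / B₂ * (K * 2 ^ (n * (-d + ε)))
      + 1 / (B₂ * S) * (K * 2 ^ (n * (-e + ε))) ≤ 14 * 2 ^ (-(n * ε)) := by
  have E : ∀ x : ℝ, (0 : ℝ) < 2 ^ x := fun x => rpow_pos_of_pos two_pos x
  have hJ0 := (E _).trans_le hJ
  have hK0 := (E _).trans_le hK
  have t₁ : 2 * 2 ^ (n * (a + ε)) / J ≤ 2 * 2 ^ (-(n * ε)) := by
    rw [div_le_iff₀ hJ0]
    calc 2 * (2 : ℝ) ^ (n * (a + ε)) = 2 * 2 ^ (-(n * ε)) * 2 ^ (n * (a + 2 * ε)) := by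
          rw [mul_assoc, ← rpow_add two_pos]; ring_nf
      _ ≤ _ := by gcongr
  have t₂ : 2 * 2 ^ (n * (b + ε)) / K ≤ 2 * 2 ^ (-(n * ε)) := by
    rw [div_le_iff₀ hK0]
    calc 2 * (2 : ℝ) ^ (n * (b + ε)) = 2 * 2 ^ (-(n * ε)) * 2 ^ (n * (b + 2 * ε)) := by
          rw [mul_assoc, ← rpow_add two_pos]; ring_nf
      _ ≤ _ := by gcongr
  have hW1 : W + 1 ≤ 2 * 2 ^ (n * r) := by
    have h1 : (1 : ℝ) ≤ 2 ^ (n * r) := one_le_rpow one_le_two (mul_nonneg hn hr)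
    have h2 : (2 : ℝ) ^ (n * (r - 6 * ε)) ≤ 2 ^ (n * r) :=
      rpow_le_rpow_of_exponent_le one_le_two (mul_le_mul_of_nonneg_left (by linarith) hn)
    linarith
  have t₃ : (W + 1) / B₁ * (J * 2 ^ (n * (-c + ε))) ≤ 4 * 2 ^ (-(n * ε)) := by
    calc (W + 1) / B₁ * (J * 2 ^ (n * (-c + ε)))
        ≤ (2 * 2 ^ (n * r)) / 2 ^ (n * (r + a - c + 4 * ε))
          * (2 * 2 ^ (n * (a + 2 * ε)) * 2 ^ (n * (-c + ε))) := by gcongr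
      _ = 4 * (2 ^ (n * r) / 2 ^ (n * (r + a - c + 4 * ε))
          * (2 ^ (n * (a + 2 * ε)) * 2 ^ (n * (-c + ε)))) := by ring
      _ = 4 * 2 ^ (-(n * ε)) := by
          rw [← rpow_sub two_pos, ← rpow_add two_pos, ← rpow_add two_pos]; ring_nf
  have t₄ : W * (J * (2 ^ (n * (-c + ε)) * 2 ^ (n * (-a + ε)))) ≤ 2 * 2 ^ (-(n * ε)) := by
    calc W * (J * (2 ^ (n * (-c + ε)) * 2 ^ (n * (-a + ε))))
        ≤ 2 ^ (n * (r - 6 * ε)) * (2 * 2 ^ (n * (a + 2 * ε))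
          * (2 ^ (n * (-c + ε)) * 2 ^ (n * (-a + ε)))) := by gcongr
      _ = 2 * (2 ^ (n * (r - 6 * ε)) * (2 ^ (n * (a + 2 * ε))
          * (2 ^ (n * (-c + ε)) * 2 ^ (n * (-a + ε))))) := by ring
      _ = 2 * 2 ^ (n * (r - c) + n * (-2 * ε)) := by
          rw [← rpow_add two_pos, ← rpow_add two_pos, ← rpow_add two_pos]; ring_nf
      _ ≤ 2 * 2 ^ (-(n * ε)) := by
          refine mul_le_mul_of_nonneg_left (rpow_le_rpow_of_exponent_le one_le_two ?_) zero_le_two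
          nlinarith [mul_nonneg hn (sub_nonneg.2 hrc), mul_nonneg hn hε]
  have t₅ : 1 / B₂ * (K * 2 ^ (n * (-d + ε))) ≤ 2 * 2 ^ (-(n * ε)) := by
    calc 1 / B₂ * (K * 2 ^ (n * (-d + ε)))
        ≤ 1 / 2 ^ (n * (b - d + 4 * ε)) * (2 * 2 ^ (n * (b + 2 * ε)) * 2 ^ (n * (-d + ε))) := by
          gcongr
      _ = 2 * (2 ^ (n * (b + 2 * ε)) * 2 ^ (n * (-d + ε)) / 2 ^ (n * (b - d + 4 * ε))) := by ring
      _ = 2 * 2 ^ (-(n * ε)) := by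
          rw [← rpow_add two_pos, ← rpow_sub two_pos]; ring_nf
  have t₆ : 1 / (B₂ * S) * (K * 2 ^ (n * (-e + ε))) ≤ 2 * 2 ^ (-(n * ε)) := by
    calc 1 / (B₂ * S) * (K * 2 ^ (n * (-e + ε)))
        ≤ 1 / (2 ^ (n * (b - d + 4 * ε)) * 2 ^ (n * (d - e)))
          * (2 * 2 ^ (n * (b + 2 * ε)) * 2 ^ (n * (-e + ε))) := by
          gcongr
          exact (E _).le.trans hB₂
      _ = 2 * (2 ^ (n * (b + 2 * ε)) * 2 ^ (n * (-e + ε))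
          / (2 ^ (n * (b - d + 4 * ε)) * 2 ^ (n * (d - e)))) := by ring
      _ = 2 * 2 ^ (-(n * ε)) := by
          rw [← rpow_add two_pos, ← rpow_add two_pos, ← rpow_sub two_pos]; ring_nf
  linarith

lemma exists_forall_rpow_neg_le {ε η : ℝ} (hε : 0 < ε) (hη : 0 < η) :
    ∃ N : ℕ, ∀ n ≥ N, (2 : ℝ) ^ (-((n : ℝ) * ε)) ≤ η := by
  obtain ⟨N, hN⟩ := exists_nat_ge (-logb 2 η / ε)
  refine ⟨N, fun n hn => ?_⟩
  rw [← le_logb_iff_rpow_le one_lt_two hη]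
  rw [div_le_iff₀ hε] at hN
  have : (N : ℝ) * ε ≤ n * ε := by gcongr
  linarith

end Sizes

section SequenceEntropy

variable {𝒳 𝔅 : Type} [Fintype 𝒳] [Fintype 𝔅] {PX : 𝒳 → ℝ} {Q : 𝒳 → 𝔅 → ℝ}

lemma ent_seqXQ {γ γ' : Type} [Fintype γ] [Fintype γ'] {n : ℕ} {p : 𝒳 × 𝔅 → ℝ} (hp : IsPMF p)
    (hfac : ∀ x b, p (x, b) = PX x * Q x b) (F : 𝒳 × 𝔅 → γ)
    (G : (Fin n → 𝒳) × (Fin n → 𝔅) → γ')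
    (hG : ∀ s t, G s = G t ↔ ∀ i, F (s.1 i, s.2 i) = F (t.1 i, t.2 i)) :
    ent (seqXQ PX Q) G = n * ent p F := by
  let s := Equiv.arrowProdEquivProdArrow (Fin n) (fun _ => 𝒳) (fun _ => 𝔅)
  have hs : pmass (fun ω : Fin n → 𝒳 × 𝔅 => ∏ i, p (ω i)) s = seqXQ PX Q := by
    funext t
    rw [pmass_eq]
    simp_rw [fun ω => show (s ω = t) = (ω = s.symm t) from propext s.eq_symm_apply.symm]
    rw [sum_mul_ind_eq, seqXQ, seqX, seqQ, ← prod_mul_distrib]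
    exact prod_congr rfl fun i _ => hfac _ _
  rw [← hs, ent_map, ← ent_pi hp F n]
  exact ent_congr_iff _ fun ω ω' => (hG _ _).trans funext_iff.symm

lemma ent_le_ent_pair {Ω α β : Type*} [Fintype Ω] [Fintype α] [Fintype β] {μ : Ω → ℝ}
    (hμ : IsPMF μ) (X : Ω → α) (Y : Ω → β) : ent μ Y ≤ ent μ (fun ω => (X ω, Y ω)) := by
  have h := ent_submodular hμ X X Y
  have : ent μ (fun ω => (X ω, X ω, Y ω)) = ent μ (fun ω => (X ω, Y ω)) :=
    ent_congr_iff μ fun _ _ => by simp only [Prod.mk.injEq]; tauto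
  linarith

end SequenceEntropy

namespace HashedBook

variable {𝕌 𝕍 : Type*} {J K B₁ B₂ S n W : ℕ}
  {𝒳 𝒴 𝒵 : Type} [Fintype 𝒳] [Fintype 𝒴] [Fintype 𝒵] {PX : 𝒳 → ℝ} {Q : 𝒳 → 𝒴 × 𝒵 → ℝ}

lemma toCode_performance [Nonempty 𝒳] [Nonempty 𝒵] (c : HashedBook 𝕌 𝕍 (Fin n → 𝒳) J K B₁ B₂ S)
    (hX : IsPMF PX) (hQ : ∀ x, IsPMF (Q x)) (hJ : 0 < J) (hB₂ : 0 < B₂) (w₀ : Fin W) (s₀ : Fin S)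
    {T : 𝕌 → 𝕍 → (Fin n → 𝒳) → (Fin n → 𝒴 × 𝒵) → Prop} {TU : 𝕌 → (Fin n → 𝒴) → Prop}
    {TV : 𝕌 → 𝕍 → (Fin n → 𝒴) → Prop} {TVZ : 𝕌 → 𝕍 → (Fin n → 𝒵) → Prop}
    {TZ : 𝕌 → (Fin n → 𝒵) → Prop} {TX : 𝕍 → (Fin n → 𝒳) → (Fin n → 𝒵) → Prop}
    (hT : ∀ u v x b, T u v x b → (TU u fun i => (b i).1) ∧ (TV u v fun i => (b i).1) ∧
      (TVZ u v fun i => (b i).2) ∧ (TZ u fun i => (b i).2) ∧ TX v x fun i => (b i).2)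
    {f g τ : ℝ} (hf : 0 ≤ f) (hg : 0 ≤ g) (hTZ : ∀ u, ∑ z, ind (TZ u z) ≤ 2 ^ f)
    (hTX : ∀ v z, ∑ x, ind (TX v x z) ≤ 2 ^ g)
    (hτ : avg (seqX PX) (fun x => avg (seqQ Q x) fun b => ind (c.BadOwn T
        (fun u b => TU u fun i => (b i).1) (fun u v b => TV u v fun i => (b i).1)
        (fun u v b => TVZ u v fun i => (b i).2) x b))
      + ((W : ℝ) - 1) * avg (seqX PX) (fun x' => avg (seqX PX) fun x => avg (seqQ Q x) fun b =>
        ind (c.BadOther (fun u b => TU u fun i => (b i).1) x' b)) ≤ τ)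
    {A B : ℝ}
    (hA : 1 + logb 2 J + logb 2 B₂ + f
      + τ * (logb 2 ((J : ℝ) * B₂ + 1) + n * logb 2 (Fintype.card 𝒵)) = A)
    (hB : 1 + g + τ * (n * logb 2 (Fintype.card 𝒳)) = B) (w : Fin W) :
    prob (codeDist PX Q (c.toCode TU TV w₀ s₀) w (𝒵 := 𝒵))
        (fun ω => ¬ ((c.toCode TU TV w₀ s₀).gId (Mbar ω) (Yseq ω) = w ∧
          (c.toCode TU TV w₀ s₀).gAu (Mbar ω) (Yseq ω) = (ω.2.1 w).2)) ≤ τ ∧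
    mutInf (codeDist PX Q (c.toCode TU TV w₀ s₀) w (𝒵 := 𝒵))
        (fun ω => ω.1 w) (fun ω => (Mbar ω, Zseq ω))
      ≤ ent (seqXQ PX Q) (fun p : (Fin n → 𝒳) × (Fin n → 𝒴 × 𝒵) => p.1) + A
        - ent (seqXQ PX Q) (fun p : (Fin n → 𝒳) × (Fin n → 𝒴 × 𝒵) => (p.1, fun i => (p.2 i).2)) ∧
    mutInf (codeDist PX Q (c.toCode TU TV w₀ s₀) w (𝒵 := 𝒵))
        (fun ω => (ω.2.1 w).2) (fun ω => (Mbar ω, Zseq ω))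
      ≤ logb 2 S + A + B
        - ent (seqXQ PX Q) (fun p : (Fin n → 𝒳) × (Fin n → 𝒴 × 𝒵) => (p.1, fun i => (p.2 i).2)) ∧
    ent (seqXQ PX Q) (fun p : (Fin n → 𝒳) × (Fin n → 𝒴 × 𝒵) => (p.1, fun i => (p.2 i).2)) - B - A
      ≤ ent (codeDist PX Q (c.toCode TU TV w₀ s₀) w (𝒵 := 𝒵)) (fun ω => (ω.2.1 w).2) := by
  have hμ : IsPMF (seqXQ PX Q : (Fin n → 𝒳) × (Fin n → 𝒴 × 𝒵) → ℝ) := isPMF_seqXQ hX hQ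
  have hW : (0 : ℝ) ≤ (W : ℝ) - 1 := by
    have : (1 : ℝ) ≤ W := by exact_mod_cast w.pos
    linarith
  have hτ' : prob (seqXQ PX Q) (fun p => c.BadOwn T (fun u b => TU u fun i => (b i).1)
      (fun u v b => TV u v fun i => (b i).1) (fun u v b => TVZ u v fun i => (b i).2) p.1 p.2)
        ≤ τ := by
    rw [prob_eq, sum_seqXQ PX Q fun x b => ind (c.BadOwn T (fun u b => TU u fun i => (b i).1)
      (fun u v b => TV u v fun i => (b i).1) (fun u v b => TVZ u v fun i => (b i).2) x b)]
    refine le_trans (le_add_of_nonneg_right (mul_nonneg hW ?_)) hτ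
    exact avg_nonneg (isPMF_seqX hX).1 fun x' => avg_nonneg (isPMF_seqX hX).1 fun x =>
      avg_nonneg (isPMF_seqQ hQ x).1 fun b => ind_nonneg _
  have hJ' : (0 : ℝ) < J := by exact_mod_cast hJ
  have hB' : (0 : ℝ) < B₂ := by exact_mod_cast hB₂
  have h2 : ∀ x : ℝ, 0 ≤ x → (1 : ℝ) ≤ 2 ^ x := fun x hx => one_le_rpow one_le_two hx
  have h1 : ent (seqXQ PX Q) (fun p : (Fin n → 𝒳) × (Fin n → 𝒴 × 𝒵) =>
      (c.fine p.1, fun i => (p.2 i).2)) ≤ A := by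
    refine (c.ent_fine_le hμ (fun (b : Fin n → 𝒴 × 𝒵) i => (b i).2) TZ
      (fun u v x b h => (hT u v x b h).2.2.2.1) hJ hB₂ (h2 f hf) hTZ hτ').trans_eq ?_
    have hZ : (Fintype.card 𝒵 : ℝ) ≠ 0 := by exact_mod_cast Fintype.card_ne_zero
    rw [← hA, logb_mul hJ'.ne' (by positivity), logb_mul hB'.ne' (by positivity),
      logb_rpow two_pos (by norm_num), Fintype.card_fun, Fintype.card_fin, Nat.cast_pow,
      logb_mul (by positivity) (by positivity), logb_pow]
    ring
  have h3 : ent (seqXQ PX Q) (fun p : (Fin n → 𝒳) × (Fin n → 𝒴 × 𝒵) => (p.1, fun i => (p.2 i).2))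
      - B ≤ ent (seqXQ PX Q) (fun p : (Fin n → 𝒳) × (Fin n → 𝒴 × 𝒵) =>
        (c.keyOf s₀ p.1, c.fine p.1, fun i => (p.2 i).2)) := by
    refine le_trans (sub_le_sub_left (le_of_eq ?_) _)
      (c.ent_key_fine_ge s₀ hμ (fun (b : Fin n → 𝒴 × 𝒵) i => (b i).2) TVZ
        (fun u v x b h => (hT u v x b h).2.2.1) TX (fun u v x b h => (hT u v x b h).2.2.2.2)
        (h2 g hg) hTX hτ')
    rw [← hB, logb_rpow two_pos (by norm_num), Fintype.card_fun, Fintype.card_fin, Nat.cast_pow,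
      logb_pow]
  have hkey : ∀ ω, codeDist PX Q (c.toCode TU TV w₀ s₀) w ω ≠ 0 →
      (ω.2.1 w).2 = c.keyOf s₀ (ω.1 w) := fun ω hω => by
    rw [c.toCode_support TU TV w₀ s₀ hω w]
  have hkent : ent (codeDist PX Q (c.toCode TU TV w₀ s₀) w (𝒵 := 𝒵)) (fun ω => (ω.2.1 w).2)
      = ent (seqXQ PX Q) (fun p : (Fin n → 𝒳) × (Fin n → 𝒴 × 𝒵) => c.keyOf s₀ p.1) :=
    ent_own_eq hX _ w (fun p => c.keyOf s₀ p.1) hkey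
  refine ⟨(c.toCode_error_le TU TV w₀ s₀ hX hQ T _ (fun u v x b h => (hT u v x b h).1)
    (fun u v x b h => (hT u v x b h).2.1) w).trans hτ, ?_, ?_, ?_⟩
  · refine (c.toCode_mutInf_le TU TV w₀ s₀ hX hQ w (fun x => x) fun _ _ => rfl).trans ?_
    rw [c.mutInf_fine _ fun (b : Fin n → 𝒴 × 𝒵) i => (b i).2]
    linarith
  · refine (c.toCode_mutInf_le TU TV w₀ s₀ hX hQ w (c.keyOf s₀) hkey).trans ?_
    have : Nonempty (Fin S) := ⟨s₀⟩
    have := ent_le_logb_card hμ (fun p => c.keyOf s₀ p.1)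
    rw [Fintype.card_fin] at this
    unfold mutInf
    linarith
  · have := mutInf_nonneg hμ (fun p => c.keyOf s₀ p.1) (fun p => (c.fine p.1, fun i => (p.2 i).2))
    unfold mutInf at this
    rw [hkent]
    linarith

end HashedBook

lemma IsPMF.nonempty {Ω : Type*} [Fintype Ω] {μ : Ω → ℝ} (hμ : IsPMF μ) : Nonempty Ω := by
  by_contra h
  rw [not_nonempty_iff] at h
  exact zero_ne_one ((sum_of_isEmpty univ).symm.trans hμ.2)

section BlockCode

variable {𝒰 𝒱 𝒳 𝒴 𝒵 : Type} [Fintype 𝒰] [Fintype 𝒱] [Fintype 𝒳] [Fintype 𝒴] [Fintype 𝒵]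
  {PX : 𝒳 → ℝ} {Q : 𝒳 → 𝒴 × 𝒵 → ℝ} {PVX : 𝒳 → 𝒱 → ℝ} {PUV : 𝒱 → 𝒰 → ℝ}

lemma pmass_slDist_XYZ (hPVX : ∀ x, IsPMF (PVX x)) (hPUV : ∀ v, IsPMF (PUV v)) (x : 𝒳)
    (b : 𝒴 × 𝒵) : pmass (slDist PX Q PVX PUV) (fun ω => (ω.2.2.1, ω.2.2.2)) (x, b)
      = PX x * Q x b := by
  rw [pmass_eq, sum_slDist fun _ _ x' b' => ind ((x', b') = (x, b))]
  simp_rw [fun v c => avg_const (hPUV v) c, fun x c => avg_const (hPVX x) c, Prod.mk.injEq, ind_and,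
    avg, mul_left_comm _ (ind (_ = x)), ← mul_sum, sum_mul_ind_eq]
  rw [← sum_mul_ind_eq x fun x => PX x * Q x b]
  exact sum_congr rfl fun x' _ => by ring

lemma ent_seqXQ_slDist {γ γ' : Type} [Fintype γ] [Fintype γ'] {n : ℕ} (hPX : IsPMF PX)
    (hQ : ∀ x, IsPMF (Q x)) (hPVX : ∀ x, IsPMF (PVX x)) (hPUV : ∀ v, IsPMF (PUV v))
    (F : 𝒳 × 𝒴 × 𝒵 → γ) (G : (Fin n → 𝒳) × (Fin n → 𝒴 × 𝒵) → γ')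
    (hG : ∀ s t, G s = G t ↔ ∀ i, F (s.1 i, s.2 i) = F (t.1 i, t.2 i)) :
    ent (seqXQ PX Q) G = n * ent (slDist PX Q PVX PUV) (fun ω => F (ω.2.2.1, ω.2.2.2)) := by
  rw [ent_seqXQ (isPMF_pmass (isPMF_slDist hPX hQ hPVX hPUV) _) (pmass_slDist_XYZ hPVX hPUV) F G hG,
    ent_map]

set_option maxHeartbeats 400000 in
theorem exists_blockCode (hPX : IsPMF PX) (hQ : ∀ x, IsPMF (Q x)) (hPVX : ∀ x, IsPMF (PVX x))
    (hPUV : ∀ v, IsPMF (PUV v)) {r : ℝ} (hr : 0 ≤ r)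
    (hrI : r ≤ mutInf (slDist PX Q PVX PUV) (fun ω => ω.2.2.2.1) (fun ω => ω.1))
    (hS : 0 ≤ condMutInf (slDist PX Q PVX PUV)
          (fun ω => ω.2.1) (fun ω => ω.2.2.2.1) (fun ω => ω.1)
        - condMutInf (slDist PX Q PVX PUV)
          (fun ω => ω.2.1) (fun ω => ω.2.2.2.2) (fun ω => ω.1))
    {η : ℝ} (hη : 0 < η) :
    ∃ N : ℕ, ∀ n ≥ N, ∃ (Mc Wc Sc : ℕ) (C : IACode 𝒳 𝒴 n Mc Wc Sc),
      n * (r - η) ≤ logb 2 Wc ∧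
      logb 2 Mc ≤ n * (r + condMutInf (slDist PX Q PVX PUV)
        (fun ω => ω.2.2.1) (fun ω => ω.2.1) (fun ω => ω.2.2.2.1) + η) + 8 ∧
      ∀ w : Fin Wc,
        prob (codeDist PX Q C w (𝒵 := 𝒵)) (fun ω => ¬ (C.gId (Mbar ω) (Yseq ω) = w ∧
          C.gAu (Mbar ω) (Yseq ω) = (ω.2.1 w).2)) ≤ η ∧
        mutInf (codeDist PX Q C w (𝒵 := 𝒵)) (fun ω => ω.1 w) (fun ω => (Mbar ω, Zseq ω))
          ≤ n * (mutInf (slDist PX Q PVX PUV) (fun ω => ω.2.2.1) (fun ω => (ω.2.1, ω.2.2.2.1))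
            - condMutInf (slDist PX Q PVX PUV)
              (fun ω => ω.2.2.1) (fun ω => ω.2.2.2.1) (fun ω => ω.1)
            + condMutInf (slDist PX Q PVX PUV)
              (fun ω => ω.2.2.1) (fun ω => ω.2.2.2.2) (fun ω => ω.1) + η) + 8 ∧
        mutInf (codeDist PX Q C w (𝒵 := 𝒵)) (fun ω => (ω.2.1 w).2) (fun ω => (Mbar ω, Zseq ω))
          ≤ n * η + 8 ∧
        n * (condMutInf (slDist PX Q PVX PUV)
            (fun ω => ω.2.1) (fun ω => ω.2.2.2.1) (fun ω => ω.1)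
          - condMutInf (slDist PX Q PVX PUV)
            (fun ω => ω.2.1) (fun ω => ω.2.2.2.2) (fun ω => ω.1) - η) - 8
          ≤ ent (codeDist PX Q C w (𝒵 := 𝒵)) (fun ω => (ω.2.1 w).2) := by
  have hμ := isPMF_slDist hPX hQ hPVX hPUV
  have hmX := pmass_slDist_X (PX := PX) hQ hPVX hPUV
  have hfac := slDist_factor hPX hQ hPVX hPUV
  have hseqX := fun n : ℕ => ent_seqXQ_slDist (n := n) hPX hQ hPVX hPUV (fun t => t.1)
    (fun p => p.1) fun s t => funext_iff
  have hseqXZ := fun n : ℕ => ent_seqXQ_slDist (n := n) hPX hQ hPVX hPUV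
    (fun t => (t.1, t.2.2)) (fun p => (p.1, fun i => (p.2 i).2)) fun s t => by
      simp only [Prod.mk.injEq, funext_iff, forall_and]
  obtain ⟨μ, hdef⟩ : ∃ μ, μ = slDist PX Q PVX PUV := ⟨_, rfl⟩
  rw [← hdef] at hμ hmX hfac hrI hS ⊢
  simp only [← hdef] at hseqX hseqXZ
  obtain ⟨hca, hdb, hI, hC, hL, hK, hH⟩ := slDist_entropies hμ hdef rfl rfl rfl rfl rfl rfl rfl
  have hf := sub_nonneg.2 (ent_le_ent_pair hμ (fun ω => ω.2.2.2.2) (fun ω => ω.1))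
  have hg := sub_nonneg.2 (ent_le_ent_pair hμ (fun ω => ω.2.2.1) (fun ω => (ω.2.1, ω.2.2.2.2)))
  have hb : 0 ≤ ent μ (fun ω => (ω.2.1, ω.1)) + ent μ (fun ω => (ω.1, ω.2.2.1))
      - ent μ (fun ω => (ω.2.1, ω.1, ω.2.2.1)) - ent μ (fun ω => ω.1) := by
    have := ent_submodular hμ (fun ω => ω.2.1) (fun ω => ω.2.2.1) (fun ω => ω.1)
    rw [ent_congr_iff μ (X := fun ω => (ω.2.2.1, ω.1)) (X' := fun ω => (ω.1, ω.2.2.1))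
      fun _ _ => by simp only [Prod.mk.injEq]; tauto,
      ent_congr_iff μ (X := fun ω => (ω.2.1, ω.2.2.1, ω.1)) (X' := fun ω => (ω.2.1, ω.1, ω.2.2.1))
      fun _ _ => by simp only [Prod.mk.injEq]; tauto] at this
    linarith
  have htyp := fun ε θ : ℝ => exists_typical_hashedBook hμ hmX hQ hfac rfl rfl rfl rfl rfl rfl rfl
    (ε := ε) (θ := θ)
  rw [hI] at hrI
  rw [hK] at hS
  rw [hC, hL, hK]
  generalize ent μ (fun ω => ω.1) + ent μ (fun ω => ω.2.2.1)
    - ent μ (fun ω => (ω.1, ω.2.2.1)) = a at *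
  generalize ent μ (fun ω => (ω.2.1, ω.1)) + ent μ (fun ω => (ω.1, ω.2.2.1))
    - ent μ (fun ω => (ω.2.1, ω.1, ω.2.2.1)) - ent μ (fun ω => ω.1) = b at *
  generalize ent μ (fun ω => ω.1) + ent μ (fun ω => ω.2.2.2.1)
    - ent μ (fun ω => (ω.1, ω.2.2.2.1)) = c at *
  generalize ent μ (fun ω => (ω.2.1, ω.1)) + ent μ (fun ω => (ω.1, ω.2.2.2.1))
    - ent μ (fun ω => (ω.2.1, ω.1, ω.2.2.2.1)) - ent μ (fun ω => ω.1) = d at *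
  generalize ent μ (fun ω => (ω.2.1, ω.1)) + ent μ (fun ω => (ω.1, ω.2.2.2.2))
    - ent μ (fun ω => (ω.2.1, ω.1, ω.2.2.2.2)) - ent μ (fun ω => ω.1) = e at *
  generalize ent μ (fun ω => (ω.2.2.2.2, ω.1)) - ent μ (fun ω => ω.1) = f at *
  generalize ent μ (fun ω => (ω.2.2.1, ω.2.1, ω.2.2.2.2))
    - ent μ (fun ω => (ω.2.1, ω.2.2.2.2)) = g at *
  have : Nonempty 𝒳 := hPX.nonempty
  have : Nonempty 𝒵 := ⟨(hQ (Classical.arbitrary 𝒳)).nonempty.some.2⟩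
  have hX0 : 0 ≤ logb 2 (Fintype.card 𝒳) :=
    logb_nonneg one_lt_two (by exact_mod_cast Fintype.card_pos (α := 𝒳))
  have hZ0 : 0 ≤ logb 2 (Fintype.card 𝒵) :=
    logb_nonneg one_lt_two (by exact_mod_cast Fintype.card_pos (α := 𝒵))
  obtain ⟨κ, hκ⟩ : ∃ κ, κ = a + b - d + 6 + logb 2 (Fintype.card 𝒵)
    + logb 2 (Fintype.card 𝒳) := ⟨_, rfl⟩
  have hκ0 : 0 ≤ κ := by linarith
  obtain ⟨ε, hε, hε1, hε2⟩ : ∃ ε : ℝ, 0 < ε ∧ ε ≤ 1 ∧ 16 * ε ≤ η :=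
    ⟨min 1 (η / 16), by positivity, min_le_left _ _, by linarith [min_le_right 1 (η / 16)]⟩
  obtain ⟨τ, hτ, hτ1, hτ2⟩ : ∃ τ : ℝ, 0 < τ ∧ τ ≤ 1 ∧ τ * (κ + 1) ≤ η / 2 :=
    ⟨min 1 (η / 2 / (κ + 1)), by positivity, min_le_left _ _,
      (le_div_iff₀ (by linarith)).1 (min_le_right _ _)⟩
  obtain ⟨N₁, hN₁⟩ := htyp ε (τ / 6) hε (by linarith) (by linarith)
  obtain ⟨N₂, hN₂⟩ := exists_forall_rpow_neg_le hε (show 0 < τ / 84 by linarith)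
  refine ⟨max N₁ N₂, fun n hn => ?_⟩
  have hn0 : (0 : ℝ) ≤ n := n.cast_nonneg
  obtain ⟨J, hJ0, hJ, hJ'⟩ := exists_nat_between (x := n * (a + 2 * ε)) (by
    apply mul_nonneg hn0; linarith)
  obtain ⟨K, hK0, hK, hK'⟩ := exists_nat_between (x := n * (b + 2 * ε)) (by
    apply mul_nonneg hn0; linarith)
  obtain ⟨B₁, hB₁0, hB₁, hB₁'⟩ := exists_nat_between (x := n * (r + a - c + 4 * ε)) (by
    apply mul_nonneg hn0; linarith)
  obtain ⟨B₂, hB₂0, hB₂, hB₂'⟩ := exists_nat_between (x := n * (b - d + 4 * ε)) (by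
    apply mul_nonneg hn0; linarith)
  obtain ⟨S, hS0, hS, hS'⟩ := exists_nat_between (x := n * (d - e)) (mul_nonneg hn0 hS)
  obtain ⟨W, hW⟩ : ∃ W : ℕ, W = ⌈(2 : ℝ) ^ (n * (r - 6 * ε))⌉₊ := ⟨_, rfl⟩
  have hWpos : (0 : ℝ) < 2 ^ (n * (r - 6 * ε)) := rpow_pos_of_pos two_pos _
  have hW0 : 0 < W := hW ▸ Nat.ceil_pos.2 hWpos
  have hW1 : (2 : ℝ) ^ (n * (r - 6 * ε)) ≤ W := hW ▸ Nat.le_ceil _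
  have hW2 : (W : ℝ) - 1 ≤ 2 ^ (n * (r - 6 * ε)) := by
    have := Nat.ceil_lt_add_one hWpos.le
    rw [← hW] at this
    linarith
  have hW3 : (0 : ℝ) ≤ (W : ℝ) - 1 := by
    have : (1 : ℝ) ≤ W := by exact_mod_cast hW0
    linarith
  obtain ⟨cb, T, TU, TV, TVZ, TZ, TX, hT, hTZ, hTX, hsum⟩ :=
    hN₁ n (le_of_max_le_left hn) J K B₁ B₂ S hJ0 hK0 hB₁0 hB₂0 hS0 (W - 1) hW3
  have herr := error_terms_le hn0 hε.le hr hrI hJ hJ' hK hK' hB₁ hB₂ hS hW2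
  have hexp := hN₂ n (le_of_max_le_right hn)
  have lJ := logb_le_of_le_two_mul hJ0 hJ'
  have lB₁ := logb_le_of_le_two_mul hB₁0 hB₁'
  have lB₂ := logb_le_of_le_two_mul hB₂0 hB₂'
  have lS := logb_le_of_le_two_mul hS0 hS'
  have lmul : ∀ {p q : ℕ}, 0 < p → 0 < q →
      logb 2 ((p : ℝ) * q + 1) ≤ 1 + logb 2 p + logb 2 q := fun {p q} hp hq => by
    have hp' : (1 : ℝ) ≤ p := by exact_mod_cast hp
    have hq' : (1 : ℝ) ≤ q := by exact_mod_cast hq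
    have hpq := one_le_mul_of_one_le_of_one_le hp' hq'
    calc logb 2 ((p : ℝ) * q + 1) ≤ logb 2 (2 * p * q) :=
          logb_le_logb_of_le one_lt_two (by positivity) (by linarith)
      _ = 1 + logb 2 p + logb 2 q := by
          rw [logb_mul (by positivity) (by positivity), logb_mul two_ne_zero (by positivity),
            logb_self_eq_one one_lt_two]
  have lJB := lmul hJ0 hB₂0
  have lBB := lmul hB₁0 hB₂0
  have nε : n * (16 * ε) ≤ n * η := by gcongr
  have nτ : n * (τ * (κ + 1)) ≤ n * (η / 2) := by gcongr
  have nε0 : 0 ≤ n * ε := by positivity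
  have hτη : τ ≤ η := by
    have := le_mul_of_one_le_right hτ.le (by linarith : 1 ≤ κ + 1)
    linarith
  have hnτ : 0 ≤ n * τ := by positivity
  have perf := cb.toCode_performance hPX hQ hJ0 hB₂0 ⟨0, hW0⟩ ⟨0, hS0⟩ hT
    (mul_nonneg hn0 (by linarith : 0 ≤ f + ε)) (mul_nonneg hn0 (by linarith : 0 ≤ g + ε))
    hTZ hTX (hsum.trans (by linarith : _ ≤ τ)) rfl rfl
  have hcost : τ * (logb 2 ((J : ℝ) * B₂ + 1) + n * logb 2 (Fintype.card 𝒵))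
      + τ * (n * logb 2 (Fintype.card 𝒳)) ≤ 3 + n * (η / 2) := by
    have h1 : logb 2 ((J : ℝ) * B₂ + 1) + n * logb 2 (Fintype.card 𝒵)
        + n * logb 2 (Fintype.card 𝒳) ≤ 3 + n * κ := by
      have : n * (6 * ε) ≤ n * 6 := by
        apply mul_le_mul_of_nonneg_left _ hn0; linarith
      rw [hκ]
      linarith
    have h2 := mul_le_mul_of_nonneg_left h1 hτ.le
    linarith
  have hcostX : 0 ≤ τ * (n * logb 2 (Fintype.card 𝒳)) := by positivity
  refine ⟨_, W, S, cb.toCode TU TV ⟨0, hW0⟩ ⟨0, hS0⟩, ?_, ?_, fun w => ?_⟩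
  · rw [le_logb_iff_rpow_le one_lt_two (by exact_mod_cast hW0)]
    refine le_trans (rpow_le_rpow_of_exponent_le one_le_two ?_) hW1
    apply mul_le_mul_of_nonneg_left _ hn0
    linarith
  · push_cast
    linarith
  · obtain ⟨p₁, p₂, p₃, p₄⟩ := perf w
    rw [hseqX, hseqXZ] at p₂
    rw [hseqXZ, ← hH] at p₃ p₄
    refine ⟨p₁.trans hτη, p₂.trans ?_, p₃.trans ?_, le_trans ?_ p₄⟩
    · linarith
    · linarith
    · linarith

end BlockCode

/-- **Achievability part of Theorem 1.**  If there exist finite `U`, `V` with joint law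
`P_{X,Y,Z} P_{V|X} P_{U|V}` such that `R_I ≤ I(Y;U)`, `R_C ≥ R_I + I(X;V|Y)`,
`L ≥ I(X;V,Y) − I(X;Y|U) + I(X;Z|U)` and `R_S ≤ I(V;Y|U) − I(V;Z|U)`, then
`(R_I, R_C, L, R_S)` is achievable. -/
theorem theorem1_achievability
    {𝒳 𝒴 𝒵 : Type} [Fintype 𝒳] [Fintype 𝒴] [Fintype 𝒵]
    (PX : 𝒳 → ℝ) (hPX : IsPMF PX)
    (Q : 𝒳 → 𝒴 × 𝒵 → ℝ) (hQ : ∀ x, IsPMF (Q x))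
    (RI RC L RS : ℝ) (hRI : 0 ≤ RI) (hRC : 0 ≤ RC) (hL : 0 ≤ L) (hRS : 0 ≤ RS)
    {𝒰 𝒱 : Type} [Fintype 𝒰] [Fintype 𝒱]
    (PVX : 𝒳 → 𝒱 → ℝ) (hPVX : ∀ x, IsPMF (PVX x))
    (PUV : 𝒱 → 𝒰 → ℝ) (hPUV : ∀ v, IsPMF (PUV v))
    -- R_I ≤ I(Y;U)
    (hRIc : RI ≤ mutInf (slDist PX Q PVX PUV) (fun ω => ω.2.2.2.1) (fun ω => ω.1))
    -- R_C ≥ R_I + I(X;V|Y)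
    (hRCc : RI + condMutInf (slDist PX Q PVX PUV)
        (fun ω => ω.2.2.1) (fun ω => ω.2.1) (fun ω => ω.2.2.2.1) ≤ RC)
    -- L ≥ I(X;V,Y) − I(X;Y|U) + I(X;Z|U)
    (hLc : mutInf (slDist PX Q PVX PUV) (fun ω => ω.2.2.1) (fun ω => (ω.2.1, ω.2.2.2.1))
        - condMutInf (slDist PX Q PVX PUV) (fun ω => ω.2.2.1) (fun ω => ω.2.2.2.1) (fun ω => ω.1)
        + condMutInf (slDist PX Q PVX PUV) (fun ω => ω.2.2.1) (fun ω => ω.2.2.2.2) (fun ω => ω.1)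
        ≤ L)
    -- R_S ≤ I(V;Y|U) − I(V;Z|U)
    (hRSc : RS ≤ condMutInf (slDist PX Q PVX PUV)
          (fun ω => ω.2.1) (fun ω => ω.2.2.2.1) (fun ω => ω.1)
        - condMutInf (slDist PX Q PVX PUV)
          (fun ω => ω.2.1) (fun ω => ω.2.2.2.2) (fun ω => ω.1)) :
    Achievable1 PX Q RI RC L RS := by

  intro δ hδ
  obtain ⟨N, hN⟩ := exists_blockCode hPX hQ hPVX hPUV hRI hRIc (hRS.trans hRSc) (half_pos hδ)
  have hcode : ∀ n, ∃ (Mc Wc Sc : ℕ) (C : IACode 𝒳 𝒴 n Mc Wc Sc), n ≥ N → _ := fun n => by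
    by_cases h : n ≥ N
    · obtain ⟨Mc, Wc, Sc, C, hC⟩ := hN n h
      exact ⟨Mc, Wc, Sc, C, fun _ => hC⟩
    · exact ⟨1, 1, 1, ⟨fun _ _ _ => 1, fun _ _ => ⟨fun _ => zero_le_one, by simp⟩,
        fun _ _ => 0, fun _ _ => 0⟩, fun h' => absurd h' h⟩
  choose Mc Wc Sc C hC using hcode
  obtain ⟨N', hN'⟩ := exists_nat_ge (16 / δ)
  refine ⟨Mc, Wc, Sc, C, max (max N N') 1, fun n hn => ?_⟩
  have hn0 : (0 : ℝ) < n := by exact_mod_cast le_of_max_le_right hn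
  have h8 : 8 ≤ n * (δ / 2) := by
    have h1 : (N' : ℝ) ≤ n := by exact_mod_cast le_of_max_le_right (le_of_max_le_left hn)
    have h2 := (div_le_iff₀ hδ).1 (hN'.trans h1)
    linarith
  have scale_le : ∀ {x y : ℝ}, x ≤ n * y → 1 / (n : ℝ) * x ≤ y := fun {x y} h => by
    rw [one_div_mul_eq_div, div_le_iff₀ hn0]
    linarith
  have le_scale : ∀ {x y : ℝ}, n * y ≤ x → y ≤ 1 / (n : ℝ) * x := fun {x y} h => by
    rw [one_div_mul_eq_div, le_div_iff₀ hn0]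
    linarith
  obtain ⟨hW, hM, hw⟩ := hC n (le_of_max_le_left (le_of_max_le_left hn))
  have hRCn := mul_le_mul_of_nonneg_left hRCc hn0.le
  have hLn := mul_le_mul_of_nonneg_left hLc hn0.le
  have hRSn := mul_le_mul_of_nonneg_left hRSc hn0.le
  refine ⟨fun w => (hw w).1.trans (by linarith), le_scale ?_, scale_le ?_,
    fun w => scale_le ?_, fun w => scale_le ?_, fun w => le_scale ?_⟩
  · linarith
  · linarith
  · linarith [(hw w).2.1]
  · linarith [(hw w).2.2.1]
  · linarith [(hw w).2.2.2]
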